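/- arXiv:2410.22714 — 3 statements merged into one kernel-verified Lean document; each statement's English description precedes it below -/
import Mathlib

section
/- (Main Theorem.) Let b ∈ ℤ[i] be fourth-power-free with factorization b = i^{s_b}(1+i)^{t_b} p₁^{r₁}⋯p_M^{r_M} q₁²⋯q_N² (s_b, t_b ∈ {0,1,2,3}, r_i ∈ {1,3}, the p_i, q_j distinct primary primes). Let V' be the set consisting of all p_i together with those q_j satisfying deg^{(1,3)}(q_j) ≡ m_{q_j} t_b + n_{q_j} s_b (mod 2). Define the matrix L_b' over 𝔽₂ indexed by V' by: off-diagonal entries (L_b')_{v,w} := e(v→w) mod 2; diagonal entries (L_b')_{v,v} := deg(v) + c_v mod 2, where c_{p_i} := 1 if deg^{(2)}(p_i) ≢ m_{p_i} t_b + n_{p_i} s_b (mod 2) and 0 otherwise, and c_{q_j} := 1 if deg^{(1)}(q_j) + 3·deg^{(3)}(q_j) ≡ m_{q_j} t_b + n_{q_j} s_b + 2(n_{q_j} + 1) (mod 4) and 0 otherwise. Let d = i^{s_d}(1+i)^{t_d} ∏_{v ∈ V_d} v (s_d, t_d ∈ {0,1}) be a square-free divisor of b, and set b₀ := b/(1+i)^{t_b},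 d₀ := d/(1+i)^{t_d}. Then C_d(ℚ(i)_v) ≠ ∅ for every prime v dividing (1+i)·b if and only if all three of the following hold: (0) V_d ⊆ V'; (1) L_b' · 𝟙^{(d)} = y^{(s_d,t_d)}, where 𝟙^{(d)} ∈ 𝔽₂^{V'} has v-entry 1 exactly when v ∣ d and y^{(s_d,t_d)}_v := m_v t_d + n_v s_d mod 2; (2) at least one of: (A) t_b ≡ t_d (mod 2) and b₀ ≡ d₀(ε − d₀(1+i)^{4k+t_b}) (mod (1+i)⁵) for some k ∈ {0,1,2}, ε ∈ {1,−1}; (B) t_d = 0 and b·(1+i)^{4k} ≡ d₀(ε − d₀) (mod (1+i)⁵) for some k ∈ {0,1,2}, ε ∈ {1,−1}; (C) t_b = 2t_d and b₀ ≡ −d₀(d₀ − α₀²(1+i)^{2k−t_d}) (mod (1+i)⁷) for some k ∈ {1,2,3,4} and some odd α₀ ∈ ℤ[i]. -/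
open IsDedekindDomain

noncomputable section

/-- The element `i` of the Gaussian integers `ℤ[i]`. -/
def ii : GaussianInt := ⟨0, 1⟩

/-- The element `1 + i` of `ℤ[i]`. -/
def tt : GaussianInt := 1 + ii

/-- A Gaussian integer is *primary* if it is `≡ 1 (mod (1+i)³)`. -/
def IsPrimary (α : GaussianInt) : Prop := tt ^ 3 ∣ (α - 1)

/-- A Gaussian integer `b` is *fourth-power-free* if no fourth power of a prime divides it. -/
def FourthPowerFree (b : GaussianInt) : Prop := ∀ p : GaussianInt, Prime p → ¬ p ^ 4 ∣ b

/-- `HasLocalPoint b d π` says that the homogeneous space `C_d : d·w² = d² − 4·b·z⁴` has a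
point in the completion `ℚ(i)_π` of `ℚ(i)` at the prime `π`, i.e. either the affine equation
`d·w² = d² − 4·b·z⁴` has a solution there, or `b/d` is a square there (the two points at
infinity are rational).  This is the meaning of `C_d(ℚ(i)_π) ≠ ∅`. -/
def HasLocalPoint (b d π : GaussianInt) : Prop :=
  ∀ v : HeightOneSpectrum GaussianInt, v.asIdeal = Ideal.span {π} →
    (∃ z w : v.adicCompletion (FractionRing GaussianInt),
        algebraMap GaussianInt _ d * w ^ 2
          = (algebraMap GaussianInt _ d) ^ 2 - 4 * algebraMap GaussianInt _ b * z ^ 4)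
    ∨ (∃ u : v.adicCompletion (FractionRing GaussianInt),
        u ^ 2 * algebraMap GaussianInt _ d = algebraMap GaussianInt _ b)

/-- The natural reduction `ℤ/4ℤ → ℤ/2ℤ`. -/
def c2 : ZMod 4 →+* ZMod 2 := ZMod.castHom (show (2:ℕ) ∣ 4 by norm_num) (ZMod 2)

variable {M N : ℕ}

/-- Partial out-degree: the sum `Σ_{w ∈ S} e(v→w)` of edge weights from `v` into a set `S`
of vertices, an element of `ℤ/4ℤ`. -/
def degSub (E : (Fin M ⊕ Fin N) → (Fin M ⊕ Fin N) → ZMod 4)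
    (S : Finset (Fin M ⊕ Fin N)) (v : Fin M ⊕ Fin N) : ZMod 4 :=
  ∑ w ∈ S, E v w

/-- `deg^{(k)}(v)` for `k ∈ {1,3}`: sum of edge weights from `v` to vertices `p_i` with
`r_i = k`. -/
def degP (E : (Fin M ⊕ Fin N) → (Fin M ⊕ Fin N) → ZMod 4) (r : Fin M → ℕ) (k : ℕ)
    (v : Fin M ⊕ Fin N) : ZMod 4 :=
  degSub E ((Finset.univ.filter fun i => r i = k).image Sum.inl) v

/-- `deg^{(2)}(v)`: sum of edge weights from `v` to the vertices `q_j`. -/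
def degQ (E : (Fin M ⊕ Fin N) → (Fin M ⊕ Fin N) → ZMod 4) (v : Fin M ⊕ Fin N) : ZMod 4 :=
  degSub E (Finset.univ.image Sum.inr) v

/-- `deg^{(1,3)}(v) = deg^{(1)}(v) + deg^{(3)}(v)`. -/
def degP13 (E : (Fin M ⊕ Fin N) → (Fin M ⊕ Fin N) → ZMod 4) (r : Fin M → ℕ)
    (v : Fin M ⊕ Fin N) : ZMod 4 :=
  degP E r 1 v + degP E r 3 v

namespace LocalField

open WithZero Topology Filter

variable (v : HeightOneSpectrum GaussianInt)

/-- The valuation on the completion. -/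
abbrev val : Valuation (v.adicCompletion (FractionRing GaussianInt)) (WithZero (Multiplicative ℤ)) :=
  Valued.v

/-- The embedding of the Gaussian integers in the completion. -/
abbrev emb : GaussianInt →+* v.adicCompletion (FractionRing GaussianInt) :=
  algebraMap GaussianInt (v.adicCompletion (FractionRing GaussianInt))

lemma val_emb (g : GaussianInt) : val v (emb v g) = v.intValuation g := by
  rw [← HeightOneSpectrum.valuation_of_algebraMap (K := FractionRing GaussianInt)]
  exact HeightOneSpectrum.valuedAdicCompletion_eq_valuation v g

variable {v} {ϖ : GaussianInt}

lemma val_emb_le_iff (hv : v.asIdeal = Ideal.span {ϖ}) (g : GaussianInt) (n : ℕ) :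
    val v (emb v g) ≤ exp (-(n : ℤ)) ↔ ϖ ^ n ∣ g := by
  rw [val_emb, HeightOneSpectrum.intValuation_le_pow_iff_mem, hv, Ideal.span_singleton_pow,
    Ideal.mem_span_singleton]

lemma val_emb_le_one (g : GaussianInt) : val v (emb v g) ≤ 1 := by
  rw [val_emb]; exact v.intValuation_le_one g

lemma val_emb_eq_one_iff (hv : v.asIdeal = Ideal.span {ϖ}) (g : GaussianInt) :
    val v (emb v g) = 1 ↔ ¬ ϖ ∣ g := by
  rw [val_emb, HeightOneSpectrum.intValuation_eq_one_iff, hv, Ideal.mem_span_singleton]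

lemma val_uniformizer (hϖ : ϖ ≠ 0) (hv : v.asIdeal = Ideal.span {ϖ}) :
    val v (emb v ϖ) = exp (-1 : ℤ) := by
  rw [val_emb]; exact v.intValuation_singleton hϖ hv

lemma emb_injective : Function.Injective (emb v) := by
  refine (injective_iff_map_eq_zero _).2 fun g hg => ?_
  by_contra h
  apply v.intValuation_ne_zero g h
  rw [← val_emb, hg, map_zero]

lemma exists_zpow_mul_unit (hϖ : ϖ ≠ 0) (hv : v.asIdeal = Ideal.span {ϖ})
    {x : v.adicCompletion (FractionRing GaussianInt)} (hx : x ≠ 0) :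
    ∃ (k : ℤ) (u : v.adicCompletion (FractionRing GaussianInt)), val v u = 1 ∧
      x = emb v ϖ ^ k * u := by
  have hx' : val v x ≠ 0 := (Valuation.ne_zero_iff _).2 hx
  have hp : emb v ϖ ≠ 0 := fun h => hϖ (emb_injective (by rw [h, map_zero]))
  refine ⟨-log (val v x), emb v ϖ ^ (log (val v x)) * x, ?_, ?_⟩
  · rw [map_mul, map_zpow₀, val_uniformizer hϖ hv, ← exp_zsmul, smul_eq_mul, mul_neg_one]
    nth_rewrite 2 [← exp_log hx']
    rw [← exp_add]; simp
  · rw [← mul_assoc, ← zpow_add₀ hp]; simp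

lemma mem_nhds_of_val {x : v.adicCompletion (FractionRing GaussianInt)} (n : ℤ) :
    {y | val v (y - x) < exp n} ∈ 𝓝 x := by
  obtain ⟨ϖ, hv⟩ := (inferInstance : v.asIdeal.IsPrincipal)
  have hv : v.asIdeal = Ideal.span {ϖ} := hv
  have hϖ : ϖ ≠ 0 := by
    rintro rfl
    exact v.ne_bot (by rw [hv]; simp)
  rw [Valued.mem_nhds]
  have h0 : (Valued.v.restrict (emb v ϖ ^ (-n)) : _) ≠ 0 := by
    intro h
    rw [Valuation.restrict_eq_zero_iff, map_zpow₀] at h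
    have := val_uniformizer hϖ hv
    unfold val at this
    rw [this, ← exp_zsmul] at h
    exact exp_ne_zero h
  refine ⟨Units.mk0 _ h0, fun y hy => ?_⟩
  simp only [Units.val_mk0, Set.mem_ofPred_eq] at hy ⊢
  rw [Valuation.restrict_lt_iff, map_zpow₀] at hy
  have := val_uniformizer hϖ hv
  unfold val at this
  rw [this, ← exp_zsmul] at hy
  simpa using hy

lemma exists_of_mem_nhds {x : v.adicCompletion (FractionRing GaussianInt)} {s : Set _}
    (hs : s ∈ 𝓝 x) : ∃ n : ℤ, {y | val v (y - x) < exp n} ⊆ s := by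
  obtain ⟨γ, hγ⟩ := Valued.mem_nhds.1 hs
  have h0 : MonoidWithZeroHom.ValueGroup₀.embedding γ.1 ≠ 0 := by
    intro h
    have := MonoidWithZeroHom.ValueGroup₀.embedding_strictMono.injective
      (h.trans (map_zero _).symm)
    exact γ.ne_zero this
  refine ⟨log (MonoidWithZeroHom.ValueGroup₀.embedding γ.1), fun y hy => hγ ?_⟩
  rw [Set.mem_ofPred_eq, exp_log h0] at hy
  exact (Valuation.restrict_lt_iff_lt_embedding _).2 hy

lemma exists_emb_near (x : v.adicCompletion (FractionRing GaussianInt)) (hx : val v x ≤ 1)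
    (n : ℕ) : ∃ g : GaussianInt, val v (x - emb v g) ≤ exp (-(n : ℤ)) := by
  have hd := HeightOneSpectrum.denseRange_algebraMap (R := GaussianInt)
    (K := FractionRing GaussianInt) v
  obtain ⟨y, ⟨k, rfl⟩, hy⟩ := hd.inter_nhds_nonempty (mem_nhds_of_val (x := x) (-(n : ℤ)))
  rw [Set.mem_ofPred_eq] at hy
  have hk : v.valuation (FractionRing GaussianInt) k ≤ 1 := by
    rw [← HeightOneSpectrum.valuedAdicCompletion_eq_valuation']
    have h1 : val v (algebraMap (FractionRing GaussianInt)
      (v.adicCompletion (FractionRing GaussianInt)) k - x + x) ≤ 1 := by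
      refine (Valuation.map_add _ _ _).trans (max_le (hy.le.trans ?_) hx)
      rw [← exp_zero, exp_le_exp]; omega
    rw [sub_add_cancel] at h1
    exact h1
  obtain ⟨a, ha⟩ := v.exists_valuation_sub_lt_of_integer hk
    (Units.mk0 (exp (-(n : ℤ))) exp_ne_zero)
  refine ⟨a, ?_⟩
  have h2 : val v (emb v a - algebraMap (FractionRing GaussianInt)
      (v.adicCompletion (FractionRing GaussianInt)) k) < exp (-(n : ℤ)) := by
    have := HeightOneSpectrum.valuedAdicCompletion_eq_valuation' v
      (algebraMap GaussianInt (FractionRing GaussianInt) a - k)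
    rw [Units.val_mk0, ← this] at ha
    convert! ha using 2
    exact (map_sub (algebraMap (FractionRing GaussianInt)
      (v.adicCompletion (FractionRing GaussianInt))) _ _).symm
  rw [Valuation.map_sub_swap]
  have := Valuation.map_add_lt _ h2 hy
  rw [sub_add_sub_cancel] at this
  exact this.le

/-- The iteration `t ↦ c - t²` started at `0`. -/
def artinSchreierIter {F : Type*} [Field F] (c : F) : ℕ → F
  | 0 => 0
  | n + 1 => c - artinSchreierIter c n ^ 2

lemma val_artinSchreierIter {F Γ : Type*} [Field F] [LinearOrderedCommGroupWithZero Γ]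
    (w : Valuation F Γ) {c : F} (hc : w c < 1) (n : ℕ) : w (artinSchreierIter c n) ≤ w c := by
  induction n with
  | zero => simp [artinSchreierIter]
  | succ n ih =>
    rw [artinSchreierIter]
    refine (Valuation.map_sub _ _ _).trans (max_le le_rfl ?_)
    rw [map_pow, pow_two]
    calc _ ≤ w (artinSchreierIter c n) * 1 := mul_le_mul_right (ih.trans hc.le) _
      _ ≤ _ := by rw [mul_one]; exact ih

lemma val_artinSchreierIter_sub {F Γ : Type*} [Field F] [LinearOrderedCommGroupWithZero Γ]
    (w : Valuation F Γ) {c : F} (hc : w c < 1) (n : ℕ) :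
    w (artinSchreierIter c (n + 1) - artinSchreierIter c n) ≤ w c ^ (n + 1) := by
  induction n with
  | zero => simp [artinSchreierIter]
  | succ n ih =>
    have : artinSchreierIter c (n + 1 + 1) - artinSchreierIter c (n + 1) =
        -((artinSchreierIter c (n + 1) - artinSchreierIter c n) *
          (artinSchreierIter c (n + 1) + artinSchreierIter c n)) := by
      rw [artinSchreierIter.eq_2 c (n + 1), artinSchreierIter.eq_2 c n]; ring
    rw [this, Valuation.map_neg, map_mul, pow_succ]
    exact mul_le_mul' ih ((Valuation.map_add _ _ _).trans
      (max_le (val_artinSchreierIter w hc _) (val_artinSchreierIter w hc _)))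

/-- Hensel's lemma for `T² + T - c`. -/
lemma exists_sq_add_self (c : v.adicCompletion (FractionRing GaussianInt)) (hc : val v c < 1) :
    ∃ t, t ^ 2 + t = c ∧ val v t ≤ val v c := by
  let f := artinSchreierIter c
  have fs : ∀ n, f (n + 1) = c - f n ^ 2 := fun n => rfl
  have hb : ∀ n, val v (f n) ≤ val v c := val_artinSchreierIter _ hc
  have hdiff : ∀ n, val v (f (n + 1) - f n) ≤ val v c ^ (n + 1) :=
    val_artinSchreierIter_sub _ hc
  have hna : NonarchimedeanAddGroup (v.adicCompletion (FractionRing GaussianInt)) := by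
    refine ⟨fun U hU => ?_⟩
    obtain ⟨n, hn⟩ := exists_of_mem_nhds hU
    simp only [sub_zero] at hn
    let V := (val v).ltAddSubgroup (Units.mk0 (exp n) exp_ne_zero)
    have hV : (V : Set (v.adicCompletion (FractionRing GaussianInt))) ∈ 𝓝 0 := by
      have := mem_nhds_of_val (v := v) (x := 0) n
      simp only [sub_zero] at this
      exact this
    exact ⟨⟨V, AddSubgroup.isOpen_of_mem_nhds V hV⟩, hn⟩
  have hpow : Tendsto (fun n => f (n + 1) - f n) atTop (𝓝 0) := by
    refine tendsto_def.2 fun s hs => ?_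
    obtain ⟨m, hm⟩ := exists_of_mem_nhds hs
    rcases eq_or_ne c 0 with rfl | hc0
    · filter_upwards with n
      have := hdiff n
      rw [map_zero, zero_pow (by omega)] at this
      apply hm
      simp only [Set.mem_ofPred_eq, sub_zero]
      exact lt_of_le_of_lt this (exp_pos)
    have hc0' : val v c ≠ 0 := (Valuation.ne_zero_iff _).2 hc0
    have hl : log (val v c) < 0 := by
      rw [← exp_lt_exp, exp_log hc0', exp_zero]; exact hc
    filter_upwards [eventually_ge_atTop (m.natAbs)] with n hn
    apply hm
    simp only [Set.mem_ofPred_eq, sub_zero]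
    refine lt_of_le_of_lt (hdiff n) ?_
    rw [← exp_log hc0', ← exp_nsmul, exp_lt_exp, nsmul_eq_mul]
    push_cast
    have : -(m.natAbs : ℤ) ≤ m := by omega
    have : (n : ℤ) ≥ m.natAbs := by exact_mod_cast hn
    nlinarith
  have hcau : CauchySeq f := NonarchimedeanAddGroup.cauchySeq_of_tendsto_sub_nhds_zero hpow
  obtain ⟨t, ht⟩ := cauchySeq_tendsto_of_complete hcau
  have h1 : Tendsto (fun n => f (n + 1)) atTop (𝓝 t) := ht.comp (tendsto_add_atTop_nat 1)
  have h2 : Tendsto (fun n => f (n + 1)) atTop (𝓝 (c - t ^ 2)) := by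
    simp_rw [fs]
    exact tendsto_const_nhds.sub (ht.pow 2)
  have he := tendsto_nhds_unique h1 h2
  refine ⟨t, by linear_combination he, ?_⟩
  by_contra hlt
  push Not at hlt
  have hcl : {y | val v (y - t) < val v t} ∈ 𝓝 t := by
    have ht0 : val v t ≠ 0 := (lt_of_le_of_lt zero_le hlt).ne'
    have := mem_nhds_of_val (x := t) (log (val v t))
    rwa [exp_log ht0] at this
  obtain ⟨n, hn⟩ := (ht.eventually hcl).exists
  have : val v t = val v (f n) := by
    have := Valuation.map_eq_of_sub_lt _ hn
    exact this.symm
  exact absurd (hb n) (by rw [← this]; exact not_le.2 hlt)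

end LocalField

namespace LocalField

open WithZero

/-- The genus one curve `W² = A X⁴ + B Y⁴` has a point. -/
def QuarticSolvable {F : Type*} [Field F] (A B : F) : Prop :=
  ∃ X Y W : F, (X ≠ 0 ∨ Y ≠ 0) ∧ W ^ 2 = A * X ^ 4 + B * Y ^ 4

section Generic

variable {F : Type*} [Field F] {A B : F}

lemma QuarticSolvable.symm (h : QuarticSolvable A B) : QuarticSolvable B A := by
  obtain ⟨X, Y, W, h, e⟩ := h
  exact ⟨Y, X, W, h.symm, by rw [e]; ring⟩

lemma QuarticSolvable.of_isSquare_left (h : IsSquare A) : QuarticSolvable A B := by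
  obtain ⟨y, hy⟩ := h
  exact ⟨1, 0, y, Or.inl one_ne_zero, by rw [hy]; ring⟩

lemma QuarticSolvable.of_isSquare_right (h : IsSquare B) : QuarticSolvable A B :=
  (QuarticSolvable.of_isSquare_left h).symm

lemma isSquare_of_sq_eq {X W : F} (hX : X ≠ 0) (h : W ^ 2 = A * X ^ 4) : IsSquare A :=
  ⟨W / X ^ 2, by field_simp; linear_combination -h⟩

lemma homogeneousSpace_iff {d b t : F} (hd : d ≠ 0) (ht : t ≠ 0) (h4 : t ^ 4 = -4) :
    ((∃ z w : F, d * w ^ 2 = d ^ 2 - 4 * b * z ^ 4) ∨ ∃ u : F, u ^ 2 * d = b) ↔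
      QuarticSolvable d (b / d) := by
  constructor
  · rintro (⟨z, w, h⟩ | ⟨u, h⟩)
    · refine ⟨1, t * z, w, Or.inl one_ne_zero, ?_⟩
      field_simp
      rw [h4]
      linear_combination h
    · exact QuarticSolvable.of_isSquare_right ⟨u, by field_simp; rw [← h]; ring⟩
  · rintro ⟨X, Y, W, hXY, h⟩
    by_cases hX : X = 0
    · right
      have hY : Y ≠ 0 := by tauto
      refine ⟨W / Y ^ 2, ?_⟩
      subst hX
      field_simp at h ⊢
      linear_combination h
    · left
      refine ⟨Y / (t * X), W / X ^ 2, ?_⟩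
      field_simp at h ⊢
      rw [h4]
      linear_combination (-4) * h

variable (w : Valuation F ℤᵐ⁰)

lemma exists_sqrt_of_near (h2 : (2 : F) ≠ 0)
    (hens : ∀ c, w c < 1 → ∃ t, t ^ 2 + t = c ∧ w t ≤ w c)
    {x : F} (hx : w (x - 1) < w 4) : ∃ y, y ^ 2 = x ∧ w (y - 1) * w 2 ≤ w (x - 1) := by
  have h4 : (4 : F) ≠ 0 := by
    have : (4 : F) = 2 * 2 := by norm_num
    rw [this]; exact mul_ne_zero h2 h2
  have w4 : 0 < w 4 := (Valuation.pos_iff _).2 h4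
  have w2 : 0 < w 2 := (Valuation.pos_iff _).2 h2
  obtain ⟨t, ht, hwt⟩ := hens ((x - 1) / 4) (by rw [map_div₀, div_lt_one₀ w4]; exact hx)
  refine ⟨1 + 2 * t, ?_, ?_⟩
  · field_simp at ht
    linear_combination ht
  · rw [add_sub_cancel_left, map_mul]
    rw [map_div₀, le_div_iff₀ w4] at hwt
    have : w 4 = w 2 * w 2 := by rw [← map_mul]; norm_num
    rw [this] at hwt
    calc _ = w t * (w 2 * w 2) := by rw [mul_comm (w 2), mul_assoc]
      _ ≤ _ := hwt

lemma exists_fourthRoot_of_near (h2 : (2 : F) ≠ 0)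
    (hens : ∀ c, w c < 1 → ∃ t, t ^ 2 + t = c ∧ w t ≤ w c)
    {x : F} (hx : w (x - 1) < w 8) : ∃ y, y ^ 4 = x := by
  have w2 : 0 < w 2 := (Valuation.pos_iff _).2 h2
  have h21 : w 2 ≤ 1 := by
    have : (2 : F) = 1 + 1 := by norm_num
    rw [this]
    exact (Valuation.map_add _ _ _).trans (by simp)
  have h8 : w 8 = w 4 * w 2 := by rw [← map_mul]; norm_num
  obtain ⟨y, hy, hy1⟩ := exists_sqrt_of_near w h2 hens (x := x)
    (hx.trans_le (by rw [h8]; exact mul_le_of_le_one_right' h21))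
  obtain ⟨z, hz, -⟩ := exists_sqrt_of_near w h2 hens (x := y) (by
    rw [h8] at hx
    exact lt_of_mul_lt_mul_right (hy1.trans_lt hx) w2.le)
  exact ⟨z, by rw [← hy, ← hz]; ring⟩

/-- If one of the terms dominates, its coefficient is a square up to a factor close to `1`. -/
lemma eq_mul_of_dominant {X Y W : F} (hX : X ≠ 0) (hA : A ≠ 0)
    (h : W ^ 2 = A * X ^ 4 + B * Y ^ 4) :
    A * (1 + B * Y ^ 4 / (A * X ^ 4)) = (W / X ^ 2) ^ 2 := by
  field_simp
  linear_combination -h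

section Odd

variable (h2 : w 2 = 1) (hens : ∀ c, w c < 1 → ∃ t, t ^ 2 + t = c ∧ w t ≤ w c)

include h2

lemma two_ne_zero_of_val : (2 : F) ≠ 0 := by
  intro h; rw [h, map_zero] at h2; exact zero_ne_one h2

include hens

lemma isSquare_of_near_one {x : F} (hx : w (x - 1) < 1) : IsSquare x := by
  have h4 : w 4 = 1 := by
    have : (4 : F) = 2 * 2 := by norm_num
    rw [this, map_mul, h2, one_mul]
  obtain ⟨y, hy, -⟩ := exists_sqrt_of_near w (two_ne_zero_of_val w h2) hens (x := x)
    (by rwa [h4])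
  exact ⟨y, by rw [← hy]; ring⟩

lemma isFourthPower_of_near_one {x : F} (hx : w (x - 1) < 1) : ∃ y, y ^ 4 = x := by
  have h8 : w 8 = 1 := by
    have : (8 : F) = 2 * 2 * 2 := by norm_num
    rw [this, map_mul, map_mul, h2, one_mul, one_mul]
  exact exists_fourthRoot_of_near w (two_ne_zero_of_val w h2) hens (x := x) (by rwa [h8])

lemma isSquare_of_dominant {X Y W : F} (hX : X ≠ 0) (hA : A ≠ 0)
    (h : W ^ 2 = A * X ^ 4 + B * Y ^ 4) (hlt : w (B * Y ^ 4) < w (A * X ^ 4)) : IsSquare A := by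
  have h0 := eq_mul_of_dominant hX hA h
  have hAX : A * X ^ 4 ≠ 0 := mul_ne_zero hA (pow_ne_zero _ hX)
  have hsm : w (B * Y ^ 4 / (A * X ^ 4)) < 1 := by
    rw [map_div₀, div_lt_one₀ ((Valuation.pos_iff _).2 hAX)]; exact hlt
  obtain ⟨y, hy⟩ := isSquare_of_near_one w h2 hens
    (x := 1 + B * Y ^ 4 / (A * X ^ 4)) (by rwa [add_sub_cancel_left])
  have hy0 : y ≠ 0 := by
    rintro rfl
    have : B * Y ^ 4 / (A * X ^ 4) = -1 := by linear_combination hy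
    rw [this, Valuation.map_neg, map_one] at hsm
    exact lt_irrefl _ hsm
  rw [hy] at h0
  refine ⟨W / X ^ 2 / y, ?_⟩
  field_simp
  field_simp at h0
  linear_combination h0

lemma quarticSolvable_iff_of_val_ne (hA : A ≠ 0) (hB : B ≠ 0)
    (hne : ∀ s : F, s ≠ 0 → w A ≠ w (B * s ^ 4)) :
    QuarticSolvable A B ↔ IsSquare A ∨ IsSquare B := by
  refine ⟨?_, fun h => h.elim .of_isSquare_left .of_isSquare_right⟩
  rintro ⟨X, Y, W, hXY, h⟩
  rcases eq_or_ne X 0 with rfl | hX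
  · exact Or.inr (isSquare_of_sq_eq (X := Y) (W := W) (by tauto) (by rw [h]; ring))
  rcases eq_or_ne Y 0 with rfl | hY
  · exact Or.inl (isSquare_of_sq_eq (X := X) (W := W) (by tauto) (by rw [h]; ring))
  have hne' : w (A * X ^ 4) ≠ w (B * Y ^ 4) := by
    intro e
    apply hne (Y / X) (div_ne_zero hY hX)
    rw [div_pow, mul_div_assoc', map_div₀, ← e, ← map_div₀]
    congr 1
    field_simp
  rcases lt_or_gt_of_ne hne' with hlt | hlt
  · exact Or.inr (isSquare_of_dominant w h2 hens hY hB (by rw [h]; ring) hlt)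
  · exact Or.inl (isSquare_of_dominant w h2 hens hX hA h hlt)

lemma quarticSolvable_iff_of_val_eq (hA : A ≠ 0) (hB : B ≠ 0) (hAB : w A = w B)
    (hodd : ∀ s : F, w A ≠ w (s ^ 2)) :
    QuarticSolvable A B ↔ ∃ t, -A = B * t ^ 4 := by
  constructor
  · rintro ⟨X, Y, W, hXY, h⟩
    rcases eq_or_ne X 0 with rfl | hX
    · have hY : Y ≠ 0 := by tauto
      exfalso
      apply hodd (W / Y ^ 2)
      rw [hAB]
      congr 1
      field_simp
      rw [h]; ring
    have key : ∀ V : F, w V = w (A * X ^ 4) → V ≠ W ^ 2 := by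
      rintro V hV rfl
      apply hodd (W / X ^ 2)
      rw [div_pow, map_div₀, hV, ← map_div₀]
      congr 1
      field_simp
    have hne : ¬ w (B * Y ^ 4) < w (A * X ^ 4) := fun hlt =>
      key _ (by rw [Valuation.map_add_eq_of_lt_left _ hlt]) h.symm
    have hY : Y ≠ 0 := by
      rintro rfl
      apply hne
      rw [zero_pow (by norm_num), mul_zero, map_zero]
      exact (Valuation.pos_iff _).2 (mul_ne_zero hA (pow_ne_zero _ hX))
    have hlt' : w (W ^ 2) < w (B * Y ^ 4) := by
      rcases lt_or_eq_of_le (not_lt.1 hne) with hlt | he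
      · exfalso
        apply hodd (W / Y ^ 2)
        rw [div_pow, map_div₀, h, Valuation.map_add_eq_of_lt_right _ hlt, ← map_div₀, hAB]
        congr 1
        field_simp
      · refine lt_of_le_of_ne ?_ (fun e => key _ (e.trans he.symm) rfl)
        rw [h]
        exact (Valuation.map_add _ _ _).trans (max_le he.le le_rfl)
    have hBY : B * Y ^ 4 ≠ 0 := mul_ne_zero hB (pow_ne_zero _ hY)
    obtain ⟨y, hy⟩ := isFourthPower_of_near_one w h2 hens (x := 1 - W ^ 2 / (B * Y ^ 4)) (by
      rw [sub_sub_cancel_left, Valuation.map_neg, map_div₀,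
        div_lt_one₀ ((Valuation.pos_iff _).2 hBY)]
      exact hlt')
    refine ⟨Y * y / X, ?_⟩
    rw [div_pow, mul_pow, hy]
    field_simp
    linear_combination h
  · rintro ⟨t, ht⟩
    refine ⟨1, t, 0, Or.inl one_ne_zero, by linear_combination ht⟩

end Odd

end Generic

end LocalField

namespace QuarticResidue

/-- The basis `1, i` of the Gaussian integers. -/
def gaussianBasis : Module.Basis (Fin 2) ℤ GaussianInt :=
  Module.Basis.ofEquivFun
    { toFun := fun z => ![z.re, z.im]
      invFun := fun f => ⟨f 0, f 1⟩
      map_add' := fun x y => by ext i; fin_cases i <;> simp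
      map_smul' := fun c x => by ext i; fin_cases i <;> simp
      left_inv := fun x => rfl
      right_inv := fun f => by ext i; fin_cases i <;> rfl }

lemma gaussianBasis_repr_zero (z : GaussianInt) : gaussianBasis.repr z 0 = z.re := rfl

lemma gaussianBasis_repr_one (z : GaussianInt) : gaussianBasis.repr z 1 = z.im := rfl

lemma gaussianBasis_zero : gaussianBasis 0 = 1 := by
  rw [gaussianBasis, Module.Basis.coe_ofEquivFun]
  rfl

lemma gaussianBasis_one : gaussianBasis 1 = ii := by
  rw [gaussianBasis, Module.Basis.coe_ofEquivFun]
  rfl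

lemma algebraNorm_eq (z : GaussianInt) : Algebra.norm ℤ z = z.norm := by
  rw [Algebra.norm_eq_matrix_det gaussianBasis, Matrix.det_fin_two]
  simp [Algebra.leftMulMatrix_eq_repr_mul, gaussianBasis_repr_zero, gaussianBasis_repr_one,
    gaussianBasis_zero, gaussianBasis_one, Zsqrtd.norm_def, ii]

instance : Module.Free ℤ GaussianInt := Module.Free.of_basis gaussianBasis

instance : Module.Finite ℤ GaussianInt := Module.Finite.of_basis gaussianBasis

lemma exists_residueField {π : GaussianInt} (hπ : Prime π) :
    ∃ (F : Type) (_ : Field F) (_ : Fintype F) (ρ : GaussianInt →+* F),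
      Function.Surjective ρ ∧ (∀ g, ρ g = 0 ↔ π ∣ g) ∧ Fintype.card F = π.norm.natAbs := by
  have hp : (Ideal.span {π}).IsPrime := (Ideal.span_singleton_prime hπ.ne_zero).2 hπ
  have hmax : (Ideal.span {π}).IsMaximal :=
    hp.isMaximal (by rw [Ne, Ideal.span_singleton_eq_bot]; exact hπ.ne_zero)
  have hcard : Nat.card (GaussianInt ⧸ Ideal.span {π}) = π.norm.natAbs := by
    rw [← algebraNorm_eq, ← Ideal.absNorm_span_singleton, Ideal.absNorm_apply]
    rfl
  have hfin : Finite (GaussianInt ⧸ Ideal.span {π}) := by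
    apply Nat.finite_of_card_ne_zero
    rw [hcard]
    have := (GaussianInt.norm_pos (x := π)).2 hπ.ne_zero
    omega
  refine ⟨GaussianInt ⧸ Ideal.span {π}, Ideal.Quotient.field _, Fintype.ofFinite _,
    Ideal.Quotient.mk _, Ideal.Quotient.mk_surjective, fun g => ?_, ?_⟩
  · rw [Ideal.Quotient.eq_zero_iff_mem, Ideal.mem_span_singleton]
  · rw [← hcard]; exact (@Nat.card_eq_fintype_card _ (Fintype.ofFinite _)).symm

lemma ii_sq : ii ^ 2 = -1 := rfl

lemma ii_pow_four : ii ^ 4 = 1 := rfl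

lemma ii_pow_mod (n : ℕ) : ii ^ (n % 4) = ii ^ n := by
  conv_rhs => rw [← Nat.div_add_mod n 4, pow_add, pow_mul, ii_pow_four, one_pow, one_mul]

lemma ii_pow_val (n : ℕ) : ii ^ ((n : ZMod 4)).val = ii ^ n := by
  rw [ZMod.val_natCast, ii_pow_mod]

/-- The power of `i` indexed by an integer modulo `4`. -/
def iPow (k : ZMod 4) : GaussianInt := ii ^ k.val

lemma iPow_natCast (n : ℕ) : iPow n = ii ^ n := ii_pow_val n

lemma iPow_zero : iPow 0 = 1 := rfl

lemma iPow_add (k l : ZMod 4) : iPow (k + l) = iPow k * iPow l := by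
  revert k l; decide

lemma primary_parity {π : GaussianInt} (h : IsPrimary π) :
    (π.re % 4 = 1 ∧ π.im % 4 = 0) ∨ (π.re % 4 = 3 ∧ π.im % 4 = 2) := by
  obtain ⟨c, hc⟩ := h
  have h1 := congrArg Zsqrtd.re hc
  have h2 := congrArg Zsqrtd.im hc
  have ht : tt ^ 3 = ⟨-2, 2⟩ := rfl
  rw [ht] at h1 h2
  simp at h1 h2
  omega

lemma norm_natAbs (π : GaussianInt) : (π.norm.natAbs : ℤ) = π.re ^ 2 + π.im ^ 2 := by
  rw [Int.natAbs_of_nonneg (GaussianInt.norm_nonneg _), Zsqrtd.norm_def]; ring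

lemma norm_mod_four {π : GaussianInt} (h : IsPrimary π) : π.norm.natAbs % 4 = 1 := by
  have h1 := norm_natAbs π
  obtain ⟨x, y, hx, hy⟩ : ∃ x y : ℤ, π.re = 2 * x + 1 ∧ π.im = 2 * y := by
    refine ⟨π.re / 2, π.im / 2, ?_, ?_⟩ <;> rcases primary_parity h with h | h <;> omega
  rw [hx, hy] at h1
  have : (π.norm.natAbs : ℤ) = 4 * (x ^ 2 + x + y ^ 2) + 1 := by rw [h1]; ring
  omega

lemma exists_norm_eq {π : GaussianInt} (hπ : Prime π) (h : IsPrimary π) :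
    ∃ k, 0 < k ∧ π.norm.natAbs = 4 * k + 1 := by
  refine ⟨(π.norm.natAbs - 1) / 4, ?_, ?_⟩
  · have h1 := norm_mod_four h
    have h2 : π.norm.natAbs ≠ 1 := fun h => hπ.not_isUnit (Zsqrtd.norm_eq_one_iff.1 h)
    omega
  · have h1 := norm_mod_four h
    omega

lemma not_dvd_two {π : GaussianInt} (hπ : Prime π) (h : IsPrimary π) : ¬ π ∣ 2 := by
  rintro ⟨c, hc⟩
  obtain ⟨k, hk, hN⟩ := exists_norm_eq hπ h
  have h4 : π.norm.natAbs * c.norm.natAbs = 4 := by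
    rw [← Int.natAbs_mul, ← Zsqrtd.norm_mul, ← hc]; rfl
  have hle : π.norm.natAbs ≤ 4 := Nat.le_of_dvd (by norm_num) ⟨_, h4.symm⟩
  omega

/-- `Lg π g k` says that the quartic residue symbol of `g` modulo `π` equals `i ^ k`. -/
def Lg (π g : GaussianInt) (k : ZMod 4) : Prop :=
  π ∣ g ^ ((π.norm.natAbs - 1) / 4) - iPow k

lemma Lg.mul {π g h : GaussianInt} {k l : ZMod 4} (hg : Lg π g k) (hh : Lg π h l) :
    Lg π (g * h) (k + l) := by
  unfold Lg at *
  rw [iPow_add, mul_pow]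
  exact dvd_mul_sub_mul hg hh

lemma Lg.one (π : GaussianInt) : Lg π 1 0 := by simp [Lg, iPow_zero]

lemma Lg.pow {π g : GaussianInt} {k : ZMod 4} (hg : Lg π g k) (n : ℕ) :
    Lg π (g ^ n) (n * k) := by
  induction n with
  | zero => simpa using Lg.one π
  | succ n ih => rw [pow_succ]; push_cast; rw [add_mul, one_mul]; exact ih.mul hg

lemma Lg.prod {π : GaussianInt} {ι : Type*} (s : Finset ι) {g : ι → GaussianInt}
    {k : ι → ZMod 4} (h : ∀ i ∈ s, Lg π (g i) (k i)) :
    Lg π (∏ i ∈ s, g i) (∑ i ∈ s, k i) := by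
  classical
  induction s using Finset.induction_on with
  | empty => simpa using Lg.one π
  | insert a s ha ih =>
    rw [Finset.prod_insert ha, Finset.sum_insert ha]
    exact (h a (Finset.mem_insert_self a s)).mul
      (ih fun i hi => h i (Finset.mem_insert_of_mem hi))

end QuarticResidue

namespace QuarticResidue

variable {π : GaussianInt}

lemma dvd_iPow_sub_iPow (hπ : Prime π) (h : IsPrimary π) {k l : ZMod 4}
    (hkl : π ∣ iPow k - iPow l) : k = l := by
  by_contra hne
  apply not_dvd_two hπ h
  refine hkl.trans ?_
  have key : ∀ k l : ZMod 4, k ≠ l → ∃ c : GaussianInt, c * (iPow k - iPow l) = 2 := by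
    intro k l hkl
    refine ⟨if k = l + 2 then iPow (-k) else iPow (-k) * (1 - iPow (k - l)), ?_⟩
    revert k l
    decide
  obtain ⟨c, hc⟩ := key k l hne
  exact ⟨c, by rw [← hc, mul_comm]⟩

lemma Lg.congr {g h : GaussianInt} {k : ZMod 4} (hg : Lg π g k) (hgh : π ∣ h - g) : Lg π h k := by
  have h1 : π ∣ h ^ ((π.norm.natAbs - 1) / 4) - g ^ ((π.norm.natAbs - 1) / 4) :=
    hgh.trans (sub_dvd_pow_sub_pow _ _ _)
  have := dvd_add h1 hg
  simpa [Lg] using this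

lemma isUnit_iPow (k : ZMod 4) : IsUnit (iPow k) :=
  IsUnit.of_mul_eq_one (iPow (-k)) (by rw [← iPow_add, add_neg_cancel, iPow_zero])

lemma Lg.not_dvd (hπ : Prime π) (h : IsPrimary π) {g : GaussianInt} {k : ZMod 4}
    (hk : Lg π g k) : ¬ π ∣ g := by
  intro hg
  obtain ⟨n, hn, hN⟩ := exists_norm_eq hπ h
  have h1 : (π.norm.natAbs - 1) / 4 = n := by omega
  rw [Lg, h1] at hk
  have h2 : π ∣ iPow k := (dvd_sub_right (dvd_pow hg hn.ne')).1 hk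
  exact hπ.not_isUnit (isUnit_of_dvd_unit h2 (isUnit_iPow k))

lemma ringChar_ne_two {F : Type} [Field F] (hπ : Prime π) (h : IsPrimary π)
    {ρ : GaussianInt →+* F} (hρ : ∀ g, ρ g = 0 ↔ π ∣ g) : ringChar F ≠ 2 := by
  intro h2
  apply not_dvd_two hπ h
  rw [← hρ, map_ofNat]
  have := ringChar.Nat.cast_ringChar (R := F)
  rw [h2] at this
  exact_mod_cast this

lemma exists_sq_iff_pow (hπ : Prime π) (h : IsPrimary π) {g : GaussianInt} (hg : ¬ π ∣ g) :
    (∃ x, π ∣ x ^ 2 - g) ↔ π ∣ g ^ ((π.norm.natAbs - 1) / 2) - 1 := by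
  obtain ⟨F, _, _, ρ, hsurj, hρ, hcard⟩ := exists_residueField hπ
  have hg0 : ρ g ≠ 0 := fun h => hg ((hρ g).1 h)
  obtain ⟨k, hk, hN⟩ := exists_norm_eq hπ h
  have he : (π.norm.natAbs - 1) / 2 = Fintype.card F / 2 := by omega
  rw [← hρ, map_sub, map_pow, map_one, sub_eq_zero, he,
    ← FiniteField.isSquare_iff (ringChar_ne_two hπ h hρ) hg0]
  constructor
  · rintro ⟨x, hx⟩
    rw [← hρ, map_sub, map_pow, sub_eq_zero] at hx
    exact ⟨ρ x, by rw [← hx, sq]⟩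
  · rintro ⟨y, hy⟩
    obtain ⟨x, rfl⟩ := hsurj y
    exact ⟨x, by rw [← hρ, map_sub, map_pow, sub_eq_zero, hy, sq]⟩

lemma Lg.exists_sq_iff (hπ : Prime π) (h : IsPrimary π) {g : GaussianInt} {k : ZMod 4}
    (hk : Lg π g k) : (∃ x, π ∣ x ^ 2 - g) ↔ c2 k = 0 := by
  rw [exists_sq_iff_pow hπ h (hk.not_dvd hπ h)]
  obtain ⟨n, hn, hN⟩ := exists_norm_eq hπ h
  have h1 : (π.norm.natAbs - 1) / 4 = n := by omega
  have h2 : (π.norm.natAbs - 1) / 2 = n * 2 := by omega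
  rw [Lg, h1] at hk
  have h3 : π ∣ (g ^ n) ^ 2 - iPow k ^ 2 := hk.trans (sub_dvd_pow_sub_pow _ _ _)
  rw [h2, pow_mul]
  have h4 : iPow k ^ 2 = iPow (k + k) := by rw [iPow_add, sq]
  rw [h4] at h3
  have h5 : π ∣ (g ^ n) ^ 2 - 1 ↔ k + k = 0 := by
    constructor
    · intro h6
      apply dvd_iPow_sub_iPow hπ h
      have := dvd_sub h6 h3
      simpa [iPow_zero] using this
    · intro h6; rwa [h6, iPow_zero] at h3
  rw [h5]
  exact (by decide : ∀ k : ZMod 4, k + k = 0 ↔ c2 k = 0) k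

lemma Lg.exists_pow_four_iff (hπ : Prime π) (h : IsPrimary π) {g : GaussianInt} {k : ZMod 4}
    (hk : Lg π g k) : (∃ x, π ∣ x ^ 4 - g) ↔ k = 0 := by
  obtain ⟨n, hn, hN⟩ := exists_norm_eq hπ h
  have h1 : (π.norm.natAbs - 1) / 4 = n := by omega
  have h2 : (π.norm.natAbs - 1) / 2 = 2 * n := by omega
  have hpow : ∀ x, π ∣ x ^ 2 - g → (π ∣ x ^ ((π.norm.natAbs - 1) / 2) - 1 ↔ k = 0) := by
    intro x hx
    have h3 : π ∣ x ^ (2 * n) - g ^ n := by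
      rw [pow_mul]; exact hx.trans (sub_dvd_pow_sub_pow _ _ _)
    rw [Lg, h1] at hk
    have h4 := dvd_add h3 hk
    rw [sub_add_sub_cancel] at h4
    rw [h2]
    constructor
    · intro h5
      apply dvd_iPow_sub_iPow hπ h
      have := dvd_sub h5 h4
      simpa [iPow_zero] using this
    · rintro rfl; exact h4
  have hnd : ∀ x, π ∣ x ^ 2 - g → ¬ π ∣ x := fun x hx hd =>
    hk.not_dvd hπ h ((dvd_sub_right (dvd_pow hd two_ne_zero)).1 hx)
  constructor
  · rintro ⟨x, hx⟩
    have hx' : π ∣ (x ^ 2) ^ 2 - g := by rwa [← pow_mul]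
    rw [← hpow _ hx', ← exists_sq_iff_pow hπ h (hnd _ hx')]
    exact ⟨x, by simp⟩
  · rintro rfl
    obtain ⟨y, hy⟩ := (hk.exists_sq_iff hπ h).2 (map_zero _)
    obtain ⟨x, hx⟩ := (exists_sq_iff_pow hπ h (hnd _ hy)).2 ((hpow y hy).2 rfl)
    refine ⟨x, ?_⟩
    have h5 : π ∣ (x ^ 2) ^ 2 - y ^ 2 := hx.trans (sub_dvd_pow_sub_pow _ _ _)
    have := dvd_add h5 hy
    rwa [sub_add_sub_cancel, ← pow_mul] at this

end QuarticResidue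

namespace QuarticResidue

lemma generators_residue : ∀ m n : ZMod 4,
    let z : GaussianInt := (1 - 4 * ii) ^ m.val * (-1 - 6 * ii) ^ n.val
    (z.re - z.im - z.im ^ 2 - 1) % 16 = 4 * m.val ∧ (z.re ^ 2 + z.im ^ 2) % 16 = 4 * n.val + 1 ∧
      z.im % 2 = 0 ∧ z.re % 2 = 1 := by
  decide

variable {π : GaussianInt} {m n : ZMod 4}

lemma residue_of_dvd (h : tt ^ 7 ∣ π - (1 - 4 * ii) ^ m.val * (-1 - 6 * ii) ^ n.val) :
    (π.re - π.im - π.im ^ 2 - 1) % 16 = 4 * m.val ∧ (π.re ^ 2 + π.im ^ 2) % 16 = 4 * n.val + 1 := by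
  obtain ⟨h1, h2, h3, h4⟩ := generators_residue m n
  set z : GaussianInt := (1 - 4 * ii) ^ m.val * (-1 - 6 * ii) ^ n.val with hz
  obtain ⟨c, hc⟩ := h
  have ht : tt ^ 7 = ⟨8, -8⟩ := rfl
  rw [ht] at hc
  have hre : π.re = z.re + (8 * c.re + 8 * c.im) := by
    have := congrArg Zsqrtd.re hc
    simp at this; linarith
  have him : π.im = z.im + (8 * c.im - 8 * c.re) := by
    have := congrArg Zsqrtd.im hc
    simp at this; linarith
  obtain ⟨y, hy⟩ : ∃ y, z.im = 2 * y := ⟨z.im / 2, by omega⟩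
  constructor
  · have e : π.re - π.im - π.im ^ 2 - 1 = (z.re - z.im - z.im ^ 2 - 1) +
        16 * (c.re - 2 * y * (c.im - c.re) - 4 * (c.im - c.re) ^ 2) := by
      rw [hre, him, hy]; ring
    rw [e, Int.add_mul_emod_self_left, h1]
  · have e : π.re ^ 2 + π.im ^ 2 = (z.re ^ 2 + z.im ^ 2) +
        16 * (z.re * (c.re + c.im) + 4 * (c.re + c.im) ^ 2 + z.im * (c.im - c.re)
          + 4 * (c.im - c.re) ^ 2) := by
      rw [hre, him]; ring
    rw [e, Int.add_mul_emod_self_left, h2]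

lemma lg_ii (h : tt ^ 7 ∣ π - (1 - 4 * ii) ^ m.val * (-1 - 6 * ii) ^ n.val) : Lg π ii n := by
  have h2 := (residue_of_dvd h).2
  rw [← norm_natAbs] at h2
  have hn : ((((π.norm.natAbs - 1) / 4 : ℕ)) : ZMod 4) = n := by
    rw [← ZMod.natCast_zmod_val n, ZMod.natCast_eq_natCast_iff']
    have := ZMod.val_lt n
    omega
  rw [Lg, ← iPow_natCast, hn, sub_self]
  exact dvd_zero _

lemma lg_neg_one (h : Lg π ii n) : Lg π (-1) (2 * n) := by
  have := h.pow 2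
  rwa [ii_sq] at this

end QuarticResidue

namespace QuarticResidue

lemma charP_of_natCast_eq_zero {F : Type*} [Field F] {q : ℕ} (hq : q.Prime)
    (h : (q : F) = 0) : CharP F q := by
  have h1 : ringChar F ∣ q := ringChar.dvd h
  rcases (Nat.dvd_prime hq).1 h1 with h2 | h2
  · exact absurd h2 CharP.ringChar_ne_one
  · rw [← h2]; infer_instance

variable {π : GaussianInt} {m n : ZMod 4}

lemma norm_prime_or_eq_neg (hπ : Prime π) (h : IsPrimary π) :
    π.norm.natAbs.Prime ∨ ∃ q : ℕ, q.Prime ∧ q % 4 = 3 ∧ π = -(q : GaussianInt) := by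
  have hdvd : π ∣ ((π.norm.natAbs : ℕ) : GaussianInt) :=
    ⟨star π, by rw [← Zsqrtd.norm_eq_mul_conj, ← Int.natAbs_of_nonneg (GaussianInt.norm_nonneg π)]; simp⟩
  obtain ⟨p, hp, hpd⟩ : ∃ p : ℕ, p.Prime ∧ π ∣ (p : GaussianInt) := by
    have hN0 : π.norm.natAbs ≠ 0 := by
      obtain ⟨k, hk, hN⟩ := exists_norm_eq hπ h
      omega
    rw [← Nat.prod_primeFactorsList hN0, Nat.cast_list_prod, hπ.dvd_prod_iff] at hdvd
    obtain ⟨a, ha, hd⟩ := hdvd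
    obtain ⟨p, hp, rfl⟩ := List.mem_map.1 ha
    exact ⟨p, Nat.prime_of_mem_primeFactorsList hp, hd⟩
  obtain ⟨c, hc⟩ := hpd
  have hN : π.norm.natAbs * c.norm.natAbs = p ^ 2 := by
    rw [← Int.natAbs_mul, ← Zsqrtd.norm_mul, ← hc]
    simp [Zsqrtd.norm_natCast, Int.natAbs_mul, sq]
  obtain ⟨k, hk, hk'⟩ := (Nat.dvd_prime_pow hp).1 ⟨_, hN.symm⟩
  interval_cases k
  · exact absurd (Zsqrtd.norm_eq_one_iff.1 (by simpa using hk')) hπ.not_isUnit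
  · left; rw [hk', pow_one]; exact hp
  · right
    rw [hk'] at hN
    have hc1 : c.norm.natAbs = 1 := by
      have : 0 < p ^ 2 := pow_pos hp.pos 2
      nlinarith
    have hu := Zsqrtd.norm_eq_one_iff.1 hc1
    have : Fact p.Prime := ⟨hp⟩
    have hp3 : p % 4 = 3 := by
      apply GaussianInt.mod_four_eq_three_of_nat_prime_of_prime
      rw [hc]
      exact (associated_mul_unit_right π c hu).prime hπ
    refine ⟨p, hp, hp3, ?_⟩
    have h1 := congrArg Zsqrtd.re hc
    have h2 := congrArg Zsqrtd.im hc
    have h3 := norm_natAbs c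
    rw [hc1] at h3
    simp at h1 h2 h3
    have hcre : c.re ≤ 1 ∧ -1 ≤ c.re := by constructor <;> nlinarith
    have hcim : c.im ≤ 1 ∧ -1 ≤ c.im := by constructor <;> nlinarith
    obtain ⟨x, y⟩ := c
    have hpar := primary_parity h
    rw [Zsqrtd.ext_iff]
    simp at *
    obtain ⟨ha, hb⟩ := hcre
    obtain ⟨hc', hd'⟩ := hcim
    interval_cases x <;> interval_cases y <;> simp at * <;> omega

lemma lg_tt_of_inert (hπ : Prime π) (h : IsPrimary π)
    (hmn : tt ^ 7 ∣ π - (1 - 4 * ii) ^ m.val * (-1 - 6 * ii) ^ n.val)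
    {q : ℕ} (hq : q.Prime) (hq3 : q % 4 = 3) (hπq : π = -(q : GaussianInt)) : Lg π tt m := by
  obtain ⟨F, _, _, ρ, -, hρ, -⟩ := exists_residueField hπ
  have hq0 : (q : F) = 0 := by
    rw [← map_natCast ρ, hρ, hπq]; exact (neg_dvd).2 dvd_rfl
  have := charP_of_natCast_eq_zero hq hq0
  have : Fact q.Prime := ⟨hq⟩
  obtain ⟨k, hk⟩ : ∃ k, q = 4 * k + 3 := ⟨q / 4, by omega⟩
  have hN : (π.norm.natAbs - 1) / 4 = (q - 1) * (k + 1) := by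
    have : π.norm.natAbs = q ^ 2 := by
      have := norm_natAbs π
      rw [hπq] at this ⊢
      simp at this ⊢
      rw [Int.natAbs_mul, Int.natAbs_natCast, sq]
    rw [this, hk]
    have e1 : (4 * k + 3) ^ 2 - 1 = 4 * ((4 * k + 2) * (k + 1)) := by
      rw [Nat.sub_eq_iff_eq_add (by nlinarith)]; ring
    rw [e1, Nat.mul_div_cancel_left _ (by norm_num)]
    rfl
  have htt : ρ tt ≠ 0 := by
    rw [Ne, hρ]
    intro hd
    exact not_dvd_two hπ h (hd.trans ⟨1 - ii, by rfl⟩)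
  have hfrob : ρ tt ^ (q - 1) = ρ (ii ^ 3) := by
    have h1 : ρ tt ^ q = ρ (tt * ii ^ 3) := by
      have e : tt * ii ^ 3 = 1 + ii ^ 3 := rfl
      rw [e, tt, map_add, map_add, add_pow_char, map_one, one_pow, ← map_pow, hk, pow_add, pow_mul,
        ii_pow_four, one_pow, one_mul]
    have h2 : ρ tt ^ q = ρ tt * ρ tt ^ (q - 1) := by
      rw [← pow_succ']; congr 1; have := hq.pos; omega
    rw [h2, map_mul] at h1
    exact mul_left_cancel₀ htt h1
  have hm := (residue_of_dvd hmn).1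
  have hmk : m = ((3 * (k + 1) : ℕ) : ZMod 4) := by
    rw [← ZMod.natCast_zmod_val m, ZMod.natCast_eq_natCast_iff']
    have := ZMod.val_lt m
    have hre : π.re = -(4 * k + 3) := by rw [hπq, hk]; simp
    have him : π.im = 0 := by rw [hπq]; simp
    rw [hre, him] at hm
    omega
  rw [Lg, ← hρ, map_sub, sub_eq_zero, hN, map_pow, pow_mul, hfrob, hmk, iPow_natCast, ← map_pow,
    ← pow_mul]

end QuarticResidue

namespace QuarticResidue

variable {π : GaussianInt}

lemma eq_iPow_of_pow_four {F : Type*} [Field F] (ρ : GaussianInt →+* F) {y : F} (hy : y ^ 4 = 1) :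
    ∃ j, y = ρ (iPow j) := by
  have hi : ρ ii ^ 2 = -1 := by rw [← map_pow, ii_sq, map_neg, map_one]
  have h : (y - 1) * (y + 1) * (y - ρ ii) * (y + ρ ii) = 0 := by
    linear_combination hy - (y ^ 2 - 1) * hi
  rcases mul_eq_zero.1 h with h | h
  · rcases mul_eq_zero.1 h with h | h
    · rcases mul_eq_zero.1 h with h | h
      · exact ⟨0, by rw [iPow_zero, map_one]; linear_combination h⟩
      · exact ⟨2, by rw [show iPow 2 = -1 from rfl, map_neg, map_one]; linear_combination h⟩
    · exact ⟨1, by rw [show iPow 1 = ii from rfl]; linear_combination h⟩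
  · exact ⟨3, by rw [show iPow 3 = -ii from rfl, map_neg]; linear_combination h⟩

lemma map_iPow_injective (hπ : Prime π) (h : IsPrimary π) {F : Type*} [Field F]
    {ρ : GaussianInt →+* F} (hρ : ∀ g, ρ g = 0 ↔ π ∣ g) {k l : ZMod 4}
    (hkl : ρ (iPow k) = ρ (iPow l)) : k = l :=
  dvd_iPow_sub_iPow hπ h (by rw [← hρ, map_sub, hkl, sub_self])

/-- The quartic residue character, with values in the Gaussian integers. -/
lemma exists_quarticChar (hπ : Prime π) (h : IsPrimary π) {F : Type*} [Field F] [Fintype F]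
    {ρ : GaussianInt →+* F} (hρ : ∀ g, ρ g = 0 ↔ π ∣ g) {k : ℕ} (hk : 0 < k)
    (hcard : Fintype.card F = 4 * k + 1) :
    ∃ χ : MulChar F GaussianInt, (∀ x, ρ (χ x) = x ^ k) ∧ ∀ x, x ≠ 0 → ∃ j, χ x = iPow j := by
  classical
  have hex : ∀ x : F, x ≠ 0 → ∃ j, x ^ k = ρ (iPow j) := fun x hx =>
    eq_iPow_of_pow_four ρ (by
      rw [← pow_mul]
      have := FiniteField.pow_card_sub_one_eq_one x hx
      rwa [hcard, Nat.add_sub_cancel, mul_comm] at this)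
  choose! j hj using hex
  have hinj := @map_iPow_injective π hπ h F _ ρ hρ
  refine ⟨
    { toFun := fun x => if x = 0 then 0 else iPow (j x)
      map_one' := ?_
      map_mul' := ?_
      map_nonunit' := ?_ }, ?_, ?_⟩
  · rw [if_neg one_ne_zero]
    have h1 : ρ (iPow 0) = ρ (iPow (j 1)) := by
      rw [← hj 1 one_ne_zero, one_pow, iPow_zero, map_one]
    rw [← hinj h1, iPow_zero]
  · intro x y
    by_cases hx : x = 0
    · simp [hx]
    by_cases hy : y = 0
    · simp [hy]
    rw [if_neg (mul_ne_zero hx hy), if_neg hx, if_neg hy, ← iPow_add]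
    congr 1
    apply hinj
    rw [← hj _ (mul_ne_zero hx hy), iPow_add, map_mul, ← hj x hx, ← hj y hy, mul_pow]
  · intro x hx
    rw [isUnit_iff_ne_zero, not_not] at hx
    exact if_pos hx
  · intro x
    change ρ (if x = 0 then 0 else iPow (j x)) = _
    split_ifs with hx
    · rw [hx, map_zero, zero_pow hk.ne']
    · exact (hj x hx).symm
  · intro x hx
    exact ⟨j x, if_neg hx⟩

lemma mulChar_apply_eq_iff {π : GaussianInt} (hπ : Prime π) (h : IsPrimary π) {F : Type*} [Field F]
    {ρ : GaussianInt →+* F} (hρ : ∀ g, ρ g = 0 ↔ π ∣ g) {k : ℕ}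
    (hN : π.norm.natAbs = 4 * k + 1) {χ : MulChar F GaussianInt} (hχ : ∀ x, ρ (χ x) = x ^ k)
    (hχ' : ∀ x, x ≠ 0 → ∃ j, χ x = iPow j) (g : GaussianInt) (l : ZMod 4) :
    χ (ρ g) = iPow l ↔ Lg π g l := by
  have h1 : (π.norm.natAbs - 1) / 4 = k := by omega
  rw [Lg, h1, ← hρ, map_sub, map_pow, ← hχ, sub_eq_zero]
  refine ⟨fun h => by rw [h], fun e => ?_⟩
  have h0 : ρ g ≠ 0 := by
    intro h0
    rw [h0, MulChar.map_zero, map_zero] at e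
    have h3 : π ∣ iPow l := (hρ _).1 e.symm
    exact hπ.not_isUnit (isUnit_of_dvd_unit h3 (isUnit_iPow l))
  obtain ⟨j, hj⟩ := hχ' _ h0
  rw [hj] at e ⊢
  rw [map_iPow_injective hπ h hρ e]

end QuarticResidue

namespace QuarticResidue

section JacobiSum

variable {π : GaussianInt} (hπ : Prime π) (h : IsPrimary π) {F : Type} [Field F] [Fintype F]
  {ρ : GaussianInt →+* F} (hρ : ∀ g, ρ g = 0 ↔ π ∣ g) {k : ℕ} (hk : 0 < k)
  (hcard : Fintype.card F = 4 * k + 1) {χ : MulChar F GaussianInt} (hχ : ∀ x, ρ (χ x) = x ^ k)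
  (hχ' : ∀ x, x ≠ 0 → ∃ j, χ x = iPow j)

include hχ' in
omit [Fintype F] in
lemma quarticChar_pow_four : χ ^ 4 = 1 := by
  refine MulChar.ext fun u => ?_
  obtain ⟨j, hj⟩ := hχ' u u.ne_zero
  rw [MulChar.pow_apply_coe, hj, MulChar.one_apply_coe]
  exact (by decide : ∀ j, iPow j ^ 4 = 1) j

include hπ h hρ hcard hχ in
lemma quarticChar_sq_ne_one : χ ^ 2 ≠ 1 := by
  intro h1
  obtain ⟨x, hx⟩ := FiniteField.exists_nonsquare (ringChar_ne_two hπ h hρ)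
  have hx0 : x ≠ 0 := by rintro rfl; exact hx ⟨0, by simp⟩
  apply hx
  rw [FiniteField.isSquare_iff (ringChar_ne_two hπ h hρ) hx0,
    show Fintype.card F / 2 = k * 2 by omega, pow_mul, ← hχ, ← map_pow,
    ← MulChar.pow_apply' _ two_ne_zero, h1, MulChar.one_apply (isUnit_iff_ne_zero.2 hx0), map_one]

include hk hcard hχ in
lemma map_jacobiSum_eq_zero : ρ (jacobiSum χ χ) = 0 := by
  have hpoly : ∀ x : F, ρ (χ x * χ (1 - x)) =
      ∑ i ∈ Finset.range (k + 1), ((-1) ^ i * (k.choose i : F)) * x ^ (k + i) := by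
    intro x
    rw [map_mul, hχ, hχ, sub_eq_neg_add, add_pow, Finset.mul_sum]
    refine Finset.sum_congr rfl fun i _ => ?_
    rw [one_pow, neg_pow, pow_add]; ring
  rw [jacobiSum, map_sum, Finset.sum_congr rfl fun x _ => hpoly x, Finset.sum_comm]
  refine Finset.sum_eq_zero fun i hi => ?_
  rw [← Finset.mul_sum, FiniteField.sum_pow_lt_card_sub_one, mul_zero]
  rw [Finset.mem_range] at hi
  omega

include hχ' in
omit [Fintype F] in
lemma inv_quarticChar : χ⁻¹ = χ.ringHomComp (starRingEnd GaussianInt) := by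
  rw [inv_eq_iff_mul_eq_one]
  refine MulChar.ext fun u => ?_
  obtain ⟨j, hj⟩ := hχ' u u.ne_zero
  rw [MulChar.mul_apply, MulChar.ringHomComp_apply, hj, MulChar.one_apply_coe]
  exact (by decide : ∀ j, iPow j * star (iPow j) = 1) j

include hπ h hρ hcard hχ hχ' in
lemma norm_jacobiSum : (jacobiSum χ χ).norm = 4 * k + 1 := by
  have h2 := quarticChar_sq_ne_one hπ h hρ hcard hχ
  have h1 : χ ≠ 1 := by rintro rfl; exact h2 (one_pow 2)
  have hinj : Function.Injective GaussianInt.toComplex :=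
    (injective_iff_map_eq_zero _).2 fun x hx => GaussianInt.toComplex_eq_zero.1 hx
  have hF : ringChar ℂ ≠ ringChar F := by
    rw [ringChar.eq_zero]
    exact (CharP.ringChar_ne_zero_of_finite F).symm
  have key := jacobiSum_mul_jacobiSum_inv (F' := ℂ) hF
    (χ := χ.ringHomComp GaussianInt.toComplex) (φ := χ.ringHomComp GaussianInt.toComplex)
    ((MulChar.ringHomComp_ne_one_iff hinj).2 h1) ((MulChar.ringHomComp_ne_one_iff hinj).2 h1)
    (by rw [← MulChar.ringHomComp_mul, ← sq]; exact (MulChar.ringHomComp_ne_one_iff hinj).2 h2)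
  rw [MulChar.ringHomComp_inv, inv_quarticChar hχ', jacobiSum_ringHomComp, jacobiSum_ringHomComp,
    jacobiSum_ringHomComp, ← map_mul] at key
  have key2 : jacobiSum χ χ * starRingEnd GaussianInt (jacobiSum χ χ) = (4 * k + 1 : ℕ) := by
    apply hinj
    rw [key, hcard, map_natCast]
  have key3 : ((jacobiSum χ χ).norm : GaussianInt) = (4 * k + 1 : ℕ) := by
    rw [Zsqrtd.norm_eq_mul_conj]; exact key2
  exact_mod_cast key3

lemma isPrimitiveRoot_ii : IsPrimitiveRoot ii 4 := by
  rw [IsPrimitiveRoot.iff (by norm_num)]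
  refine ⟨rfl, fun l h0 h1 => ?_⟩
  interval_cases l <;> decide

include hπ h hρ hk hcard hχ hχ' in
lemma jacobiSum_sq (hN : π.norm.natAbs = 4 * k + 1) : jacobiSum χ χ ^ 2 = π ^ 2 := by
  classical
  obtain ⟨c, hc⟩ := (hρ _).1 (map_jacobiSum_eq_zero hk hcard hχ)
  have hn := norm_jacobiSum hπ h hρ hcard hχ hχ'
  obtain ⟨z, -, hz⟩ := exists_jacobiSum_eq_neg_one_add (n := 4) (by norm_num)
    (quarticChar_pow_four hχ') (quarticChar_pow_four hχ') (by rw [hcard]; simp) isPrimitiveRoot_ii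
  have hcn : c.norm.natAbs = 1 := by
    have h1 : (4 * k + 1) * c.norm.natAbs = 4 * k + 1 := by
      rw [← hN, ← Int.natAbs_mul, ← Zsqrtd.norm_mul, ← hc, hn]; omega
    exact Nat.eq_of_mul_eq_mul_left (by omega : 0 < 4 * k + 1) (by rw [h1, mul_one])
  have h3 := norm_natAbs c
  rw [hcn] at h3
  have him : (2 : ℤ) ∣ c.im := by
    rw [hc] at hz
    have h1 := congrArg Zsqrtd.im hz
    have hii : (ii - 1) ^ 2 = ⟨0, -2⟩ := rfl
    rw [hii] at h1
    simp at h1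
    obtain ⟨y, hy⟩ : ∃ y, π.im = 2 * y := by
      rcases primary_parity h with h | h
      · exact ⟨π.im / 2, by omega⟩
      · exact ⟨π.im / 2, by omega⟩
    obtain ⟨x, hx⟩ : ∃ x, π.re = 2 * x + 1 := by
      rcases primary_parity h with h | h
      · exact ⟨π.re / 2, by omega⟩
      · exact ⟨π.re / 2, by omega⟩
    rw [hx, hy] at h1
    exact ⟨-z.re - x * c.im - y * c.re, by linarith⟩
  have him0 : c.im = 0 := by
    obtain ⟨y, hy⟩ := him
    rw [hy] at h3 ⊢
    have : y = 0 := by push_cast at h3; nlinarith [sq_nonneg c.re]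
    rw [this]; rfl
  rw [him0] at h3
  have hc2 : c ^ 2 = 1 := by
    rw [Zsqrtd.ext_iff, sq]
    simp [him0]
    push_cast at h3; linarith
  rw [hc, mul_pow, hc2, mul_one]

end JacobiSum

end QuarticResidue

namespace QuarticResidue

section GaussSum

variable {F : Type*} [Field F] [Fintype F] {K : Type*} [Field K] {χ : MulChar F K}
  {ψ : AddChar F K}

lemma gaussSum_pow_four (h4 : χ ^ 4 = 1) (h2 : χ ^ 2 ≠ 1) (hψ : ψ.IsPrimitive) :
    gaussSum χ ψ ^ 4 = jacobiSum χ χ ^ 2 * Fintype.card F := by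
  have h1 := jacobiSum_mul_nontrivial (χ := χ) (φ := χ) (by rwa [← sq]) ψ
  have hquad : (χ ^ 2).IsQuadratic := by
    intro a
    by_cases ha : a = 0
    · left; rw [ha, MulChar.map_zero]
    · right
      refine mul_self_eq_one_iff.1 ?_
      rw [← sq, ← MulChar.pow_apply' _ two_ne_zero, ← pow_mul, h4,
        MulChar.one_apply (isUnit_iff_ne_zero.2 ha)]
  have h3 := gaussSum_sq h2 hquad hψ
  have h5 : (χ ^ 2) (-1) = 1 := by
    rw [MulChar.pow_apply' _ two_ne_zero, ← map_pow, neg_one_sq, map_one]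
  rw [h5, one_mul] at h3
  rw [← sq, ← sq] at h1
  calc gaussSum χ ψ ^ 4 = (gaussSum χ ψ ^ 2) ^ 2 := by ring
    _ = _ := by rw [← h1, mul_pow, h3, mul_comm]

lemma gaussSum_pow_char (q : ℕ) [Fact q.Prime] [CharP K q] (hq : (q : F) ≠ 0) :
    (χ ^ q) q * gaussSum χ ψ ^ q = gaussSum (χ ^ q) ψ := by
  rw [gaussSum_frob q, AddChar.pow_mulShift]
  exact gaussSum_mulShift (χ ^ q) ψ (Units.mk0 (q : F) hq)

lemma gaussSum_pow_sub_one (h4 : χ ^ 4 = 1) (q : ℕ) [Fact q.Prime] [CharP K q]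
    (hq : (q : F) ≠ 0) {s : ℕ} (hs : q = 4 * s + 1) (hG : gaussSum χ ψ ≠ 0) :
    χ q * (gaussSum χ ψ ^ 4) ^ s = 1 := by
  have h := gaussSum_pow_char (χ := χ) (ψ := ψ) q hq
  have hχ : χ ^ q = χ := by rw [hs, pow_succ, pow_mul, h4, one_pow, one_mul]
  rw [hχ] at h
  have h2 : gaussSum χ ψ ^ q = (gaussSum χ ψ ^ 4) ^ s * gaussSum χ ψ := by
    rw [← pow_mul, ← pow_succ, hs]
  rw [h2, ← mul_assoc] at h
  exact mul_right_cancel₀ hG (by rw [h, one_mul])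

lemma gaussSum_pow_add_one (h4 : χ ^ 4 = 1) (h1 : χ ≠ 1) (hψ : ψ.IsPrimitive) (q : ℕ)
    [Fact q.Prime] [CharP K q] (hq : (q : F) ≠ 0) {s : ℕ} (hs : q = 4 * s + 3) :
    (gaussSum χ ψ ^ 4) ^ (s + 1) = χ (-q) * Fintype.card F := by
  have h := gaussSum_pow_char (χ := χ) (ψ := ψ) q hq
  have hχ : χ ^ q = χ⁻¹ := by
    rw [hs, pow_add, pow_mul, h4, one_pow, one_mul, eq_comm, inv_eq_iff_mul_eq_one, ← pow_succ', h4]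
  rw [hχ] at h
  have h5 := mul_gaussSum_inv_eq_gaussSum χ⁻¹ ψ
  have h6 := gaussSum_mul_gaussSum_eq_card h1 hψ
  have h7 : (gaussSum χ ψ ^ 4) ^ (s + 1) = gaussSum χ ψ * gaussSum χ ψ ^ q := by
    rw [← pow_mul, ← pow_succ', hs]; congr 1
  have h8 : χ q * χ⁻¹ q = 1 := by
    rw [← MulChar.mul_apply, mul_inv_cancel, MulChar.one_apply (isUnit_iff_ne_zero.2 hq)]
  have h9 : χ⁻¹ (-1) = χ (-1) := by
    rw [MulChar.inv_apply', inv_neg_one]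
  rw [h9] at h5
  have h10 : χ (-q) = χ (-1) * χ q := by rw [← map_mul, neg_one_mul]
  rw [h7, h10]
  linear_combination χ (-1) * χ q * h6 - χ q * gaussSum χ ψ * h5 + χ q * gaussSum χ ψ * h
   - gaussSum χ ψ * gaussSum χ ψ ^ q * h8

end GaussSum

end QuarticResidue

namespace QuarticResidue

lemma exists_hom_of_prime (q : ℕ) [Fact q.Prime] :
    ∃ (K : Type) (_ : Field K) (_ : CharP K q), Nonempty (GaussianInt →+* K) := by
  obtain ⟨z, hz⟩ := IsAlgClosed.exists_eq_mul_self (-1 : AlgebraicClosure (ZMod q))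
  exact ⟨AlgebraicClosure (ZMod q), inferInstance, inferInstance,
    ⟨Zsqrtd.lift ⟨z, by rw [← hz]; norm_num⟩⟩⟩

lemma map_pow_char {K : Type*} [Field K] (q : ℕ) [Fact q.Prime] [CharP K q]
    (f : GaussianInt →+* K) (y : GaussianInt) :
    f y ^ q = y.re + y.im * f ii ^ q := by
  have hy : f y = y.re + y.im * f ii := by
    conv_lhs => rw [show y = (y.re : GaussianInt) + (y.im : GaussianInt) * ii by
      rw [Zsqrtd.ext_iff]; simp [ii]]
    rw [map_add, map_mul, map_intCast, map_intCast]
  rw [hy, ← frobenius_def, map_add, map_mul, map_intCast, map_intCast, frobenius_def]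

lemma map_star_eq {K : Type*} [Field K] (f : GaussianInt →+* K) (y : GaussianInt) :
    f (star y) = y.re + y.im * f (ii ^ 3) := by
  conv_lhs => rw [show star y = (y.re : GaussianInt) + (y.im : GaussianInt) * ii ^ 3 by
    rw [Zsqrtd.ext_iff]; simp [ii, pow_succ]]
  rw [map_add, map_mul, map_intCast, map_intCast]

lemma map_iPow_injective_of_charP {K : Type*} [Field K] (q : ℕ) [Fact q.Prime] [CharP K q]
    (hq : q ≠ 2) (f : GaussianInt →+* K) {k l : ZMod 4} (hkl : f (iPow k) = f (iPow l)) :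
    k = l := by
  have key : ∀ k l : ZMod 4, k ≠ l → ∃ c : GaussianInt, c * (iPow k - iPow l) = 2 := by
    intro k l hkl
    refine ⟨if k = l + 2 then iPow (-k) else iPow (-k) * (1 - iPow (k - l)), ?_⟩
    revert k l
    decide
  by_contra hne
  obtain ⟨c, hc⟩ := key k l hne
  have h2 : (2 : K) = 0 := by
    rw [← map_ofNat f, ← hc, map_mul, map_sub, hkl, sub_self, mul_zero]
  have h3 : q ∣ 2 := (CharP.cast_eq_zero_iff K q 2).1 (by exact_mod_cast h2)
  have h4 := Nat.le_of_dvd (by norm_num) h3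
  have h5 := (Fact.out : q.Prime).two_le
  omega

variable {π : GaussianInt}

lemma lg_prime (hπ : Prime π) (h : IsPrimary π) (hp : π.norm.natAbs.Prime) {q : ℕ}
    (hq : q.Prime) (hqp : q ≠ π.norm.natAbs) (y : GaussianInt) (e : ℕ)
    (h1 : (q : GaussianInt) ∣ π ^ 2 * (π.norm.natAbs : ℕ) - y ^ 4 * ii ^ e)
    (h2 : (q : GaussianInt) ∣ y * star y - (π.norm.natAbs : ℕ)) (c : ℤ)
    (hc : (c = q ∨ c = -q) ∧ c % 4 = 1) :
    Lg π c (-(e : ZMod 4) * ((c - 1) / 4 : ℤ)) := by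
  obtain ⟨F, _, _, ρ, -, hρ, hcard'⟩ := exists_residueField hπ
  obtain ⟨k, hk, hN⟩ := exists_norm_eq hπ h
  have hcard : Fintype.card F = 4 * k + 1 := hcard'.trans hN
  obtain ⟨χ, hχ, hχ'⟩ := exists_quarticChar hπ h hρ hk hcard
  have h4 := quarticChar_pow_four hχ'
  have hsq := quarticChar_sq_ne_one hπ h hρ hcard hχ
  have hJ := jacobiSum_sq hπ h hρ hk hcard hχ hχ' hN
  set p := π.norm.natAbs with hpdef
  have hpF : (p : F) = 0 := by
    rw [← hcard']; exact Nat.cast_card_eq_zero F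
  have := charP_of_natCast_eq_zero hp hpF
  have : Fact q.Prime := ⟨hq⟩
  have hqF : (q : F) ≠ 0 := by
    rw [Ne, CharP.cast_eq_zero_iff F p q, Nat.prime_dvd_prime_iff_eq hp hq]
    exact fun h => hqp h.symm
  have hq2 : q ≠ 2 := by omega
  obtain ⟨K₀, _, _, ⟨f₀⟩⟩ := exists_hom_of_prime q
  have hchar : ringChar K₀ ≠ ringChar F := by
    rw [ringChar.eq K₀ q, ringChar.eq F p]; exact hqp
  set ψ := AddChar.FiniteField.primitiveChar F K₀ hchar
  set K := CyclotomicField ψ.n K₀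
  have : CharP K q := charP_of_injective_algebraMap (algebraMap K₀ K).injective q
  set f : GaussianInt →+* K := (algebraMap K₀ K).comp f₀
  have hinj : ∀ {k l : ZMod 4}, f (iPow k) = f (iPow l) → k = l :=
    map_iPow_injective_of_charP q hq2 f
  have hqK : f q = 0 := by rw [map_natCast]; exact CharP.cast_eq_zero K q
  have hpK : (p : K) ≠ 0 := by
    rw [Ne, CharP.cast_eq_zero_iff K q p, Nat.prime_dvd_prime_iff_eq hq hp]
    exact hqp
  have hT : f π ^ 2 * p = f y ^ 4 * f ii ^ e := by
    obtain ⟨z, hz⟩ := h1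
    have := congrArg f hz
    rw [map_mul, hqK, zero_mul, map_sub, map_mul, map_mul, map_pow, map_pow, map_pow,
      map_natCast, sub_eq_zero] at this
    exact this
  have hyy : f y * f (star y) = p := by
    obtain ⟨z, hz⟩ := h2
    have := congrArg f hz
    rw [map_mul, hqK, zero_mul, map_sub, map_mul, map_natCast, sub_eq_zero] at this
    exact this
  have hfy : f y ≠ 0 := left_ne_zero_of_mul (hyy.trans_ne hpK)
  have hfi : f ii ≠ 0 := by
    intro h0
    have := congrArg f ii_pow_four
    rw [map_pow, h0, map_one, zero_pow (by norm_num)] at this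
    exact zero_ne_one this
  set χK := χ.ringHomComp f
  have h4K : χK ^ 4 = 1 := by
    rw [MulChar.ringHomComp_pow, h4, MulChar.ringHomComp_one]
  have hsqK : χK ^ 2 ≠ 1 := by
    intro hh
    apply hsq
    refine MulChar.ext fun u => ?_
    have h5 := congrArg (fun X : MulChar F K => X u) hh
    obtain ⟨j, hj⟩ := hχ' u u.ne_zero
    simp only [MulChar.pow_apply_coe, MulChar.one_apply_coe, χK, MulChar.ringHomComp_apply, hj] at h5
    rw [MulChar.pow_apply_coe, hj, MulChar.one_apply_coe]
    have h6 : f (iPow (j + j)) = f (iPow 0) := by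
      rw [iPow_add, iPow_zero, map_mul, map_one, ← sq, h5]
    rw [sq, ← iPow_add, hinj h6, iPow_zero]
  have h1K : χK ≠ 1 := by
    intro h; apply hsqK; rw [h, one_pow]
  set G := gaussSum χK ψ.char
  have hG4 : G ^ 4 = f y ^ 4 * f ii ^ e := by
    rw [← hT, gaussSum_pow_four h4K hsqK ψ.prim, jacobiSum_ringHomComp, ← map_pow, hJ, map_pow,
      hcard']
  have hG0 : G ≠ 0 := by
    intro h0
    rw [h0, zero_pow (by norm_num)] at hG4
    exact mul_ne_zero (pow_ne_zero 4 hfy) (pow_ne_zero e hfi) hG4.symm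
  have hval : ∀ z : GaussianInt, χK (ρ z) = f (χ (ρ z)) := fun z => rfl
  have fin : ∀ (z : GaussianInt) (l : ZMod 4), χK (ρ z) = f (iPow l) → ρ z ≠ 0 → Lg π z l := by
    intro z l hz hz0
    rw [← mulChar_apply_eq_iff hπ h hρ hN hχ hχ']
    obtain ⟨j, hj⟩ := hχ' _ hz0
    rw [hval, hj] at hz
    rw [hj, hinj hz]
  rcases hc with ⟨rfl | rfl, hc4⟩
  · obtain ⟨s, hs⟩ : ∃ s, q = 4 * s + 1 := ⟨q / 4, by omega⟩
    have h5 := gaussSum_pow_sub_one h4K q hqF hs hG0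
    have h6 : f y ^ (4 * s) = 1 := by
      refine mul_right_cancel₀ hfy ?_
      rw [one_mul, ← pow_succ, ← hs, map_pow_char, hs, ← map_pow, pow_succ, pow_mul, ii_pow_four,
        one_pow, one_mul]
      conv_rhs => rw [show y = (y.re : GaussianInt) + (y.im : GaussianInt) * ii by
        rw [Zsqrtd.ext_iff]; simp [ii]]
      simp
    have hcs : ((q : ℤ) - 1) / 4 = s := by omega
    rw [hcs]
    refine fin _ _ ?_ (by simpa using hqF)
    rw [hG4, mul_pow, ← pow_mul, h6, one_mul] at h5
    have h7 : f (iPow (-(e : ZMod 4) * (s : ℤ))) * (f ii ^ e) ^ s = 1 := by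
      rw [← pow_mul, ← map_pow, ← iPow_natCast, ← map_mul, ← iPow_add]
      have : -(e : ZMod 4) * ((s : ℤ) : ZMod 4) + ((e * s : ℕ) : ZMod 4) = 0 := by
        push_cast; ring
      rw [this, iPow_zero, map_one]
    have h8 : (f ii ^ e) ^ s ≠ 0 := pow_ne_zero _ (pow_ne_zero _ hfi)
    refine mul_right_cancel₀ h8 ?_
    rw [h7, ← h5]
    simp
  · obtain ⟨s, hs⟩ : ∃ s, q = 4 * s + 3 := ⟨q / 4, by omega⟩
    have h5 := gaussSum_pow_add_one h4K h1K ψ.prim q hqF hs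
    have h6 : f y ^ (4 * (s + 1)) = p := by
      rw [show 4 * (s + 1) = q + 1 by omega, pow_succ', map_pow_char, ← hyy, map_star_eq, hs,
        ← map_pow, pow_add, pow_mul, ii_pow_four, one_pow, one_mul]
    have hcs : (-(q : ℤ) - 1) / 4 = -(s + 1 : ℕ) := by push_cast; omega
    rw [hcs]
    refine fin _ _ ?_ (by simpa using hqF)
    rw [hG4, mul_pow, ← pow_mul, h6, hcard'] at h5
    have h7 : -(e : ZMod 4) * ((-(s + 1 : ℕ) : ℤ) : ZMod 4) = ((e * (s + 1) : ℕ) : ZMod 4) := by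
      push_cast; ring
    rw [h7, iPow_natCast, map_pow, pow_mul]
    refine mul_right_cancel₀ hpK ?_
    rw [mul_comm (_ ^ (s + 1)), h5]
    simp

end QuarticResidue

namespace QuarticResidue

variable {π : GaussianInt}

lemma Lg.of_mul {g h : GaussianInt} {k l : ZMod 4} (hgh : Lg π (g * h) (k + l)) (hh : Lg π h l) :
    Lg π g k := by
  have h1 : π ∣ (g ^ ((π.norm.natAbs - 1) / 4) - iPow k) * iPow l := by
    have h2 := dvd_sub hgh (hh.mul_left (g ^ ((π.norm.natAbs - 1) / 4)))
    rw [mul_pow, iPow_add] at h2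
    convert h2 using 1
    ring
  exact (isUnit_iPow l).dvd_mul_right.1 h1

lemma lg_of_primeFactors (hπ : Prime π) (h : IsPrimary π) (hp : π.norm.natAbs.Prime) (e n : ℕ)
    (H : ∀ q : ℕ, q.Prime → q ∣ n → q ≠ π.norm.natAbs ∧ ∃ y : GaussianInt,
      (q : GaussianInt) ∣ π ^ 2 * (π.norm.natAbs : ℕ) - y ^ 4 * ii ^ e ∧
      (q : GaussianInt) ∣ y * star y - (π.norm.natAbs : ℕ)) :
    ∀ c : ℤ, (c = n ∨ c = -n) → c % 4 = 1 → Lg π c (-(e : ZMod 4) * ((c - 1) / 4 : ℤ)) := by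
  induction n using Nat.recOnMul with
  | zero => intro c hc hc4; simp at hc; omega
  | one =>
    intro c hc hc4
    obtain rfl : c = 1 := by omega
    simpa using Lg.one π
  | prime q hq =>
    intro c hc hc4
    obtain ⟨h1, y, h2, h3⟩ := H q hq dvd_rfl
    exact lg_prime hπ h hp hq h1 y e h2 h3 c ⟨hc, hc4⟩
  | mul a b iha ihb =>
    intro c hc hc4
    have ihA := iha fun q hq hqa => H q hq (hqa.mul_right b)
    have ihB := ihb fun q hq hqb => H q hq (hqb.mul_left a)
    have hodd : a % 2 = 1 ∧ b % 2 = 1 := by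
      have : ((a * b : ℕ) : ℤ) % 2 = 1 := by omega
      have h2 : (a * b) % 2 = 1 := by omega
      exact ⟨Nat.odd_iff.1 (Nat.odd_mul.1 (Nat.odd_iff.2 h2)).1,
        Nat.odd_iff.1 (Nat.odd_mul.1 (Nat.odd_iff.2 h2)).2⟩
    have key : ∀ n : ℕ, n % 2 = 1 → ∃ (c k : ℤ), (c = n ∨ c = -n) ∧ c = 4 * k + 1 := by
      intro n hn
      rcases (by omega : n % 4 = 1 ∨ n % 4 = 3) with h | h
      · exact ⟨n, n / 4, Or.inl rfl, by omega⟩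
      · exact ⟨-n, (-n) / 4, Or.inr rfl, by omega⟩
    obtain ⟨ca, ka, hca, hka⟩ := key a hodd.1
    obtain ⟨cb, kb, hcb, hkb⟩ := key b hodd.2
    have hcab : c = ca * cb := by
      have h1 : ca * cb = 4 * (4 * ka * kb + ka + kb) + 1 := by rw [hka, hkb]; ring
      have h2 : ca * cb = (a * b : ℕ) ∨ ca * cb = -(a * b : ℕ) := by
        push_cast
        rcases hca with h | h <;> rcases hcb with h' | h' <;> rw [h, h'] <;> simp
      omega
    have h1 := (ihA ca hca (by omega)).mul (ihB cb hcb (by omega))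
    have e1 : (ca - 1) / 4 = ka := by omega
    have e2 : (cb - 1) / 4 = kb := by omega
    have e3 : (c - 1) / 4 = 4 * (ka * kb) + ka + kb := by
      have : c = 4 * (4 * (ka * kb) + ka + kb) + 1 := by rw [hcab, hka, hkb]; ring
      omega
    rw [e1, e2] at h1
    rw [e3, hcab]
    convert h1 using 1
    · push_cast; rfl
    · push_cast
      rw [show (4 : ZMod 4) = 0 from rfl]
      ring

lemma lg_re (hπ : Prime π) (h : IsPrimary π) (hp : π.norm.natAbs.Prime) (c : ℤ)
    (hc : c = π.re ∨ c = -π.re) (hc4 : c % 4 = 1) : Lg π c (2 * ((c - 1) / 4 : ℤ)) := by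
  have hN := norm_natAbs π
  have hpar := primary_parity h
  have key := lg_of_primeFactors hπ h hp 2 π.re.natAbs (fun q hq hqn => ?_) c (by omega) hc4
  · convert key using 1
    rw [show -((2 : ℕ) : ZMod 4) = 2 from rfl]
  obtain ⟨x, hx⟩ : (q : ℤ) ∣ π.re := Int.natCast_dvd.2 hqn
  refine ⟨?_, (π.im : GaussianInt), ?_, ?_⟩
  · intro hqp
    rw [← hqp] at hN
    have hx0 : x ≠ 0 := by rintro rfl; omega
    have h1 : (1 : ℤ) ≤ x ^ 2 := by have := sq_pos_of_ne_zero hx0; omega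
    have h2 : (2 : ℤ) ≤ q := by exact_mod_cast hq.two_le
    rw [hx, mul_pow] at hN
    have h3 := mul_le_mul_of_nonneg_left h1 (sq_nonneg (q : ℤ))
    nlinarith [sq_nonneg π.im]
  · rw [show ((π.norm.natAbs : ℕ) : GaussianInt) = ((π.norm.natAbs : ℤ) : GaussianInt) by simp, hN]
    have hπe : π = (π.re : GaussianInt) + (π.im : GaussianInt) * ii := by
      rw [Zsqrtd.ext_iff]; simp [ii]
    have h1 : (π.re : GaussianInt) = q * x := by rw [hx]; push_cast; rfl
    rw [show π ^ 2 = ((π.re : GaussianInt) + (π.im : GaussianInt) * ii) ^ 2 by rw [← hπe]]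
    push_cast
    rw [h1]
    generalize (π.im : GaussianInt) = y
    refine ⟨x * (q * x + 2 * y * ii) * ((q * x) ^ 2 + y ^ 2) - y ^ 2 * x * (q * x), ?_⟩
    linear_combination (y ^ 2 * (q * x) ^ 2 ) * ii_sq
  · rw [show ((π.norm.natAbs : ℕ) : GaussianInt) = ((π.norm.natAbs : ℤ) : GaussianInt) by simp, hN,
      hx]
    refine ⟨-(x * (q * x)), ?_⟩
    simp only [star_intCast]
    push_cast
    ring

lemma lg_re_add_im (hπ : Prime π) (h : IsPrimary π) (hp : π.norm.natAbs.Prime)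
    (hc4 : (π.re + π.im) % 4 = 1) :
    Lg π (π.re + π.im : ℤ) (-((π.re + π.im - 1) / 4 : ℤ)) := by
  have hN := norm_natAbs π
  have hpar := primary_parity h
  have key := lg_of_primeFactors hπ h hp 1 (π.re + π.im).natAbs (fun q hq hqn => ?_)
    (π.re + π.im) (by omega) hc4
  · convert key using 1
    push_cast; ring
  obtain ⟨x, hx⟩ : (q : ℤ) ∣ π.re + π.im := Int.natCast_dvd.2 hqn
  have him : π.im = q * x - π.re := by omega
  refine ⟨?_, (π.re : GaussianInt) * tt, ?_, ?_⟩
  · intro hqp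
    have h4 := norm_mod_four h
    rw [← hqp] at hN h4
    have hx0 : x ≠ 0 := by rintro rfl; omega
    have h1 : (1 : ℤ) ≤ x ^ 2 := by have := sq_pos_of_ne_zero hx0; omega
    have h2 : (3 : ℤ) ≤ q := by have := hq.two_le; omega
    have h3 : (q * x) ^ 2 ≤ 2 * (q : ℤ) := by
      rw [← hx, hN]; nlinarith [sq_nonneg (π.re - π.im)]
    rw [mul_pow] at h3
    have h5 := mul_le_mul_of_nonneg_left h1 (sq_nonneg (q : ℤ))
    nlinarith
  · rw [show ((π.norm.natAbs : ℕ) : GaussianInt) = ((π.norm.natAbs : ℤ) : GaussianInt) by simp, hN]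
    have hπe : π = (π.re : GaussianInt) + (π.im : GaussianInt) * ii := by
      rw [Zsqrtd.ext_iff]; simp [ii]
    rw [show π ^ 2 = ((π.re : GaussianInt) + (π.im : GaussianInt) * ii) ^ 2 by rw [← hπe], him,
      mul_pow, show tt ^ 4 = -4 from rfl]
    push_cast
    generalize (π.re : GaussianInt) = a
    have e1 : (a + (q * x - a) * ii) ^ 2 = -2 * a ^ 2 * ii + q * (x * (2 * a * ii - q * x + 2 * a)) := by
      linear_combination (q * x - a) ^ 2 * ii_sq
    rw [e1]
    refine ⟨x * (2 * a * ii - q * x + 2 * a) * (a ^ 2 + (q * x - a) ^ 2) +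
      (-2 * a ^ 2 * ii) * (x * (q * x - 2 * a)), ?_⟩
    ring
  · rw [show ((π.norm.natAbs : ℕ) : GaussianInt) = ((π.norm.natAbs : ℤ) : GaussianInt) by simp, hN,
      him]
    refine ⟨x * (2 * π.re - q * x), ?_⟩
    rw [star_mul', star_intCast, mul_mul_mul_comm, show tt * star tt = 2 from rfl]
    push_cast
    ring

/-- The supplementary law for the prime `1 + i`. -/
lemma lg_tt (hπ : Prime π) (h : IsPrimary π) {m n : ZMod 4}
    (hmn : tt ^ 7 ∣ π - (1 - 4 * ii) ^ m.val * (-1 - 6 * ii) ^ n.val) : Lg π tt m := by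
  rcases norm_prime_or_eq_neg hπ h with hp | ⟨q, hq, hq3, rfl⟩
  swap
  · exact lg_tt_of_inert hπ h hmn hq hq3 rfl
  obtain ⟨hr, hr'⟩ := residue_of_dvd hmn
  have h40 : (4 : ZMod 4) = 0 := rfl
  have hsum : (π.re + π.im) % 4 = 1 := by
    have := primary_parity h; omega
  have h1 : Lg π (tt * (π.re : ℤ)) (-((π.re + π.im - 1) / 4 : ℤ)) := by
    refine (lg_re_add_im hπ h hp hsum).congr ⟨ii, ?_⟩
    rw [Zsqrtd.ext_iff]; simp [ii, tt]
  rcases primary_parity h with ⟨ha, hb⟩ | ⟨ha, hb⟩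
  · obtain ⟨a, ha⟩ : ∃ a, π.re = 4 * a + 1 := ⟨π.re / 4, by omega⟩
    obtain ⟨b, hb⟩ : ∃ b, π.im = 4 * b := ⟨π.im / 4, by omega⟩
    have h2 := lg_re hπ h hp π.re (Or.inl rfl) (by omega)
    refine Lg.of_mul (l := _) ?_ h2
    convert h1 using 1
    have e1 : (π.re - 1) / 4 = a := by omega
    have e2 : (π.re + π.im - 1) / 4 = a + b := by omega
    have e3 : m = ((a - b : ℤ) : ZMod 4) := by
      rw [← ZMod.natCast_zmod_val m, ← Int.cast_natCast, ZMod.intCast_eq_intCast_iff']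
      have : π.im ^ 2 = 16 * b ^ 2 := by rw [hb]; ring
      omega
    rw [e1, e2, e3]
    push_cast
    linear_combination (a : ZMod 4) * h40
  · obtain ⟨a, ha⟩ : ∃ a, π.re = 4 * a + 3 := ⟨π.re / 4, by omega⟩
    obtain ⟨b, hb⟩ : ∃ b, π.im = 4 * b + 2 := ⟨π.im / 4, by omega⟩
    have h2 := (lg_neg_one (lg_ii hmn)).mul (lg_re hπ h hp (-π.re) (Or.inr rfl) (by omega))
    rw [show (-1 : GaussianInt) * ((-π.re : ℤ) : GaussianInt) = (π.re : ℤ) by push_cast; ring] at h2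
    refine Lg.of_mul (l := _) ?_ h2
    convert h1 using 1
    have e1 : (-π.re - 1) / 4 = -a - 1 := by omega
    have e2 : (π.re + π.im - 1) / 4 = a + b + 1 := by omega
    have e5 : π.im ^ 2 = 16 * (b ^ 2 + b) + 4 := by rw [hb]; ring
    have e6 : π.re ^ 2 = 16 * (a ^ 2 + a) + 8 * a + 9 := by rw [ha]; ring
    have e3 : m = ((a - b - 1 : ℤ) : ZMod 4) := by
      rw [← ZMod.natCast_zmod_val m, ← Int.cast_natCast, ZMod.intCast_eq_intCast_iff']
      omega
    have e4 : n = ((2 * a + 3 : ℤ) : ZMod 4) := by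
      rw [← ZMod.natCast_zmod_val n, ← Int.cast_natCast, ZMod.intCast_eq_intCast_iff']
      omega
    rw [e1, e2, e3, e4]
    push_cast
    linear_combination (a + 1 : ZMod 4) * h40

end QuarticResidue

namespace LocalField

open WithZero Topology Filter QuarticResidue

variable {v : HeightOneSpectrum GaussianInt} {π : GaussianInt}

lemma emb_ne_zero {g : GaussianInt} (hg : g ≠ 0) : emb v g ≠ 0 := fun h =>
  hg (emb_injective (by rw [h, map_zero]))

lemma hasLocalPoint_iff {b d : GaussianInt} (hd : d ≠ 0)
    (hv : v.asIdeal = Ideal.span {π}) :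
    HasLocalPoint b d π ↔ QuarticSolvable (emb v d) (emb v b / emb v d) := by
  rw [← homogeneousSpace_iff (t := emb v tt) (emb_ne_zero hd) (emb_ne_zero (by decide))
    (by rw [← map_pow, show tt ^ 4 = -4 from rfl, map_neg, map_ofNat])]
  constructor
  · intro h
    exact h v hv
  · intro h v' hv'
    obtain rfl : v' = v := HeightOneSpectrum.ext (hv'.trans hv.symm)
    exact h

lemma exists_heightOneSpectrum (hπ : Prime π) :
    ∃ v : HeightOneSpectrum GaussianInt, v.asIdeal = Ideal.span {π} :=
  ⟨⟨Ideal.span {π}, (Ideal.span_singleton_prime hπ.ne_zero).2 hπ, by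
    simpa using hπ.ne_zero⟩, rfl⟩

lemma exists_pow_eq_emb_iff (hv : v.asIdeal = Ideal.span {π}) {n : ℕ} (hn : n ≠ 0)
    (hens : ∀ x, val v (x - 1) < 1 → ∃ y, y ^ n = x) {g : GaussianInt} (hg : ¬ π ∣ g) :
    (∃ y, y ^ n = emb v g) ↔ ∃ h, π ∣ h ^ n - g := by
  have hg1 := (val_emb_eq_one_iff hv g).2 hg
  constructor
  · rintro ⟨y, hy⟩
    have hy1 : val v y ≤ 1 := by
      rw [← pow_le_one_iff hn, ← map_pow, hy, hg1]
    obtain ⟨h, hh⟩ := exists_emb_near y hy1 1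
    refine ⟨h, ?_⟩
    rw [← pow_one π, ← val_emb_le_iff hv, map_sub, map_pow, ← hy]
    obtain ⟨c, hc⟩ : (emb v h - y) ∣ emb v h ^ n - y ^ n := sub_dvd_pow_sub_pow _ _ n
    have hc' : emb v h ^ n - y ^ n =
        (emb v h - y) * ∑ i ∈ Finset.range n, emb v h ^ i * y ^ (n - 1 - i) := by
      rw [mul_comm, Commute.geom_sum₂_mul (Commute.all _ _)]
    rw [hc', map_mul, Valuation.map_sub_swap]
    refine (mul_le_mul' hh (Valuation.map_sum_le _ (g := 1) fun i _ => ?_)).trans (mul_one _).le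
    rw [map_mul, map_pow, map_pow]
    exact mul_le_one' (pow_le_one' (val_emb_le_one h) _) (pow_le_one' hy1 _)
  · rintro ⟨h, hh⟩
    have hlt : val v (emb v (h ^ n - g)) < 1 := by
      refine ((val_emb_le_iff hv _ 1).2 (by rwa [pow_one])).trans_lt ?_
      rw [← exp_zero, exp_lt_exp]; norm_num
    have hh0 : ¬ π ∣ h := fun h0 => hg <| by
      have := dvd_sub (dvd_pow h0 hn) hh
      rwa [sub_sub_cancel] at this
    have hv1 : val v (emb v h ^ n) = 1 := by
      rw [map_pow, (val_emb_eq_one_iff hv h).2 hh0, one_pow]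
    have hne : emb v h ^ n ≠ 0 := fun h0 => by rw [h0, map_zero] at hv1; exact zero_ne_one hv1
    obtain ⟨y, hy⟩ := hens (emb v g / emb v h ^ n) (by
      rwa [div_sub_one hne, map_div₀, hv1, div_one, Valuation.map_sub_swap, ← map_pow, ← map_sub])
    exact ⟨y * emb v h, by rw [mul_pow, hy, div_mul_cancel₀ _ hne]⟩

section Odd

variable (hπ : Prime π) (h : IsPrimary π) (hv : v.asIdeal = Ideal.span {π})

include hπ h hv

lemma val_two : val v 2 = 1 := by
  have := (val_emb_eq_one_iff hv 2).2 (not_dvd_two hπ h)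
  rwa [map_ofNat] at this

lemma isSquare_emb_iff {g : GaussianInt} {k : ZMod 4} (hk : Lg π g k) :
    IsSquare (emb v g) ↔ c2 k = 0 := by
  rw [← hk.exists_sq_iff hπ h, ← exists_pow_eq_emb_iff hv two_ne_zero _ (hk.not_dvd hπ h)]
  · rw [isSquare_iff_exists_sq]; simp only [eq_comm]
  · intro x hx
    obtain ⟨y, hy⟩ := isSquare_of_near_one _ (val_two hπ h hv) exists_sq_add_self hx
    exact ⟨y, by rw [hy, sq]⟩

lemma exists_pow_four_emb_iff {g : GaussianInt} {k : ZMod 4} (hk : Lg π g k) :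
    (∃ y, y ^ 4 = emb v g) ↔ k = 0 := by
  rw [← hk.exists_pow_four_iff hπ h, ← exists_pow_eq_emb_iff hv four_ne_zero _ (hk.not_dvd hπ h)]
  exact fun x hx => isFourthPower_of_near_one _ (val_two hπ h hv) exists_sq_add_self hx

lemma isSquare_div_emb_iff {f g : GaussianInt} {k l : ZMod 4} (hk : Lg π f k) (hl : Lg π g l) :
    IsSquare (emb v f / emb v g) ↔ c2 (k + l) = 0 := by
  have hg : emb v g ≠ 0 := emb_ne_zero fun h0 => hl.not_dvd hπ h (h0 ▸ dvd_zero _)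
  rw [← isSquare_emb_iff hπ h hv (hk.mul hl), map_mul]
  constructor
  · rintro ⟨y, hy⟩
    exact ⟨y * emb v g, by rw [div_eq_iff hg] at hy; rw [hy]; ring⟩
  · rintro ⟨y, hy⟩
    exact ⟨y / emb v g, by field_simp; rw [hy]; ring⟩

lemma log_val_emb {g : GaussianInt} {k : ZMod 4} (hk : Lg π g k) : log (val v (emb v g)) = 0 := by
  rw [(val_emb_eq_one_iff hv g).2 (hk.not_dvd hπ h)]; rfl

omit h in
lemma log_val_uniformizer : log (val v (emb v π)) = -1 := by
  rw [val_uniformizer hπ.ne_zero hv, log_exp]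

variable {b d : GaussianInt} {k l : ZMod 4} {r : ℕ} (hd : Lg π d k) (hb : Lg π b l)

include hd hb

lemma quarticSolvable_odd_unit (hr : r % 2 = 1) :
    QuarticSolvable (emb v d) (emb v (π ^ r * b) / emb v d) ↔ c2 k = 0 := by
  have hd0 : emb v d ≠ 0 := emb_ne_zero fun h0 => hd.not_dvd hπ h (h0 ▸ dvd_zero _)
  have hb0 : emb v b ≠ 0 := emb_ne_zero fun h0 => hb.not_dvd hπ h (h0 ▸ dvd_zero _)
  have hp0 : emb v π ≠ 0 := emb_ne_zero hπ.ne_zero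
  have vd := log_val_emb hπ h hv hd
  have vb := log_val_emb hπ h hv hb
  have vp := log_val_uniformizer hπ hv
  rw [map_mul, map_pow]
  have hB : emb v π ^ r * emb v b / emb v d ≠ 0 := by positivity
  have vB : log (val v (emb v π ^ r * emb v b / emb v d)) = -r := by
    rw [map_div₀, map_mul, map_pow, log_div (by simpa using ⟨fun h => absurd h hp0, hb0⟩) (by simpa),
      log_mul (by simp [hp0]) (by simpa), log_pow, vd, vb, vp]
    simp
  rw [quarticSolvable_iff_of_val_ne (val v) (val_two hπ h hv) exists_sq_add_self hd0 hB,
    isSquare_emb_iff hπ h hv hd, or_iff_left]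
  · rintro ⟨y, hy⟩
    have hy0 : y ≠ 0 := by rintro rfl; simp at hy; tauto
    rw [hy, map_mul, log_mul (by simpa) (by simpa)] at vB
    omega
  · intro s hs e
    have := congrArg log e
    rw [map_mul, map_pow, log_mul (by simpa using hB) (by simpa), log_pow, vd, vB] at this
    simp at this
    omega

lemma quarticSolvable_odd_dvd (hr : r % 2 = 0) :
    QuarticSolvable (emb v (π * d)) (emb v (π ^ (r + 1) * b) / emb v (π * d)) ↔ c2 (l + k) = 0 := by
  have hd0 : emb v d ≠ 0 := emb_ne_zero fun h0 => hd.not_dvd hπ h (h0 ▸ dvd_zero _)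
  have hb0 : emb v b ≠ 0 := emb_ne_zero fun h0 => hb.not_dvd hπ h (h0 ▸ dvd_zero _)
  have hp0 : emb v π ≠ 0 := emb_ne_zero hπ.ne_zero
  have vd := log_val_emb hπ h hv hd
  have vb := log_val_emb hπ h hv hb
  have vp := log_val_uniformizer hπ hv
  have hBe : emb v (π ^ (r + 1) * b) / emb v (π * d) = emb v π ^ r * (emb v b / emb v d) := by
    simp only [map_mul, map_pow, pow_succ]; field_simp
  rw [hBe]
  have hB : emb v π ^ r * (emb v b / emb v d) ≠ 0 := by positivity
  have hA : emb v (π * d) ≠ 0 := by rw [map_mul]; exact mul_ne_zero hp0 hd0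
  have vA : log (val v (emb v (π * d))) = -1 := by
    rw [map_mul, map_mul, log_mul (by simpa) (by simpa), vp, vd, add_zero]
  have vB : log (val v (emb v π ^ r * (emb v b / emb v d))) = -r := by
    rw [map_mul, map_pow, map_div₀, log_mul (by simp [hp0]) (by simpa using ⟨hb0, hd0⟩), log_pow,
      log_div (by simpa) (by simpa), vd, vb, vp]
    simp
  rw [quarticSolvable_iff_of_val_ne (val v) (val_two hπ h hv) exists_sq_add_self hA hB,
    or_iff_right, ← isSquare_div_emb_iff hπ h hv hb hd]
  · obtain ⟨s, rfl⟩ : ∃ s, r = s + s := ⟨r / 2, by omega⟩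
    constructor
    · rintro ⟨y, hy⟩
      refine ⟨y / emb v π ^ s, ?_⟩
      rw [pow_add] at hy
      have : emb v π ^ s ≠ 0 := pow_ne_zero _ hp0
      rw [div_mul_div_comm, ← hy, mul_div_cancel_left₀ _ (mul_ne_zero this this)]
    · rintro ⟨y, hy⟩
      exact ⟨y * emb v π ^ s, by rw [hy, pow_add]; ring⟩
  · rintro ⟨y, hy⟩
    have hy0 : y ≠ 0 := by rintro rfl; simp [hp0] at hy; simp [hy] at hd0
    rw [hy, map_mul, log_mul (by simpa) (by simpa)] at vA
    omega
  · intro s hs e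
    have := congrArg log e
    rw [map_mul _ _ (s ^ 4), map_pow, log_mul (by simpa using hB) (by simpa), log_pow, vA, vB] at this
    simp at this
    omega

lemma quarticSolvable_two_unit :
    QuarticSolvable (emb v d) (emb v (π ^ 2 * b) / emb v d) ↔ c2 k = 0 ∨ c2 (l + k) = 0 := by
  have hd0 : emb v d ≠ 0 := emb_ne_zero fun h0 => hd.not_dvd hπ h (h0 ▸ dvd_zero _)
  have hb0 : emb v b ≠ 0 := emb_ne_zero fun h0 => hb.not_dvd hπ h (h0 ▸ dvd_zero _)
  have hp0 : emb v π ≠ 0 := emb_ne_zero hπ.ne_zero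
  have vd := log_val_emb hπ h hv hd
  have vb := log_val_emb hπ h hv hb
  have vp := log_val_uniformizer hπ hv
  rw [map_mul, map_pow, mul_div_assoc]
  have hB : emb v π ^ 2 * (emb v b / emb v d) ≠ 0 := by positivity
  have vB : log (val v (emb v π ^ 2 * (emb v b / emb v d))) = -2 := by
    rw [map_mul, map_pow, map_div₀, log_mul (by simp [hp0]) (by simpa using ⟨hb0, hd0⟩), log_pow,
      log_div (by simpa) (by simpa), vd, vb, vp]
    simp
  rw [quarticSolvable_iff_of_val_ne (val v) (val_two hπ h hv) exists_sq_add_self hd0 hB,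
    isSquare_emb_iff hπ h hv hd, ← isSquare_div_emb_iff hπ h hv hb hd]
  · refine or_congr_right ⟨?_, ?_⟩
    · rintro ⟨y, hy⟩
      refine ⟨y / emb v π, ?_⟩
      rw [div_mul_div_comm, ← hy, ← sq, mul_div_cancel_left₀ _ (pow_ne_zero 2 hp0)]
    · rintro ⟨y, hy⟩
      exact ⟨y * emb v π, by rw [hy]; ring⟩
  · intro s hs e
    have := congrArg log e
    rw [map_mul _ _ (s ^ 4), map_pow, log_mul (by simpa using hB) (by simpa), log_pow, vd, vB] at this
    simp at this
    omega

lemma quarticSolvable_two_dvd {n : ZMod 4} (hn : Lg π ii n) :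
    QuarticSolvable (emb v (π * d)) (emb v (π ^ 2 * b) / emb v (π * d)) ↔
      2 * n + 2 * k + 3 * l = 0 := by
  have hd0 : emb v d ≠ 0 := emb_ne_zero fun h0 => hd.not_dvd hπ h (h0 ▸ dvd_zero _)
  have hb0 : emb v b ≠ 0 := emb_ne_zero fun h0 => hb.not_dvd hπ h (h0 ▸ dvd_zero _)
  have hp0 : emb v π ≠ 0 := emb_ne_zero hπ.ne_zero
  have vd := log_val_emb hπ h hv hd
  have vb := log_val_emb hπ h hv hb
  have vp := log_val_uniformizer hπ hv
  have hBe : emb v (π ^ 2 * b) / emb v (π * d) = emb v π * (emb v b / emb v d) := by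
    simp only [map_mul, map_pow]; field_simp
  rw [hBe]
  have hB : emb v π * (emb v b / emb v d) ≠ 0 := by positivity
  have hA : emb v (π * d) ≠ 0 := by rw [map_mul]; exact mul_ne_zero hp0 hd0
  have vA : log (val v (emb v (π * d))) = -1 := by
    rw [map_mul, map_mul, log_mul (by simpa) (by simpa), vp, vd, add_zero]
  have vB : log (val v (emb v π * (emb v b / emb v d))) = -1 := by
    rw [map_mul, map_div₀, log_mul (by simpa) (by simpa using ⟨hb0, hd0⟩),
      log_div (by simpa) (by simpa), vd, vb, vp]
    simp
  have hL : Lg π (-1 * d ^ 2 * b ^ 3) (2 * n + 2 * k + 3 * l) := by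
    have := ((lg_neg_one hn).mul (hd.pow 2)).mul (hb.pow 3)
    exact_mod_cast this
  rw [quarticSolvable_iff_of_val_eq (val v) (val_two hπ h hv) exists_sq_add_self hA hB,
    ← exists_pow_four_emb_iff hπ h hv hL]
  · simp only [map_mul, map_pow, map_neg, map_one]
    constructor
    · rintro ⟨t, ht⟩
      refine ⟨t * emb v b, ?_⟩
      field_simp at ht
      rw [mul_pow]
      linear_combination -emb v b ^ 3 * ht
    · rintro ⟨y, hy⟩
      refine ⟨y / emb v b, ?_⟩
      rw [div_pow, hy]
      field_simp
  · have := congrArg exp (vA.trans vB.symm)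
    rwa [exp_log ((Valuation.ne_zero_iff (val v)).2 hA),
      exp_log ((Valuation.ne_zero_iff (val v)).2 hB)] at this
  · intro s e
    have hs : s ≠ 0 := by
      rintro rfl
      rw [zero_pow two_ne_zero, map_zero, Valuation.zero_iff] at e
      exact hA e
    have := congrArg log e
    rw [map_pow, log_pow, vA] at this
    simp at this
    omega

end Odd

end LocalField

namespace LocalField

open WithZero Topology Filter QuarticResidue

lemma tt_dvd_iff (z : GaussianInt) : tt ∣ z ↔ (z.re + z.im) % 2 = 0 := by
  constructor
  · rintro ⟨y, rfl⟩
    simp [tt, ii]; omega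
  · intro h
    refine ⟨⟨(z.re + z.im) / 2, (z.im - z.re) / 2⟩, ?_⟩
    rw [Zsqrtd.ext_iff]; simp [tt, ii]; omega

lemma tt_pow_five_dvd_sq_sub_or {g : GaussianInt} (hg : ¬ tt ∣ g) :
    ∃ ε : GaussianInt, (ε = 1 ∨ ε = -1) ∧ tt ^ 5 ∣ g ^ 2 - ε := by
  rw [tt_dvd_iff] at hg
  have key : ∀ a b : ℤ, a % 2 = 1 → b % 2 = 0 → tt ^ 5 ∣ (⟨a, b⟩ : GaussianInt) ^ 2 - 1 := by
    intro a b ha hb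
    obtain ⟨a, rfl⟩ : ∃ x, a = 2 * x + 1 := ⟨a / 2, by omega⟩
    obtain ⟨b, rfl⟩ : ∃ x, b = 2 * x := ⟨b / 2, by omega⟩
    have e : (⟨2 * a + 1, 2 * b⟩ : GaussianInt) ^ 2 - 1 =
        tt ^ 4 * ⟨b ^ 2 - a ^ 2 - a, -(2 * a * b + b)⟩ := by
      rw [show tt ^ 4 = -4 from rfl, Zsqrtd.ext_iff]
      simp [sq]
      constructor <;> ring
    rw [e, pow_succ]
    refine mul_dvd_mul_left _ ((tt_dvd_iff _).2 ?_)
    have h1 : (a ^ 2 + a) % 2 = 0 := by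
      rw [sq, Int.add_emod, Int.mul_emod]; rcases Int.emod_two_eq a with h | h <;> simp [h]
    have h2 : (b ^ 2 + b) % 2 = 0 := by
      rw [sq, Int.add_emod, Int.mul_emod]; rcases Int.emod_two_eq b with h | h <;> simp [h]
    have h3 : 2 * a * b = 2 * (a * b) := by ring
    simp only
    omega
  rcases (by omega : g.re % 2 = 1 ∧ g.im % 2 = 0 ∨ g.im % 2 = 1 ∧ (-g.re) % 2 = 0) with h | h
  · exact ⟨1, Or.inl rfl, key _ _ h.1 h.2⟩
  · refine ⟨-1, Or.inr rfl, ?_⟩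
    have h1 := key _ _ h.1 h.2
    rw [show (⟨g.im, -g.re⟩ : GaussianInt) = -ii * g by rw [Zsqrtd.ext_iff]; simp [ii],
      mul_pow, neg_sq, ii_sq] at h1
    rw [← dvd_neg]
    convert h1 using 1
    ring

lemma tt_pow_seven_dvd_pow_four_sub {g : GaussianInt} (hg : ¬ tt ∣ g) : tt ^ 7 ∣ g ^ 4 - 1 := by
  have h2 : tt ^ 2 ∣ 2 := ⟨-ii, rfl⟩
  obtain ⟨ε, rfl | rfl, h⟩ := tt_pow_five_dvd_sq_sub_or hg
  · have h1 : tt ^ 2 ∣ g ^ 2 + 1 := by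
      have := dvd_add ((pow_dvd_pow tt (by norm_num : 2 ≤ 5)).trans h) h2
      convert this using 1; ring
    have := mul_dvd_mul h h1
    rw [← pow_add] at this
    convert this using 1; ring
  · have h1 : tt ^ 2 ∣ g ^ 2 - 1 := by
      have := dvd_sub ((pow_dvd_pow tt (by norm_num : 2 ≤ 5)).trans h) h2
      convert this using 1; ring
    have := mul_dvd_mul h h1
    rw [← pow_add] at this
    convert this using 1; ring

variable {v : HeightOneSpectrum GaussianInt}

/-- `Approx v n x g` says that `x ≡ g` modulo the `n`-th power of the maximal ideal. -/
def Approx (v : HeightOneSpectrum GaussianInt) (n : ℕ)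
    (x : v.adicCompletion (FractionRing GaussianInt)) (g : GaussianInt) : Prop :=
  val v (x - emb v g) ≤ exp (-(n : ℤ))

namespace Approx

variable {n : ℕ} {x y : v.adicCompletion (FractionRing GaussianInt)} {g h : GaussianInt}

lemma of_emb (n : ℕ) (g : GaussianInt) : Approx v n (emb v g) g := by
  rw [Approx, sub_self, map_zero]; exact zero_le

lemma val_le_one (hx : Approx v n x g) : val v x ≤ 1 := by
  rw [← sub_add_cancel x (emb v g)]
  refine (Valuation.map_add _ _ _).trans (max_le (hx.trans ?_) (val_emb_le_one g))
  rw [← exp_zero, exp_le_exp]; omega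

lemma add (hx : Approx v n x g) (hy : Approx v n y h) : Approx v n (x + y) (g + h) := by
  rw [Approx, map_add, add_sub_add_comm]
  exact (Valuation.map_add _ _ _).trans (max_le hx hy)

lemma mul (hx : Approx v n x g) (hy : Approx v n y h) : Approx v n (x * y) (g * h) := by
  rw [Approx, map_mul, show x * y - emb v g * emb v h =
    (x - emb v g) * y + emb v g * (y - emb v h) by ring]
  refine (Valuation.map_add _ _ _).trans (max_le ?_ ?_)
  · rw [map_mul]
    exact (mul_le_mul' hx hy.val_le_one).trans (mul_one _).le
  · rw [map_mul]
    exact (mul_le_mul' (val_emb_le_one g) hy).trans (one_mul _).le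

lemma pow (hx : Approx v n x g) (k : ℕ) : Approx v n (x ^ k) (g ^ k) := by
  induction k with
  | zero => simpa using of_emb n 1
  | succ k ih => rw [pow_succ, pow_succ]; exact ih.mul hx

lemma dvd (hv : v.asIdeal = Ideal.span {tt}) (hx : Approx v n x g) (hy : Approx v n x h) :
    tt ^ n ∣ g - h := by
  rw [← val_emb_le_iff hv, map_sub, show emb v g - emb v h =
    (x - emb v h) - (x - emb v g) by ring]
  exact (Valuation.map_sub _ _ _).trans (max_le hy hx)

end Approx

variable (hv : v.asIdeal = Ideal.span {tt})

include hv

lemma exists_approx_of_val_eq_one {x : v.adicCompletion (FractionRing GaussianInt)}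
    (hx : val v x = 1) {n : ℕ} (hn : n ≠ 0) : ∃ g, ¬ tt ∣ g ∧ Approx v n x g := by
  obtain ⟨g, hg⟩ := exists_emb_near x hx.le n
  refine ⟨g, ?_, hg⟩
  rw [← val_emb_eq_one_iff hv, ← hx]
  have : emb v g = x - (x - emb v g) := by ring
  rw [this]
  refine Valuation.map_sub_eq_of_lt_left _ (hg.trans_lt ?_)
  rw [hx, ← exp_zero, exp_lt_exp]; omega

lemma val_four : val v 4 = exp (-4 : ℤ) := by
  rw [show (4 : v.adicCompletion (FractionRing GaussianInt)) = -emb v tt ^ 4 by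
    rw [← map_pow, show tt ^ 4 = -4 from rfl, map_neg, map_ofNat, neg_neg],
    Valuation.map_neg, map_pow, val_uniformizer (by decide) hv, ← exp_nsmul]
  rfl

lemma val_eight : val v 8 = exp (-6 : ℤ) := by
  rw [show (8 : v.adicCompletion (FractionRing GaussianInt)) = emb v (ii * tt ^ 6) by
    rw [show ii * tt ^ 6 = 8 from rfl, map_ofNat], map_mul,
    map_mul, map_pow, map_pow, val_uniformizer (by decide) hv, ← exp_nsmul,
    (val_emb_eq_one_iff hv ii).2 (by rw [tt_dvd_iff]; decide), one_mul]
  rfl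

omit hv in
lemma two_ne_zero_completion : (2 : v.adicCompletion (FractionRing GaussianInt)) ≠ 0 := by
  rw [← map_ofNat (emb v)]
  exact emb_ne_zero two_ne_zero

lemma isSquare_of_approx {x : v.adicCompletion (FractionRing GaussianInt)} {ε : GaussianInt}
    (hε : ε = 1 ∨ ε = -1) (hx : Approx v 5 x ε) : ∃ y, y ^ 2 = x := by
  have key : ∀ x, Approx v 5 x 1 → ∃ y, y ^ 2 = x := by
    intro x hx
    obtain ⟨y, hy, -⟩ := exists_sqrt_of_near (val v) two_ne_zero_completion exists_sq_add_self
      (x := x) (by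
        rw [val_four hv]
        rw [Approx, map_one] at hx
        exact hx.trans_lt (by rw [exp_lt_exp]; norm_num))
    exact ⟨y, hy⟩
  rcases hε with rfl | rfl
  · exact key x hx
  · obtain ⟨y, hy⟩ := key (-x) (by
      have := hx.mul (Approx.of_emb 5 (-1))
      rwa [map_neg, map_one, mul_neg_one, neg_mul_neg, one_mul] at this)
    refine ⟨emb v ii * y, ?_⟩
    rw [mul_pow, hy, ← map_pow, ii_sq]
    simp

lemma exists_pow_four_of_approx {x : v.adicCompletion (FractionRing GaussianInt)}
    (hx : Approx v 7 x 1) : ∃ y, y ^ 4 = x := by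
  refine exists_fourthRoot_of_near (val v) two_ne_zero_completion exists_sq_add_self ?_
  rw [val_eight hv]
  rw [Approx, map_one] at hx
  exact hx.trans_lt (by rw [exp_lt_exp]; norm_num)

lemma approx_div {g h k : GaussianInt} {n : ℕ} (hh : ¬ tt ∣ h) (hd : tt ^ n ∣ g - k * h) :
    Approx v n (emb v g / emb v h) k := by
  have h1 := (val_emb_eq_one_iff hv h).2 hh
  have h0 : emb v h ≠ 0 := emb_ne_zero fun h0 => hh (h0 ▸ dvd_zero _)
  rw [Approx, div_sub' h0, map_div₀, h1, div_one, mul_comm, ← map_mul, ← map_sub]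
  exact (val_emb_le_iff hv _ n).2 hd

lemma exists_unit_of_mul_sq_eq {δ Ω κ : v.adicCompletion (FractionRing GaussianInt)} {n : ℤ}
    (hδ : val v δ = 1) (hκ : val v κ = 1) (h : δ * Ω ^ 2 = emb v tt ^ n * κ) :
    n % 2 = 0 ∧ ∃ ω, val v ω = 1 ∧ δ * ω ^ 2 = κ := by
  have hτ : emb v tt ≠ 0 := emb_ne_zero (by decide)
  have hκ0 : κ ≠ 0 := by rintro rfl; simp at hκ
  have hδ0 : δ ≠ 0 := by rintro rfl; simp at hδ
  have hΩ : Ω ≠ 0 := by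
    rintro rfl
    rw [zero_pow two_ne_zero, mul_zero] at h
    exact mul_ne_zero (zpow_ne_zero _ hτ) hκ0 h.symm
  obtain ⟨l, ω, hω, rfl⟩ := exists_zpow_mul_unit (by decide) hv hΩ
  have hn : n = 2 * l := by
    have := congrArg (val v) h
    rw [map_mul, map_mul, hδ, hκ, map_pow, map_mul, hω, map_zpow₀, map_zpow₀,
      val_uniformizer (by decide) hv, ← exp_zsmul, ← exp_zsmul, mul_one, mul_one, one_mul,
      ← exp_nsmul, exp_inj] at this
    simp at this
    omega
  refine ⟨by omega, ω, hω, mul_left_cancel₀ (zpow_ne_zero n hτ) ?_⟩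
  rw [← h, hn, two_mul, zpow_add₀ hτ]
  ring

end LocalField

namespace LocalField

open WithZero Topology Filter QuarticResidue

variable {v : HeightOneSpectrum GaussianInt} (hv : v.asIdeal = Ideal.span {tt})

variable {b₀ d₀ : GaussianInt} {tb td : ℕ}

include hv

lemma exists_sq_eq_of_dvd {g : GaussianInt} (hd : ¬ tt ∣ d₀)
    {ε : GaussianInt} (hε : ε = 1 ∨ ε = -1) (h : tt ^ 5 ∣ g - ε * d₀) :
    ∃ y, emb v d₀ * y ^ 2 = emb v g := by
  obtain ⟨y, hy⟩ := isSquare_of_approx hv hε (approx_div hv hd h)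
  refine ⟨y, ?_⟩
  rw [hy, mul_div_cancel₀]
  exact emb_ne_zero fun h0 => hd (h0 ▸ dvd_zero _)

lemma quarticSolvable_tt_of_congr (hb : ¬ tt ∣ b₀) (hd : ¬ tt ∣ d₀)
    (h : (tb % 2 = td % 2 ∧ ∃ k ≤ 2, ∃ ε : GaussianInt, (ε = 1 ∨ ε = -1) ∧
            tt ^ 5 ∣ (b₀ - d₀ * (ε - d₀ * tt ^ (4 * k + tb)))) ∨
        (td = 0 ∧ ∃ k ≤ 2, ∃ ε : GaussianInt, (ε = 1 ∨ ε = -1) ∧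
            tt ^ 5 ∣ (tt ^ tb * b₀ * tt ^ (4 * k) - d₀ * (ε - d₀))) ∨
        (tb = 2 * td ∧ td ≤ 1 ∧ ∃ k, 1 ≤ k ∧ k ≤ 4 ∧ ∃ α₀ : GaussianInt, ¬ tt ∣ α₀ ∧
            tt ^ 7 ∣ (b₀ - (-(d₀ * (d₀ - α₀ ^ 2 * tt ^ (2 * k - td))))))) :
    QuarticSolvable (emb v (tt ^ td * d₀)) (emb v (tt ^ tb * b₀) / emb v (tt ^ td * d₀)) := by
  have hτ : emb v tt ≠ 0 := emb_ne_zero (by decide)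
  have hδ : emb v d₀ ≠ 0 := emb_ne_zero fun h0 => hd (h0 ▸ dvd_zero _)
  have hβ : emb v b₀ ≠ 0 := emb_ne_zero fun h0 => hb (h0 ▸ dvd_zero _)
  rcases h with ⟨hpar, k, -, ε, hε, h⟩ | ⟨rfl, k, -, ε, hε, h⟩ | ⟨rfl, htd, k, hk1, -, α, hα, h⟩
  · obtain ⟨y, hy⟩ := exists_sq_eq_of_dvd hv (g := b₀ + d₀ ^ 2 * tt ^ (4 * k + tb)) hd hε (by
      convert h using 1; ring)
    simp only [map_add, map_mul, map_pow] at hy ⊢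
    obtain ⟨s, hs⟩ : ∃ s : ℤ, (tb : ℤ) - td = 2 * s := ⟨(tb - td) / 2, by omega⟩
    refine ⟨emb v tt ^ (k + s), 1, emb v tt ^ s * y, Or.inr one_ne_zero, ?_⟩
    generalize emb v tt = τ at *
    generalize emb v d₀ = δ at *
    generalize emb v b₀ = β at *
    have e1 : τ ^ td * (τ ^ s) ^ 2 = τ ^ tb := by
      rw [← zpow_natCast, ← zpow_natCast, ← zpow_natCast, ← zpow_mul, ← zpow_add₀ hτ]
      congr 1; push_cast; omega
    have e2 : τ ^ td * τ ^ td * (τ ^ (k + s)) ^ 4 = τ ^ tb * τ ^ (4 * k + tb) := by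
      rw [← zpow_natCast, ← zpow_natCast, ← zpow_natCast, ← zpow_natCast, ← zpow_mul,
        ← zpow_add₀ hτ, ← zpow_add₀ hτ, ← zpow_add₀ hτ]
      congr 1; push_cast; omega
    field_simp
    linear_combination δ * y ^ 2 * e1 - δ ^ 2 * e2 + τ ^ tb * hy
  · obtain ⟨y, hy⟩ := exists_sq_eq_of_dvd hv (g := tt ^ tb * b₀ * tt ^ (4 * k) + d₀ ^ 2)
      hd hε (by convert h using 1; ring)
    simp only [map_add, map_mul, map_pow] at hy ⊢
    refine ⟨1, emb v tt ^ k, y, Or.inl one_ne_zero, ?_⟩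
    generalize emb v tt = τ at *
    generalize emb v d₀ = δ at *
    generalize emb v b₀ = β at *
    field_simp
    linear_combination hy
  · have hc : tt ^ 7 ∣ (d₀ * α ^ 2 * tt ^ (2 * k - td) - d₀ ^ 2) - 1 * b₀ := by
      rw [← dvd_neg]; convert h using 1; ring
    obtain ⟨y, hy⟩ := exists_pow_four_of_approx hv (approx_div hv hb hc)
    rw [eq_div_iff hβ] at hy
    simp only [map_sub, map_mul, map_pow] at hy ⊢
    refine ⟨1, y, emb v α * emb v tt ^ k, Or.inl one_ne_zero, ?_⟩
    have e1 : emb v tt ^ td * emb v tt ^ (2 * k - td) = emb v tt ^ (2 * k) := by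
      rw [← pow_add]; congr 1; omega
    generalize emb v tt = τ at *
    generalize emb v d₀ = δ at *
    generalize emb v b₀ = β at *
    have e2 : τ ^ td * (τ ^ td) = τ ^ (2 * td) := by rw [← pow_add]; congr 1; omega
    field_simp
    rw [← e2] at *
    linear_combination -τ ^ td * τ ^ td * hy - δ * emb v α ^ 2 * τ ^ td * e1

omit hv in
lemma val_one_add {x y : v.adicCompletion (FractionRing GaussianInt)} (hx : val v x = 1)
    (hy : val v y < 1) : val v (x + y) = 1 := by
  rw [Valuation.map_add_eq_of_lt_left _ (hx ▸ hy), hx]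

lemma val_pow_uniformizer_lt {n : ℕ} (hn : 0 < n) : val v (emb v tt ^ n) < 1 := by
  rw [map_pow, val_uniformizer (by decide) hv, ← exp_nsmul, ← exp_zero, exp_lt_exp]
  simpa using hn

lemma congr_of_quarticSolvable_tt (htb : tb ≤ 3) (htd : td ≤ 1) (hb : ¬ tt ∣ b₀) (hd : ¬ tt ∣ d₀)
    (h : QuarticSolvable (emb v (tt ^ td * d₀)) (emb v (tt ^ tb * b₀) / emb v (tt ^ td * d₀))) :
    (tb % 2 = td % 2 ∧ ∃ k ≤ 2, ∃ ε : GaussianInt, (ε = 1 ∨ ε = -1) ∧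
            tt ^ 5 ∣ (b₀ - d₀ * (ε - d₀ * tt ^ (4 * k + tb)))) ∨
        (td = 0 ∧ ∃ k ≤ 2, ∃ ε : GaussianInt, (ε = 1 ∨ ε = -1) ∧
            tt ^ 5 ∣ (tt ^ tb * b₀ * tt ^ (4 * k) - d₀ * (ε - d₀))) ∨
        (tb = 2 * td ∧ ∃ k, 1 ≤ k ∧ k ≤ 4 ∧ ∃ α₀ : GaussianInt, ¬ tt ∣ α₀ ∧
            tt ^ 7 ∣ (b₀ - (-(d₀ * (d₀ - α₀ ^ 2 * tt ^ (2 * k - td)))))) := by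
  have hτ : emb v tt ≠ 0 := emb_ne_zero (by decide)
  have hδ : emb v d₀ ≠ 0 := emb_ne_zero fun h0 => hd (h0 ▸ dvd_zero _)
  have hδ1 := (val_emb_eq_one_iff hv d₀).2 hd
  have hβ1 := (val_emb_eq_one_iff hv b₀).2 hb
  obtain ⟨X, Y, W, hXY, h⟩ := h
  have h' : emb v tt ^ td * emb v d₀ * W ^ 2 =
      emb v tt ^ (2 * td) * emb v d₀ ^ 2 * X ^ 4 + emb v tt ^ tb * emb v b₀ * Y ^ 4 := by
    rw [h]; simp only [map_mul, map_pow]; field_simp; ring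
  clear h
  have hδa : ∀ n, Approx v n (emb v d₀) d₀ := fun n => .of_emb n d₀
  have hβa : ∀ n, Approx v n (emb v b₀) b₀ := fun n => .of_emb n b₀
  have hτa : ∀ n, Approx v n (emb v tt) tt := fun n => .of_emb n tt
  have sqcase : ∀ (ω κ : v.adicCompletion (FractionRing GaussianInt)) (K : GaussianInt),
      val v ω = 1 → emb v d₀ * ω ^ 2 = κ → Approx v 5 κ K →
      ∃ ε : GaussianInt, (ε = 1 ∨ ε = -1) ∧ tt ^ 5 ∣ K - d₀ * ε := by
    intro ω κ K hω hκ hK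
    obtain ⟨g, hg, hωg⟩ := exists_approx_of_val_eq_one hv hω (n := 5) (by norm_num)
    obtain ⟨ε, hε, hgε⟩ := tt_pow_five_dvd_sq_sub_or hg
    refine ⟨ε, hε, ?_⟩
    have h1 := hK.dvd hv (hκ ▸ (hδa 5).mul (hωg.pow 2))
    convert dvd_add h1 (hgε.mul_left d₀) using 1
    ring
  rcases eq_or_ne X 0 with rfl | hX
  · have hY : Y ≠ 0 := by tauto
    obtain ⟨y, u, hu, rfl⟩ := exists_zpow_mul_unit (by decide) hv hY
    obtain ⟨hn, ω, hω, he⟩ := exists_unit_of_mul_sq_eq hv (Ω := W / (emb v tt ^ y * u) ^ 2)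
      (n := (tb : ℤ) - td) hδ1 hβ1 (by
        rw [zpow_sub₀ hτ, zpow_natCast, zpow_natCast]
        generalize emb v tt ^ y * u = Y at *
        field_simp
        linear_combination h')
    obtain ⟨ε, hε, hK⟩ := sqcase ω _ b₀ hω he (hβa 5)
    refine Or.inl ⟨by omega, 2, le_rfl, ε, hε, ?_⟩
    convert dvd_add hK ((pow_dvd_pow tt (by omega : 5 ≤ 4 * 2 + tb)).mul_left (d₀ ^ 2)) using 1
    ring
  rcases eq_or_ne Y 0 with rfl | hY
  · obtain ⟨hn, ω, hω, he⟩ := exists_unit_of_mul_sq_eq hv (Ω := W / X ^ 2)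
      (n := (td : ℤ)) (κ := emb v d₀ ^ 2) hδ1 (by rw [map_pow, hδ1, one_pow]) (by
        rw [zpow_natCast]
        field_simp
        refine mul_left_cancel₀ (mul_ne_zero (pow_ne_zero td hτ) hδ) ?_
        linear_combination h')
    obtain ⟨ε, hε, hK⟩ := sqcase ω _ _ hω he ((hδa 5).pow 2)
    refine Or.inr (Or.inl ⟨by omega, 2, le_rfl, ε, hε, ?_⟩)
    convert dvd_add hK ((pow_dvd_pow tt (by omega : 5 ≤ 4 * 2)).mul_left (tt ^ tb * b₀)) using 1
    ring
  obtain ⟨x, X', hX', rfl⟩ := exists_zpow_mul_unit (by decide) hv hX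
  obtain ⟨y, Y', hY', rfl⟩ := exists_zpow_mul_unit (by decide) hv hY
  have hX0 : X' ≠ 0 := right_ne_zero_of_mul hX
  have hu : val v (Y' / X') = 1 := by rw [map_div₀, hX', hY', div_one]
  obtain ⟨w, hw, huw⟩ := exists_approx_of_val_eq_one hv hu (n := 7) (by norm_num)
  have hw4 := tt_pow_seven_dvd_pow_four_sub hw
  have huw5 : Approx v 5 (Y' / X') w := huw.trans (by rw [exp_le_exp]; norm_num)
  have hw45 := (pow_dvd_pow tt (by norm_num : 5 ≤ 7)).trans hw4
  have hΩ : emb v d₀ * (W / X' ^ 2) ^ 2 = emb v tt ^ (td + 4 * x) * emb v d₀ ^ 2 +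
      emb v tt ^ (tb - td + 4 * y) * (emb v b₀ * (Y' / X') ^ 4) := by
    have e1 : emb v tt ^ (td + 4 * x) = emb v tt ^ td * (emb v tt ^ x) ^ 4 := by
      rw [zpow_add₀ hτ, zpow_natCast, mul_comm 4 x, zpow_mul]; norm_cast
    have e2 : emb v tt ^ (tb - td + 4 * y) = emb v tt ^ tb / emb v tt ^ td * (emb v tt ^ y) ^ 4 := by
      rw [zpow_add₀ hτ, zpow_sub₀ hτ, zpow_natCast, zpow_natCast, mul_comm 4 y, zpow_mul]; norm_cast
    rw [e1, e2]
    field_simp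
    linear_combination h'
  have hu4 : val v (emb v b₀ * (Y' / X') ^ 4) = 1 := by
    rw [map_mul, map_pow, hu, hβ1, one_pow, one_mul]
  have hd4 : val v (emb v d₀ ^ 2) = 1 := by rw [map_pow, hδ1, one_pow]
  rcases lt_trichotomy (td + 4 * x) (tb - td + 4 * y : ℤ) with hlt | heq | hgt
  · obtain ⟨e, he⟩ := Int.eq_ofNat_of_zero_le (sub_nonneg.2 hlt.le)
    obtain ⟨hn, ω, hω, hκ⟩ := exists_unit_of_mul_sq_eq hv (Ω := W / X' ^ 2)
      (n := td + 4 * x) (κ := emb v d₀ ^ 2 + emb v tt ^ e * (emb v b₀ * (Y' / X') ^ 4)) hδ1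
      (val_one_add hd4 (by
        rw [map_mul, hu4, mul_one]; exact val_pow_uniformizer_lt hv (by omega))) (by
        rw [hΩ, show (tb - td + 4 * y : ℤ) = (td + 4 * x) + (e : ℤ) by omega, zpow_add₀ hτ _ (e : ℤ),
          zpow_natCast]
        ring)
    obtain ⟨ε, hε, hK⟩ := sqcase ω _ _ hω hκ (((hδa 5).pow 2).add
      (((hτa 5).pow e).mul ((hβa 5).mul (huw5.pow 4))))
    have hK' : tt ^ 5 ∣ tt ^ e * b₀ - d₀ * (ε - d₀) := by
      convert dvd_sub hK (hw45.mul_left (tt ^ e * b₀)) using 1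
      ring
    refine Or.inr (Or.inl ⟨by omega, min ((e - tb) / 4) 2, min_le_right _ _, ε, hε, ?_⟩)
    have : td = 0 := by omega
    obtain ⟨j, hj⟩ : ∃ j, e = tb + 4 * j := ⟨(e - tb) / 4, by omega⟩
    rw [show (e - tb) / 4 = j by omega]
    rcases le_total j 2 with hj2 | hj2
    · rw [min_eq_left hj2]
      convert hK' using 1
      rw [hj]; ring
    · rw [min_eq_right hj2]
      convert dvd_add (dvd_sub hK' ((pow_dvd_pow tt (by omega : 5 ≤ e)).mul_right b₀))
        ((pow_dvd_pow tt (by omega : 5 ≤ 4 * 2)).mul_left (tt ^ tb * b₀)) using 1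
      ring
  · have htb2 : tb = 2 * td := by omega
    refine Or.inr (Or.inr ⟨htb2, ?_⟩)
    rw [← heq, ← mul_add] at hΩ
    have hκa := ((hδa 7).pow 2).add ((hβa 7).mul (huw.pow 4))
    have fin : ∀ k α, Approx v 7 (emb v d₀ ^ 2 + emb v b₀ * (Y' / X') ^ 4)
        (d₀ * α ^ 2 * tt ^ (2 * k - td)) →
        tt ^ 7 ∣ (b₀ - (-(d₀ * (d₀ - α ^ 2 * tt ^ (2 * k - td))))) := by
      intro k α hα
      convert dvd_sub (hκa.dvd hv hα) (hw4.mul_left b₀) using 1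
      ring
    have hone : ¬ tt ∣ 1 := by rw [tt_dvd_iff]; decide
    have hbig : ∀ α, ∀ n : ℕ, 7 ≤ n → tt ^ 7 ∣ d₀ ^ 2 + b₀ * w ^ 4 →
        Approx v 7 (emb v d₀ ^ 2 + emb v b₀ * (Y' / X') ^ 4) (d₀ * α ^ 2 * tt ^ n) := by
      intro α n hn h0
      rw [Approx, show ∀ a b c : v.adicCompletion (FractionRing GaussianInt),
        a - b = (a - c) + (c - b) from fun a b c => by ring,
        ← map_sub]
      refine (Valuation.map_add _ _ _).trans (max_le hκa ((val_emb_le_iff hv _ 7).2 ?_))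
      exact dvd_sub h0 ((pow_dvd_pow tt hn).mul_left _)
    rcases eq_or_ne W 0 with rfl | hW
    · refine ⟨4, by norm_num, le_rfl, 1, hone, fin _ _ (hbig _ _ (by omega) ?_)⟩
      have h0 : emb v d₀ ^ 2 + emb v b₀ * (Y' / X') ^ 4 = emb v 0 := by
        rw [map_zero]
        rw [zero_div, zero_pow two_ne_zero, mul_zero, eq_comm, mul_eq_zero] at hΩ
        exact hΩ.resolve_left (zpow_ne_zero _ hτ)
      have := hκa.dvd hv (h0 ▸ Approx.of_emb 7 0)
      rwa [sub_zero] at this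
    · obtain ⟨l, ω, hω, hWl⟩ := exists_zpow_mul_unit (by decide) hv
        (div_ne_zero hW (pow_ne_zero 2 hX0))
      rw [hWl] at hΩ
      have hκ : emb v d₀ ^ 2 + emb v b₀ * (Y' / X') ^ 4 =
          emb v d₀ * ω ^ 2 * emb v tt ^ (2 * (l - 2 * x) - td) := by
        refine mul_left_cancel₀ (zpow_ne_zero (td + 4 * x) hτ) ?_
        rw [← hΩ, mul_left_comm, ← zpow_add₀ hτ, mul_pow, ← zpow_natCast, ← zpow_mul,
          show td + 4 * x + (2 * (l - 2 * x) - td) = l * (2 : ℕ) by push_cast; ring]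
        ring
      have hpos : 1 ≤ 2 * (l - 2 * x) - td := by
        have h1 : tt ^ 1 ∣ d₀ ^ 2 + b₀ * w ^ 4 := by
          rw [pow_one]
          rw [tt_dvd_iff] at hd hb hw ⊢
          have key : ∀ g h : GaussianInt, (g * h).re + (g * h).im =
              (g.re + g.im) * (h.re + h.im) - 2 * (g.im * h.im) := by
            intro g h; simp; ring
          have hodd : ∀ g h : GaussianInt, (g.re + g.im) % 2 = 1 → (h.re + h.im) % 2 = 1 →
              ((g * h).re + (g * h).im) % 2 = 1 := by
            intro g h hg hh
            rw [key]
            have : ((g.re + g.im) * (h.re + h.im)) % 2 = 1 := by rw [Int.mul_emod, hg, hh]; rfl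
            omega
          have h1 := hodd d₀ d₀ (by omega) (by omega)
          have h2 := hodd w w (by omega) (by omega)
          have h3 := hodd b₀ _ (by omega) (hodd _ _ h2 h2)
          have e : d₀ ^ 2 + b₀ * w ^ 4 = d₀ * d₀ + b₀ * (w * w * (w * w)) := by ring
          rw [e, Zsqrtd.re_add, Zsqrtd.im_add]
          omega
        have h2 : val v (emb v d₀ ^ 2 + emb v b₀ * (Y' / X') ^ 4) ≤ exp (-1 : ℤ) := by
          rw [← sub_add_cancel (emb v d₀ ^ 2 + emb v b₀ * (Y' / X') ^ 4)
            (emb v (d₀ ^ 2 + b₀ * w ^ 4))]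
          refine (Valuation.map_add _ _ _).trans (max_le (hκa.trans ?_)
            ((val_emb_le_iff hv _ 1).2 h1))
          rw [exp_le_exp]; norm_num
        rw [hκ, map_mul, map_mul, hδ1, map_pow, hω, one_pow, one_mul, one_mul, map_zpow₀,
          val_uniformizer (by decide) hv, ← exp_zsmul, exp_le_exp] at h2
        simp at h2
        omega
      obtain ⟨n, hn⟩ := Int.eq_ofNat_of_zero_le (by omega : 0 ≤ l - 2 * x)
      rw [hn, show (2 * (n : ℤ) - td) = ((2 * n - td : ℕ) : ℤ) by omega, zpow_natCast] at hκ
      obtain ⟨α, hα, hωα⟩ := exists_approx_of_val_eq_one hv hω (n := 7) (by norm_num)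
      have hκα := ((hδa 7).mul (hωα.pow 2)).mul ((hτa 7).pow (2 * n - td))
      rw [← hκ] at hκα
      rcases le_total n 4 with hn4 | hn4
      · exact ⟨n, by omega, hn4, α, hα, fin _ _ hκα⟩
      · refine ⟨4, by norm_num, le_rfl, 1, hone, fin _ _ (hbig _ _ (by omega) ?_)⟩
        have := dvd_add (hκa.dvd hv hκα)
          ((pow_dvd_pow tt (by omega : 7 ≤ 2 * n - td)).mul_left (d₀ * α ^ 2))
        rwa [sub_add_cancel] at this
  · obtain ⟨e, he⟩ := Int.eq_ofNat_of_zero_le (sub_nonneg.2 hgt.le)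
    obtain ⟨hn, ω, hω, hκ⟩ := exists_unit_of_mul_sq_eq hv (Ω := W / X' ^ 2)
      (n := tb - td + 4 * y) (κ := emb v b₀ * (Y' / X') ^ 4 + emb v tt ^ e * emb v d₀ ^ 2) hδ1
      (val_one_add hu4 (by
        rw [map_mul, hd4, mul_one]; exact val_pow_uniformizer_lt hv (by omega))) (by
        rw [hΩ, show (td + 4 * x : ℤ) = (tb - td + 4 * y) + (e : ℤ) by omega, zpow_add₀ hτ _ (e : ℤ),
          zpow_natCast]
        ring)
    obtain ⟨ε, hε, hK⟩ := sqcase ω _ _ hω hκ (((hβa 5).mul (huw5.pow 4)).add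
      (((hτa 5).pow e).mul ((hδa 5).pow 2)))
    have hK' : tt ^ 5 ∣ b₀ - d₀ * (ε - d₀ * tt ^ e) := by
      convert dvd_sub hK (hw45.mul_left b₀) using 1
      ring
    obtain ⟨j, hj⟩ : ∃ j, e = 4 * j + tb := ⟨(e - tb) / 4, by omega⟩
    refine Or.inl ⟨by omega, min j 2, min_le_right _ _, ε, hε, ?_⟩
    rcases le_total j 2 with hj2 | hj2
    · rw [min_eq_left hj2, ← hj]
      exact hK'
    · rw [min_eq_right hj2]
      convert dvd_add (dvd_sub hK' ((pow_dvd_pow tt (by omega : 5 ≤ e)).mul_left (d₀ ^ 2)))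
        ((pow_dvd_pow tt (by omega : 5 ≤ 4 * 2 + tb)).mul_left (d₀ ^ 2)) using 1
      ring

end LocalField

namespace QuarticResidue

open LocalField

section Vertex

variable {ι : Type*} [DecidableEq ι] {P : ι → GaussianInt} {v : ι} {e : ι → ZMod 4} {m n : ZMod 4}

lemma lg_mul_prod_erase (hii : Lg (P v) ii n) (htt : Lg (P v) tt m)
    (he : ∀ w, v ≠ w → Lg (P v) (P w) (e w)) (hev : e v = 0) (s t : ℕ) (x : ι → ℕ) (S : Finset ι) :
    Lg (P v) (ii ^ s * tt ^ t * ∏ w ∈ S.erase v, P w ^ x w)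
      (s * n + t * m + ∑ w ∈ S, x w * e w) := by
  have hsum : ∑ w ∈ S.erase v, (x w : ZMod 4) * e w = ∑ w ∈ S, (x w : ZMod 4) * e w :=
    Finset.sum_erase _ (by rw [hev, mul_zero])
  rw [← hsum]
  exact ((hii.pow s).mul (htt.pow t)).mul
    (Lg.prod _ fun w hw => (he w (Finset.ne_of_mem_erase hw).symm).pow (x w))

lemma mul_prod_eq (a : GaussianInt) (x : ι → ℕ) {S : Finset ι} (hv : v ∈ S) :
    a * ∏ w ∈ S, P w ^ x w = P v ^ x v * (a * ∏ w ∈ S.erase v, P w ^ x w) := by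
  rw [← Finset.mul_prod_erase S _ hv]
  ring

variable [Fintype ι] {x : ι → ℕ} {sb tb sd td : ℕ} {S : Finset ι}

lemma hasLocalPoint_iff_lg (hπ : Prime (P v)) (h : IsPrimary (P v))
    (hii : Lg (P v) ii n) (htt : Lg (P v) tt m)
    (he : ∀ w, v ≠ w → Lg (P v) (P w) (e w)) (hev : e v = 0)
    (hd0 : ii ^ sd * tt ^ td * ∏ w ∈ S, P w ≠ 0) (hx : x v = 1 ∨ x v = 2 ∨ x v = 3) :
    HasLocalPoint (ii ^ sb * tt ^ tb * ∏ w, P w ^ x w) (ii ^ sd * tt ^ td * ∏ w ∈ S, P w) (P v) ↔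
      if x v = 2 then
        if v ∈ S then 2 * n + 2 * (sd * n + td * m + ∑ w ∈ S, e w) +
          3 * (sb * n + tb * m + ∑ w, x w * e w) = 0
        else c2 (sd * n + td * m + ∑ w ∈ S, e w) = 0 ∨
          c2 (sb * n + tb * m + ∑ w, x w * e w + (sd * n + td * m + ∑ w ∈ S, e w)) = 0
      else
        if v ∈ S then c2 (sb * n + tb * m + ∑ w, x w * e w + (sd * n + td * m + ∑ w ∈ S, e w)) = 0
        else c2 (sd * n + td * m + ∑ w ∈ S, e w) = 0 := by
  obtain ⟨u, hu⟩ := exists_heightOneSpectrum hπ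
  rw [hasLocalPoint_iff hd0 hu]
  have hb := lg_mul_prod_erase hii htt he hev sb tb x Finset.univ
  have hd := lg_mul_prod_erase hii htt he hev sd td (fun _ => 1) S
  rw [mul_prod_eq _ x (Finset.mem_univ v)]
  simp only [pow_one, Nat.cast_one, one_mul] at hd
  by_cases hvS : v ∈ S
  · have hdv := mul_prod_eq (P := P) (ii ^ sd * tt ^ td) (fun _ => 1) hvS
    simp only [pow_one] at hdv
    rw [hdv, if_pos hvS, if_pos hvS]
    rcases hx with hx | hx | hx <;> rw [hx]
    · exact quarticSolvable_odd_dvd hπ h hu hd hb (r := 0) rfl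
    · exact quarticSolvable_two_dvd hπ h hu hd hb hii
    · exact quarticSolvable_odd_dvd hπ h hu hd hb (r := 2) rfl
  · rw [Finset.erase_eq_of_notMem hvS] at hd
    rw [if_neg hvS, if_neg hvS]
    rcases hx with hx | hx | hx <;> rw [hx]
    · exact quarticSolvable_odd_unit hπ h hu hd hb rfl
    · exact quarticSolvable_two_unit hπ h hu hd hb
    · exact quarticSolvable_odd_unit hπ h hu hd hb rfl

end Vertex

lemma odd_row_iff : ∀ A B Q k D : ZMod 4, ∀ δ : ZMod 2, δ = c2 k →
    (c2 (B + (A + 2 * Q) + (k + D)) = 0 ↔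
      c2 D + (c2 (A + Q) + if c2 Q = c2 B then 0 else 1) = δ) := by
  rintro A B Q k D _ rfl
  simp only [map_add, map_mul, show c2 2 = 0 from rfl]
  generalize c2 A = A, c2 B = B, c2 Q = Q, c2 k = k, c2 D = D
  revert A B Q k D
  decide

lemma even_row_iff (A B Q n k : ZMod 4) (δ D : ZMod 2) (hδ : c2 k = δ + D) (h : c2 A = c2 B) :
    2 * n + 2 * k + 3 * (B + (A + 2 * Q)) = 0 ↔
      D + (c2 (A + Q) + if A = B + 2 * (n + 1) then 1 else 0) = δ := by
  obtain rfl : D = c2 k - δ := by rw [hδ]; ring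
  clear hδ
  revert A B Q n k δ
  decide

lemma c2_eq_zero_of_two_mul (n k l : ZMod 4) (h : 2 * n + 2 * k + 3 * l = 0) : c2 l = 0 := by
  revert n k l
  decide

lemma prime_tt : Prime tt := by
  refine ⟨by decide, by rw [isUnit_iff_dvd_one, tt_dvd_iff]; decide, fun a b h => ?_⟩
  rw [tt_dvd_iff] at *
  rw [← Int.dvd_iff_emod_eq_zero] at *
  rw [tt_dvd_iff, ← Int.dvd_iff_emod_eq_zero]
  refine Int.prime_two.dvd_or_dvd ?_
  rw [Zsqrtd.re_mul, Zsqrtd.im_mul] at h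
  obtain ⟨c, hc⟩ := h
  exact ⟨c + a.im * b.im, by linear_combination hc⟩

lemma not_tt_dvd_of_isPrimary {π : GaussianInt} (h : IsPrimary π) : ¬ tt ∣ π := fun hd =>
  prime_tt.not_dvd_one ((dvd_sub_right hd).1 ((dvd_pow_self tt (by norm_num)).trans h))

lemma not_tt_dvd_ii_pow_mul_prod {ι : Type*} {P : ι → GaussianInt} (hP : ∀ v, IsPrimary (P v))
    (s : ℕ) (x : ι → ℕ) (S : Finset ι) : ¬ tt ∣ ii ^ s * ∏ w ∈ S, P w ^ x w := by
  rw [prime_tt.dvd_mul, not_or]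
  refine ⟨fun h => absurd (prime_tt.dvd_of_dvd_pow h) (by rw [tt_dvd_iff]; decide), fun h => ?_⟩
  obtain ⟨w, -, hw⟩ := (prime_tt.dvd_finsetProd_iff _).1 h
  exact not_tt_dvd_of_isPrimary (hP w) (prime_tt.dvd_of_dvd_pow hw)

lemma degP_eq (E : (Fin M ⊕ Fin N) → (Fin M ⊕ Fin N) → ZMod 4) (r : Fin M → ℕ) (k : ℕ)
    (v : Fin M ⊕ Fin N) : degP E r k v = ∑ i, if r i = k then E v (Sum.inl i) else 0 := by
  rw [degP, degSub, Finset.sum_image Sum.inl_injective.injOn, Finset.sum_filter]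

lemma degQ_eq (E : (Fin M ⊕ Fin N) → (Fin M ⊕ Fin N) → ZMod 4) (v : Fin M ⊕ Fin N) :
    degQ E v = ∑ j, E v (Sum.inr j) := by
  rw [degQ, degSub, Finset.sum_image Sum.inr_injective.injOn]

variable {E : (Fin M ⊕ Fin N) → (Fin M ⊕ Fin N) → ZMod 4} {r : Fin M → ℕ}
  (hr : ∀ i, r i = 1 ∨ r i = 3)

include hr

lemma c2_degSub_univ (v : Fin M ⊕ Fin N) :
    c2 (degSub E Finset.univ v) = c2 (degP E r 1 v + 3 * degP E r 3 v + degQ E v) := by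
  rw [degP_eq, degP_eq, degQ_eq, degSub, Fintype.sum_sum_type, Finset.mul_sum,
    ← Finset.sum_add_distrib, map_add, map_add, map_sum c2, map_sum c2, map_sum c2]
  refine congrArg₂ _ (Finset.sum_congr rfl fun i _ => ?_) rfl
  rcases hr i with h | h <;> simp [h, show c2 3 = 1 from rfl]

lemma sum_exponent_mul_eq (v : Fin M ⊕ Fin N) :
    ∑ w, (Sum.elim r (fun _ => 2) w : ℕ) * E v w =
      degP E r 1 v + 3 * degP E r 3 v + 2 * degQ E v := by
  rw [degP_eq, degP_eq, degQ_eq, Fintype.sum_sum_type, Finset.mul_sum, Finset.mul_sum,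
    ← Finset.sum_add_distrib]
  simp only [Sum.elim_inl, Sum.elim_inr, Nat.cast_ofNat]
  congr 1
  refine Finset.sum_congr rfl fun i _ => ?_
  rcases hr i with h | h <;> simp [h]

end QuarticResidue

open LocalField QuarticResidue

/-- **Statement 13 (Main Theorem).**  With `b = i^{s_b}(1+i)^{t_b} p₁^{r₁}⋯p_M^{r_M} q₁²⋯q_N²`
fourth-power-free and `d = i^{s_d}(1+i)^{t_d} ∏_{v ∈ V_d} v` a square-free divisor of `b`,
let `V'` consist of all `p_i` together with those `q_j` satisfying
`deg^{(1,3)}(q_j) ≡ m_{q_j} t_b + n_{q_j} s_b (mod 2)`, and let `L_b'` be the modified mod-2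
Laplacian indexed by `V'` described in the paper.  Then `C_d(ℚ(i)_v) ≠ ∅` for every prime
`v ∣ (1+i)·b` (equivalently, `d ∈ S^{(φ)}(E_b/ℚ(i))`) iff (0) every prime divisor of `d`
lies in `V'`, (1) `L_b' · 𝟙^{(d)} = y^{(s_d,t_d)}` over `𝔽₂`, and (2) one of the conditions
(A), (B), (C) at `1+i` holds. -/
theorem selmer_membership_criterion
    (M N : ℕ) (p : Fin M → GaussianInt) (q : Fin N → GaussianInt) (r : Fin M → ℕ)
    (sb tb : ℕ) (hsb : sb ≤ 3) (htb : tb ≤ 3) (hr : ∀ i, r i = 1 ∨ r i = 3)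
    (hprime : ∀ v : Fin M ⊕ Fin N, Prime (Sum.elim p q v) ∧ IsPrimary (Sum.elim p q v))
    (hdist : Function.Injective (Sum.elim p q))
    (b : GaussianInt)
    (hb : b = ii ^ sb * tt ^ tb * (∏ i, p i ^ r i) * ∏ j, q j ^ 2)
    (hb4 : FourthPowerFree b)
    (sd td : ℕ) (hsd : sd ≤ 1) (htd : td ≤ 1)
    (Vd : Finset (Fin M ⊕ Fin N)) (d : GaussianInt)
    (hd : d = ii ^ sd * tt ^ td * ∏ v ∈ Vd, Sum.elim p q v)
    (E : (Fin M ⊕ Fin N) → (Fin M ⊕ Fin N) → ZMod 4)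
    (hE : ∀ v w, v ≠ w → Sum.elim p q v ∣
      (Sum.elim p q w ^ (((Sum.elim p q v).norm.natAbs - 1) / 4) - ii ^ (E v w).val))
    (hE0 : ∀ v, E v v = 0)
    (m4 n4 : (Fin M ⊕ Fin N) → ZMod 4)
    (hmn : ∀ v, tt ^ 7 ∣ (Sum.elim p q v -
      (1 - 4 * ii) ^ (m4 v).val * (-1 - 6 * ii) ^ (n4 v).val))
    -- the set `V'` of retained vertices
    (V' : Finset (Fin M ⊕ Fin N))
    (hV' : V' = (Finset.univ.image Sum.inl) ∪
      ((Finset.univ.filter fun j : Fin N =>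
          c2 (degP13 E r (Sum.inr j))
            = c2 (m4 (Sum.inr j)) * (tb : ZMod 2)
              + c2 (n4 (Sum.inr j)) * (sb : ZMod 2)).image Sum.inr))
    -- the modified Laplacian matrix `L_b'`
    (L' : (Fin M ⊕ Fin N) → (Fin M ⊕ Fin N) → ZMod 2)
    (hL'off : ∀ v w, v ≠ w → L' v w = c2 (E v w))
    (hL'diagP : ∀ i : Fin M, L' (Sum.inl i) (Sum.inl i)
      = c2 (degSub E Finset.univ (Sum.inl i)) +
        (if c2 (degQ E (Sum.inl i))
            = c2 (m4 (Sum.inl i)) * (tb : ZMod 2) + c2 (n4 (Sum.inl i)) * (sb : ZMod 2)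
          then 0 else 1))
    (hL'diagQ : ∀ j : Fin N, L' (Sum.inr j) (Sum.inr j)
      = c2 (degSub E Finset.univ (Sum.inr j)) +
        (if degP E r 1 (Sum.inr j) + 3 * degP E r 3 (Sum.inr j)
            = m4 (Sum.inr j) * (tb : ZMod 4) + n4 (Sum.inr j) * (sb : ZMod 4)
              + 2 * (n4 (Sum.inr j) + 1)
          then 1 else 0))
    -- `b₀ = b/(1+i)^{t_b}` and `d₀ = d/(1+i)^{t_d}`
    (b₀ d₀ : GaussianInt)
    (hb₀ : b₀ = ii ^ sb * (∏ i, p i ^ r i) * ∏ j, q j ^ 2)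
    (hd₀ : d₀ = ii ^ sd * ∏ v ∈ Vd, Sum.elim p q v) :
    (HasLocalPoint b d tt ∧ ∀ v : Fin M ⊕ Fin N, HasLocalPoint b d (Sum.elim p q v)) ↔
      (Vd ⊆ V' ∧
       (∀ v ∈ V', (∑ w ∈ V', L' v w * (if w ∈ Vd then 1 else 0))
          = c2 (m4 v) * (td : ZMod 2) + c2 (n4 v) * (sd : ZMod 2)) ∧
       ((tb % 2 = td % 2 ∧ ∃ k ≤ 2, ∃ ε : GaussianInt, (ε = 1 ∨ ε = -1) ∧
            tt ^ 5 ∣ (b₀ - d₀ * (ε - d₀ * tt ^ (4 * k + tb)))) ∨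
        (td = 0 ∧ ∃ k ≤ 2, ∃ ε : GaussianInt, (ε = 1 ∨ ε = -1) ∧
            tt ^ 5 ∣ (b * tt ^ (4 * k) - d₀ * (ε - d₀))) ∨
        (tb = 2 * td ∧ ∃ k, 1 ≤ k ∧ k ≤ 4 ∧ ∃ α₀ : GaussianInt, ¬ tt ∣ α₀ ∧
            tt ^ 7 ∣ (b₀ - (-(d₀ * (d₀ - α₀ ^ 2 * tt ^ (2 * k - td))))))) ) := by
  classical
  set P := Sum.elim p q with hP
  set x : Fin M ⊕ Fin N → ℕ := Sum.elim r (fun _ => 2) with hx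
  have hprod : ∏ w, P w ^ x w = (∏ i, p i ^ r i) * ∏ j, q j ^ 2 := by
    simp [Fintype.prod_sum_type, hP, hx]
  have hb' : b = ii ^ sb * tt ^ tb * ∏ w, P w ^ x w := by rw [hb, hprod]; ring
  have hbtt : b = tt ^ tb * b₀ := by rw [hb, hb₀]; ring
  have hdtt : d = tt ^ td * d₀ := by rw [hd, hd₀]; ring
  have hb₀tt : ¬ tt ∣ b₀ := by
    rw [hb₀, mul_assoc, ← hprod]
    exact not_tt_dvd_ii_pow_mul_prod (fun v => (hprime v).2) sb x Finset.univ
  have hd₀tt : ¬ tt ∣ d₀ := by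
    rw [hd₀]
    simpa using not_tt_dvd_ii_pow_mul_prod (fun v => (hprime v).2) sd (fun _ => 1) Vd
  have hd0 : d ≠ 0 := by
    rw [hdtt]
    exact mul_ne_zero (pow_ne_zero _ prime_tt.ne_zero) fun h => hd₀tt (h ▸ dvd_zero _)
  -- the local condition at `1 + i`
  obtain ⟨u, hu⟩ := exists_heightOneSpectrum prime_tt
  have htt : HasLocalPoint b d tt ↔ _ := ⟨fun h =>
      congr_of_quarticSolvable_tt hu htb htd hb₀tt hd₀tt (by
        rw [← hbtt, ← hdtt]; exact (hasLocalPoint_iff hd0 hu).1 h),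
    fun h => (hasLocalPoint_iff hd0 hu).2 (by
      rw [hbtt, hdtt]
      exact quarticSolvable_tt_of_congr hu hb₀tt hd₀tt (h.imp_right (Or.imp_right
        fun h => ⟨h.1, htd, h.2⟩)))⟩
  rw [htt, ← hbtt, and_comm, ← and_assoc]
  refine and_congr_left fun _ => ?_
  -- the local conditions at the vertices
  have hloc := fun v => hasLocalPoint_iff_lg (S := Vd) (sb := sb) (tb := tb) (sd := sd) (td := td)
    (hprime v).1 (hprime v).2 (lg_ii (hmn v)) (lg_tt (hprime v).1 (hprime v).2 (hmn v))
    (hE v) (hE0 v) (hd ▸ hd0) (x := x) (by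
      rcases v with i | j
      · simpa [hx] using (hr i).imp_right Or.inr
      · simp [hx])
  rw [← hb', ← hd] at hloc
  simp only [hx, sum_exponent_mul_eq hr] at hloc
  have hδ : ∀ v, c2 (sd * n4 v + td * m4 v) = c2 (m4 v) * td + c2 (n4 v) * sd := fun v => by
    simp only [map_add, map_mul, map_natCast]; ring
  have hβ : ∀ v, c2 (sb * n4 v + tb * m4 v) = c2 (m4 v) * tb + c2 (n4 v) * sb := fun v => by
    simp only [map_add, map_mul, map_natCast]; ring
  have hQmem : ∀ j, Sum.inr j ∈ V' ↔ c2 (sb * n4 (Sum.inr j) + tb * m4 (Sum.inr j) +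
      (degP E r 1 (Sum.inr j) + 3 * degP E r 3 (Sum.inr j) + 2 * degQ E (Sum.inr j))) = 0 := by
    intro j
    simp [hV', degP13, hβ, show c2 3 = 1 from rfl, show c2 2 = 0 from rfl]
    rw [CharTwo.add_eq_zero, eq_comm]
  have hPmem : ∀ i, Sum.inl i ∈ V' := fun i => by simp [hV']
  have hrow : Vd ⊆ V' → ∀ v, (∑ w ∈ V', L' v w * (if w ∈ Vd then 1 else 0)) =
      c2 (∑ w ∈ Vd, E v w) + if v ∈ Vd then L' v v else 0 := by
    intro hsub v
    simp only [mul_ite, mul_one, mul_zero]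
    rw [Finset.sum_ite_mem, Finset.inter_eq_right.2 hsub, map_sum, ← Finset.sum_ite_eq Vd v (L' v),
      ← Finset.sum_add_distrib]
    refine Finset.sum_congr rfl fun w _ => ?_
    split_ifs with h
    · rw [← h, hE0, map_zero, zero_add]
    · rw [hL'off v w h, add_zero]
  have hsub : (∀ v, HasLocalPoint b d (P v)) → Vd ⊆ V' := by
    rintro h (i | j) hv
    · exact hPmem i
    · have := (hloc (Sum.inr j)).1 (h _)
      simp only [Sum.elim_inr, if_true, if_pos hv] at this
      exact (hQmem j).2 (c2_eq_zero_of_two_mul _ _ _ this)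
  have hkey : Vd ⊆ V' → ∀ v ∈ V', (HasLocalPoint b d (P v) ↔
      (∑ w ∈ V', L' v w * (if w ∈ Vd then 1 else 0)) = c2 (m4 v) * td + c2 (n4 v) * sd) := by
    intro hs v hv
    rw [hloc, hrow hs, ← hδ]
    rcases v with i | j
    · have hi : x (Sum.inl i) ≠ 2 := by rcases hr i with h | h <;> simp [hx, h]
      rw [if_neg hi]
      by_cases hvd : Sum.inl i ∈ Vd
      · rw [if_pos hvd, if_pos hvd, hL'diagP, c2_degSub_univ hr, ← hβ]
        exact odd_row_iff _ _ _ _ _ _ rfl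
      · rw [if_neg hvd, if_neg hvd, add_zero, map_add, add_comm, CharTwo.add_eq_zero]
    · have hj := (hQmem j).1 hv
      rw [if_pos (by simp)]
      by_cases hvd : Sum.inr j ∈ Vd
      · rw [if_pos hvd, if_pos hvd, hL'diagQ, c2_degSub_univ hr,
          show m4 (Sum.inr j) * (tb : ZMod 4) + n4 (Sum.inr j) * (sb : ZMod 4) =
            sb * n4 (Sum.inr j) + tb * m4 (Sum.inr j) by ring]
        refine even_row_iff _ _ _ _ _ _ _ (map_add c2 _ _) ?_
        rw [map_add, map_add _ _ (2 * _), map_mul, show c2 2 = 0 from rfl, zero_mul, add_zero,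
          CharTwo.add_eq_zero] at hj
        exact hj.symm
      · rw [if_neg hvd, if_neg hvd, add_zero, map_add c2 _ (_ + _ + _), hj, zero_add, or_self,
          map_add, add_comm, CharTwo.add_eq_zero]
  constructor
  · intro h
    exact ⟨hsub h, fun v hv => (hkey (hsub h) v hv).1 (h v)⟩
  · rintro ⟨hs, h⟩ v
    by_cases hv : v ∈ V'
    · exact (hkey hs v hv).2 (h v hv)
    · rcases v with i | j
      · exact absurd (hPmem i) hv
      · rw [hloc]
        simp only [Sum.elim_inr, if_true, if_neg fun hvd => hv (hs hvd)]
        rw [hQmem] at hv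
        rw [map_add c2 _ (_ + _ + _)]
        revert hv
        generalize c2 _ = k
        generalize c2 _ = l
        revert k l
        decide
end
end

section
/- Let b ∈ ℤ[i] be fourth-power-free with factorization b = i^{s_b}(1+i)^{t_b} p₁^{r₁}⋯p_M^{r_M} q₁²⋯q_N² (s_b, t_b ∈ {0,1,2,3}, r_i ∈ {1,3}, the p_i, q_j distinct primary primes). Write s_b = s_{b,0} + 2s_{b,1} and t_b = t_{b,0} + 2t_{b,1} with s_{b,0}, s_{b,1}, t_{b,0}, t_{b,1} ∈ {0,1}, and set d := i^{s_{b,0}}(1+i)^{t_{b,0}} p₁⋯p_M. Then C_d(ℚ(i)_v) ≠ ∅ for every prime v of ℤ[i] dividing (1+i)·b; in particular, d represents an element of the φ-Selmer group S^{(φ)}(E_b/ℚ(i)). -/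
open IsDedekindDomain

noncomputable section

/-- If `b = u² d` with `u` a Gaussian integer, then the points at infinity of `C_d` are rational
over every completion. -/
theorem HasLocalPoint.of_eq_sq_mul {b d u : GaussianInt} (h : u ^ 2 * d = b) (π : GaussianInt) :
    HasLocalPoint b d π := fun v _ =>
  Or.inr ⟨algebraMap GaussianInt (v.adicCompletion (FractionRing GaussianInt)) u, by
    rw [← h, map_mul, map_pow]⟩

/-- Splitting the exponent of a power into its binary digit and its half. -/
theorem pow_half_sq_mul_pow_mod_two {R : Type*} [Monoid R] (x : R) (n : ℕ) :
    (x ^ (n / 2)) ^ 2 * x ^ (n % 2) = x ^ n := by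
  rw [← pow_mul, ← pow_add, Nat.div_add_mod']

/-- **Statement 14.**  Let `b = i^{s_b}(1+i)^{t_b} p₁^{r₁}⋯p_M^{r_M} q₁²⋯q_N²` be
fourth-power-free, write `s_b = s_{b,0} + 2s_{b,1}` and `t_b = t_{b,0} + 2t_{b,1}` with
digits in `{0,1}`, and set `d := i^{s_{b,0}}(1+i)^{t_{b,0}} p₁⋯p_M`.  Then
`C_d(ℚ(i)_v) ≠ ∅` for every prime `v` dividing `(1+i)·b`; in particular `d` represents an
element of the φ-Selmer group `S^{(φ)}(E_b/ℚ(i))`. -/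
theorem selmer_contains_odd_part
    (M N : ℕ) (p : Fin M → GaussianInt) (q : Fin N → GaussianInt) (r : Fin M → ℕ)
    (sb tb : ℕ) (hsb : sb ≤ 3) (htb : tb ≤ 3) (hr : ∀ i, r i = 1 ∨ r i = 3)
    (hprime : ∀ v : Fin M ⊕ Fin N, Prime (Sum.elim p q v) ∧ IsPrimary (Sum.elim p q v))
    (hdist : Function.Injective (Sum.elim p q))
    (b : GaussianInt)
    (hb : b = ii ^ sb * tt ^ tb * (∏ i, p i ^ r i) * ∏ j, q j ^ 2)
    (hb4 : FourthPowerFree b)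
    (d : GaussianInt)
    (hd : d = ii ^ (sb % 2) * tt ^ (tb % 2) * ∏ i, p i) :
    HasLocalPoint b d tt ∧ ∀ v : Fin M ⊕ Fin N, HasLocalPoint b d (Sum.elim p q v) := by
  have hp : (∏ i, p i ^ (r i / 2)) ^ 2 * ∏ i, p i = ∏ i, p i ^ r i := by
    rw [← Finset.prod_pow, ← Finset.prod_mul_distrib]
    refine Finset.prod_congr rfl fun i _ => ?_
    have hmod : r i % 2 = 1 := by
      rcases hr i with h | h <;> simp [h]
    simpa only [hmod, pow_one] using pow_half_sq_mul_pow_mod_two (p i) (r i)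
  have hsq : (ii ^ (sb / 2) * tt ^ (tb / 2) * (∏ i, p i ^ (r i / 2)) * ∏ j, q j) ^ 2 * d = b := by
    rw [hb, hd, ← pow_half_sq_mul_pow_mod_two ii sb, ← pow_half_sq_mul_pow_mod_two tt tb, ← hp,
      Finset.prod_pow]
    ring
  exact ⟨.of_eq_sq_mul hsq _, fun _ => .of_eq_sq_mul hsq _⟩
end
end

section
/- Suppose b = (−1)^{s_{b,1}}(1+i)^{2t_{b,1}} q₁²⋯q_N² with s_{b,1}, t_{b,1} ∈ {0,1} and q₁, …, q_N distinct primary primes each congruent to 1 modulo (1+i)⁷. Let d = i^{s_d}(1+i)^{t_d} ∏_{j ∈ S} q_j be a square-free divisor of b (s_d, t_d ∈ {0,1}, S ⊆ {1,…,N}). Then C_d(ℚ(i)_{(1+i)}) ≠ ∅ if and only if: (s_d, t_d) ∈ {(0,0),(1,0)} when (s_{b,1}, t_{b,1}) = (0,0); (s_d, t_d) ∈ {(0,0),(1,1)} when (s_{b,1}, t_{b,1}) = (0,1); (s_d, t_d) ∈ {(0,0),(1,0)} when (s_{b,1}, t_{b,1}) = (1,0); and (s_d, t_d) ∈ {(0,0),(0,1)}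 when (s_{b,1}, t_{b,1}) = (1,1). -/
open IsDedekindDomain

noncomputable section

open WithZero Filter Topology

/-- In a complete field with a `ℤᵐ⁰`-valued valuation, `1 + 4c` is a square when `c` has
valuation less than `1`. -/
theorem Valued.exists_sq_eq_one_add_four_mul {K : Type*} [Field K] [Valued K ℤᵐ⁰]
    [CompleteSpace K] {c : K} (hc : Valued.v c < 1) : ∃ x : K, x ^ 2 = 1 + 4 * c := by
  let y : ℕ → K := fun n => Nat.rec 0 (fun _ x => c - x ^ 2) n
  have hy : ∀ n, y (n + 1) = c - y n ^ 2 := fun _ => rfl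
  have hbound : ∀ n, Valued.v (y n) ≤ Valued.v c := by
    intro n
    induction n with
    | zero => simp [y]
    | succ n ih =>
      rw [hy]
      refine (Valuation.map_sub _ _ _).trans (max_le le_rfl ?_)
      rw [map_pow, pow_two]
      exact (mul_le_of_le_one_left' (ih.trans hc.le)).trans ih
  have hstep : ∀ n, Valued.v (y (n + 1) - y n) ≤ Valued.v (c ^ n) := by
    intro n
    induction n with
    | zero => simpa [y] using hc.le
    | succ n ih =>
      have h : y (n + 1 + 1) - y (n + 1) = -((y (n + 1) - y n) * (y (n + 1) + y n)) := by
        rw [hy (n + 1)]; nth_rewrite 2 [hy n]; ring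
      rw [h, Valuation.map_neg, map_mul, pow_succ, map_mul]
      exact mul_le_mul' ih ((Valuation.map_add _ _ _).trans (max_le (hbound (n + 1)) (hbound n)))
  have hlim : Tendsto (fun n => y (n + 1) - y n) atTop (𝓝 0) := by
    have h := Valued.tendsto_zero_pow_of_v_lt_one hc
    simp only [(Valued.hasBasis_nhds_zero _ _).tendsto_right_iff] at h ⊢
    intro γ hγ
    filter_upwards [h γ hγ] with n hn
    exact ((Valuation.restrict_le_iff _).mpr (hstep n)).trans_lt hn
  have hna : NonarchimedeanRing K := by
    rw [Valued.toUniformSpace_eq K ℤᵐ⁰]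
    exact RingSubgroupsBasis.nonarchimedean _
  have hcau : CauchySeq y := NonarchimedeanAddGroup.cauchySeq_of_tendsto_sub_nhds_zero hlim
  obtain ⟨L, hL⟩ := cauchySeq_tendsto_of_complete hcau
  have h1 : Tendsto (fun n => y (n + 1)) atTop (𝓝 L) := (tendsto_add_atTop_iff_nat 1).mpr hL
  have h2 : Tendsto (fun n => y (n + 1)) atTop (𝓝 (c - L ^ 2)) := (hL.pow 2).const_sub c
  have h3 := tendsto_nhds_unique h1 h2
  exact ⟨1 + 2 * L, by linear_combination 4 * h3⟩

namespace IsDedekindDomain.HeightOneSpectrum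

/-- An integral element of the completion is congruent to a global integer. -/
theorem exists_valued_sub_algebraMap_lt_one {R : Type*} [CommRing R] [IsDedekindDomain R]
    (K : Type*) [Field K] [Algebra R K] [IsFractionRing R K] (v : HeightOneSpectrum R)
    {x : v.adicCompletion K} (hx : Valued.v x ≤ 1) :
    ∃ r : R, Valued.v (x - algebraMap R _ r) < 1 := by
  have hnhds : {y : v.adicCompletion K | Valued.v (y - x) < 1} ∈ 𝓝 x := by
    rw [Valued.mem_nhds]
    exact ⟨1, fun y hy => (Valuation.restrict_lt_one_iff _).mp hy⟩
  obtain ⟨k, hk⟩ := (denseRange_algebraMap (K := K) (v := v)).exists_mem_open isOpen_interior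
    ⟨x, mem_interior_iff_mem_nhds.mpr hnhds⟩
  have hk : Valued.v (algebraMap K (v.adicCompletion K) k - x) < 1 :=
    interior_subset (s := {y : v.adicCompletion K | Valued.v (y - x) < 1}) hk
  have hk1 : Valued.v (algebraMap K (v.adicCompletion K) k) ≤ 1 := by
    have := Valuation.map_add Valued.v (algebraMap K (v.adicCompletion K) k - x) x
    rw [sub_add_cancel] at this
    exact this.trans (max_le hk.le hx)
  have hval : ∀ k : K, Valued.v (algebraMap K (v.adicCompletion K) k) = v.valuation K k :=
    fun k => valuedAdicCompletion_eq_valuation' v k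
  rw [hval] at hk1
  obtain ⟨r, hr⟩ := exists_valuation_sub_lt_of_integer v hk1 1
  refine ⟨r, ?_⟩
  rw [← hval, map_sub, ← IsScalarTower.algebraMap_apply] at hr
  rw [Valuation.map_sub_swap,
    ← sub_add_sub_cancel _ (algebraMap K (v.adicCompletion K) k) x]
  exact Valuation.map_add_lt _ hr hk

end IsDedekindDomain.HeightOneSpectrum

namespace WithZero

theorem le_exp_neg_one_of_lt_one {x : ℤᵐ⁰} (hx : x < 1) : x ≤ exp (-1 : ℤ) := by
  rcases eq_or_ne x 0 with rfl | h
  · exact zero_le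
  · rw [← exp_log h] at hx ⊢
    rw [← exp_zero, exp_lt_exp] at hx
    rw [exp_le_exp]
    omega

theorem exp_neg_one_mul_sq_ne_sq {a g : ℤᵐ⁰} (hg : g ≠ 0) :
    exp (-1 : ℤ) * a ^ 2 ≠ g ^ 2 := by
  intro h
  have ha : a ≠ 0 := by
    rintro rfl
    rw [zero_pow two_ne_zero, mul_zero] at h
    exact pow_ne_zero 2 hg h.symm
  have := congrArg log h
  rw [log_mul exp_ne_zero (pow_ne_zero 2 ha), log_pow, log_pow, log_exp] at this
  simp only [nsmul_eq_mul] at this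
  omega

end WithZero

section LocalField

theorem exists_eq_mul_of_valuation_lt_one {K : Type*} [Field K] {V : Valuation K ℤᵐ⁰} {P : K}
    (hP : V P = exp (-1 : ℤ)) {s : K} (hs : V s < 1) : ∃ t, V t ≤ 1 ∧ s = P * t := by
  have hP0 : P ≠ 0 := by
    rintro rfl
    rw [map_zero] at hP
    exact exp_ne_zero hP.symm
  refine ⟨s / P, ?_, by field_simp⟩
  rw [map_div₀, hP]
  exact div_le_one_of_le₀ (le_exp_neg_one_of_lt_one hs) zero_le

theorem valuation_eq_one_of_sq_eq_neg_one {K : Type*} [Field K] {V : Valuation K ℤᵐ⁰} {I : K}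
    (hI : I ^ 2 = -1) : V I = 1 := by
  have h := congrArg V hI
  rw [map_pow, Valuation.map_neg, map_one] at h
  exact (pow_eq_one_iff_of_nonneg zero_le two_ne_zero).mp h

/-- An element of odd valuation is not a square, not even after multiplication by an element of
even valuation. -/
theorem sq_ne_mul_uniformizer_mul {K : Type*} [Field K] {V : Valuation K ℤᵐ⁰} {P : K}
    (hP : V P = exp (-1 : ℤ)) {c w x : K} (hc : V c = 1) {g : ℤᵐ⁰} (hg : g ≠ 0)
    (hx : V x = g ^ 2) : w ^ 2 ≠ c * P * x := by
  intro h
  have h := congrArg V h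
  rw [map_pow, map_mul, map_mul, hc, one_mul, hP, hx] at h
  refine exp_neg_one_mul_sq_ne_sq (a := g) (g := V w) ?_ h.symm
  intro h0
  rw [h0, zero_pow two_ne_zero] at h
  exact mul_ne_zero exp_ne_zero (pow_ne_zero 2 hg) h.symm

variable {K : Type*} [Field K]

theorem two_eq_neg_mul_sq {I : K} (hI : I ^ 2 = -1) : (2 : K) = -I * (1 + I) ^ 2 := by
  linear_combination (2 + I) * hI

/-- `1 + z⁴` always has even valuation. -/
theorem exists_valuation_one_add_pow_four_eq_sq {V : Valuation K ℤᵐ⁰} {I : K}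
    (hI : I ^ 2 = -1) (hP : V (1 + I) = exp (-1 : ℤ))
    (hres : ∀ x, V x ≤ 1 → V x < 1 ∨ V (x - 1) < 1) (z : K) :
    ∃ g ≠ 0, V (1 + z ^ 4) = g ^ 2 := by
  have hVI := valuation_eq_one_of_sq_eq_neg_one (V := V) hI
  have hP1 : V (1 + I) < 1 := by rw [hP, ← exp_zero, exp_lt_exp]; norm_num
  rcases le_or_gt (V z) 1 with hz | hz
  · rcases hres z hz with hz | hz
    · refine ⟨1, one_ne_zero, ?_⟩
      rw [one_pow, Valuation.map_one_add_of_lt]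
      rw [map_pow]
      exact pow_lt_one₀ zero_le hz four_ne_zero
    · obtain ⟨a, ha, hza⟩ := exists_eq_mul_of_valuation_lt_one hP hz
      have ha2 : V (a ^ 2) ≤ 1 := by rw [map_pow]; exact pow_le_one₀ zero_le ha
      have hPa : V (I * (1 + I) * a) ≤ 1 := by
        rw [map_mul, map_mul, hVI, one_mul]; exact mul_le_one' hP1.le ha
      have hc : V (a ^ 2 - I * (1 + I) * a) ≤ 1 :=
        (Valuation.map_sub _ _ _).trans (max_le ha2 hPa)
      set c := a ^ 2 - I * (1 + I) * a with hcdef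
      have hm : V (I * (1 + I) ^ 2 * (c ^ 2 - I * c)) < 1 := by
        rw [map_mul, map_mul, hVI, one_mul, map_pow]
        refine mul_lt_one_of_lt_of_le (pow_lt_one₀ zero_le hP1 two_ne_zero) ?_
        refine (Valuation.map_sub _ _ _).trans (max_le ?_ ?_)
        · rw [map_pow]; exact pow_le_one₀ zero_le hc
        · rw [map_mul, hVI, one_mul]; exact hc
      have h2 := two_eq_neg_mul_sq hI
      have hz2 : z ^ 2 = 1 + (1 + I) ^ 2 * c := by
        have : z = 1 + (1 + I) * a := by linear_combination hza
        rw [this, hcdef]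
        linear_combination (1 + I) * a * h2
      have hz4 : 1 + z ^ 4 = -I * (1 + I) ^ 2 * (1 + I * (1 + I) ^ 2 * (c ^ 2 - I * c)) := by
        have : z ^ 4 = (z ^ 2) ^ 2 := by ring
        rw [this, hz2]
        linear_combination (1 + (1 + I) ^ 2 * c) * h2 +
          (1 + I) ^ 4 * (c ^ 2 - I * c) * hI
      refine ⟨V (1 + I), by rw [hP]; exact exp_ne_zero, ?_⟩
      rw [hz4, map_mul, Valuation.map_one_add_of_lt _ hm, mul_one, map_mul, Valuation.map_neg,
        hVI, one_mul, map_pow]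
  · refine ⟨V z ^ 2, pow_ne_zero 2 (zero_lt_one.trans hz).ne', ?_⟩
    have hz4 : V 1 < V (z ^ 4) := by
      rw [map_one, map_pow]
      exact one_lt_pow₀ hz four_ne_zero
    rw [Valuation.map_add_eq_of_lt_right _ hz4, map_pow, ← pow_mul]

theorem sq_ne_mul_one_add_sq_mul {V : Valuation K ℤᵐ⁰} {I : K}
    (hI : I ^ 2 = -1) (hP : V (1 + I) = exp (-1 : ℤ))
    (hres : ∀ x, V x ≤ 1 → V x < 1 ∨ V (x - 1) < 1) {w x : K} (hx : V x ≤ 1) :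
    w ^ 2 ≠ I * (1 + (1 + I) ^ 2 * x) := by
  intro h
  have hVI := valuation_eq_one_of_sq_eq_neg_one (V := V) hI
  have hP0 : (1 + I) ≠ 0 := by
    intro h0
    rw [h0, map_zero] at hP
    exact exp_ne_zero hP.symm
  have hP1 : V (1 + I) < 1 := by rw [hP, ← exp_zero, exp_lt_exp]; norm_num
  have hw : V w = 1 := by
    have hV := congrArg V h
    rw [map_pow, map_mul, hVI, one_mul, Valuation.map_one_add_of_lt] at hV
    · exact (pow_eq_one_iff_of_nonneg zero_le two_ne_zero).mp hV
    · rw [map_mul, map_pow]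
      exact mul_lt_one_of_lt_of_le (pow_lt_one₀ zero_le hP1 two_ne_zero) hx
  have hw1 : V (w - 1) < 1 := (hres w hw.le).resolve_left hw.not_lt
  obtain ⟨a, ha, hwa⟩ := exists_eq_mul_of_valuation_lt_one hP hw1
  have key : -I = (1 + I) * (I * ((1 + I) * a) - a ^ 2 + I * x) := by
    apply mul_left_cancel₀ hP0
    have h2 := two_eq_neg_mul_sq hI
    have : w = 1 + (1 + I) * a := by linear_combination hwa
    rw [this] at h
    linear_combination h - (1 + I) * a * h2 - hI
  have hlt : V I < 1 := by
    rw [← Valuation.map_neg, key, map_mul]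
    refine mul_lt_one_of_lt_of_le hP1 ?_
    refine (Valuation.map_add _ _ _).trans (max_le ?_ ?_)
    · refine (Valuation.map_sub _ _ _).trans (max_le ?_ ?_)
      · rw [map_mul, map_mul, hVI, one_mul]; exact mul_le_one' hP1.le ha
      · rw [map_pow]; exact pow_le_one₀ zero_le ha
    · rw [map_mul, hVI, one_mul]; exact hx
  exact hlt.ne hVI

theorem mul_sq_ne_sq_add_mul_pow_four {V : Valuation K ℤᵐ⁰} {P : K} (hP : V P = exp (-1 : ℤ))
    {c ε w z : K} (hc : V c = 1) (hε : V ε = 1) :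
    c * P * w ^ 2 ≠ (c * P) ^ 2 + ε * z ^ 4 := by
  intro h
  have hcP : V ((c * P) ^ 2) = exp (-1 : ℤ) ^ 2 := by
    rw [map_pow, map_mul, hc, one_mul, hP]
  have hεz : V (ε * z ^ 4) = (V z ^ 2) ^ 2 := by
    rw [map_mul, hε, one_mul, map_pow, ← pow_mul]
  have hne : exp (-1 : ℤ) ≠ V z ^ 2 := by
    rcases eq_or_ne (V z) 0 with hz | hz
    · rw [hz, zero_pow two_ne_zero]
      exact exp_ne_zero
    · simpa using exp_neg_one_mul_sq_ne_sq (a := 1) hz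
  have hg : ∃ g ≠ 0, V ((c * P) ^ 2 + ε * z ^ 4) = g ^ 2 := by
    rcases lt_or_gt_of_ne hne with hlt | hlt
    · refine ⟨V z ^ 2, (exp_pos.trans hlt).ne', ?_⟩
      rw [Valuation.map_add_eq_of_lt_right _ ?_, hεz]
      rw [hcP, hεz]
      exact pow_lt_pow_left₀ hlt zero_le two_ne_zero
    · refine ⟨exp (-1), exp_ne_zero, ?_⟩
      rw [Valuation.map_add_eq_of_lt_left _ ?_, hcP]
      rw [hcP, hεz]
      exact pow_lt_pow_left₀ hlt zero_le two_ne_zero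
  obtain ⟨g, hg0, hg⟩ := hg
  rw [← h, map_mul, map_mul, hc, one_mul, hP, map_pow] at hg
  exact exp_neg_one_mul_sq_ne_sq hg0 hg

theorem sq_ne_mul_one_add_mul_sq_mul_pow_four {V : Valuation K ℤᵐ⁰} {I : K}
    (hI : I ^ 2 = -1) (hP : V (1 + I) = exp (-1 : ℤ))
    (hres : ∀ x, V x ≤ 1 → V x < 1 ∨ V (x - 1) < 1) {ε w z : K} (hε : ε = 1 ∨ ε = -1) :
    w ^ 2 ≠ I * (1 + ε * (1 + I) ^ 2 * z ^ 4) := by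
  intro h
  have hVε : V ε = 1 := by rcases hε with rfl | rfl <;> simp
  rcases le_or_gt (V z) 1 with hz | hz
  · refine sq_ne_mul_one_add_sq_mul hI hP hres (w := w) (x := ε * z ^ 4) ?_ ?_
    · rw [map_mul, hVε, one_mul, map_pow]
      exact pow_le_one₀ zero_le hz
    · rw [h]; ring
  · have hP0 : 1 + I ≠ 0 := by
      intro h0
      rw [h0, map_zero] at hP
      exact exp_ne_zero hP.symm
    have hz0 : z ≠ 0 := by
      rintro rfl
      rw [map_zero] at hz
      exact not_lt_zero hz
    have hinv : V z⁻¹ < 1 := by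
      rw [map_inv₀]
      exact inv_lt_one_of_one_lt₀ hz
    obtain ⟨y, hy, hzy⟩ := exists_eq_mul_of_valuation_lt_one hP hinv
    have hzy : (1 + I) * y * z = 1 := by rw [← hzy, inv_mul_cancel₀ hz0]
    have hsq : (w * (1 + I) * y ^ 2) ^ 2 = ε * I * (1 + (1 + I) ^ 2 * (ε * y ^ 4)) := by
      have hε2 : ε ^ 2 = 1 := by rcases hε with rfl | rfl <;> ring
      have h4 : ((1 + I) * y) ^ 4 * z ^ 4 = 1 := by rw [← mul_pow, hzy, one_pow]
      linear_combination (1 + I) ^ 2 * y ^ 4 * h + I * ε * h4 - I * (1 + I) ^ 2 * y ^ 4 * hε2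
    have hx : V (ε * y ^ 4) ≤ 1 := by
      rw [map_mul, hVε, one_mul, map_pow]
      exact pow_le_one₀ zero_le hy
    rcases hε with rfl | rfl
    · exact sq_ne_mul_one_add_sq_mul hI hP hres hx (hsq.trans (by ring))
    · refine sq_ne_mul_one_add_sq_mul hI hP hres hx
        (w := I * (w * (1 + I) * y ^ 2)) ?_
      rw [mul_pow, hI, hsq]
      ring

/-- Local solubility of `d w² = d² + b z⁴` (or of `b = d u²`) for `d = i^m (1+i)^n` and
`b = (-1)^s (1+i)^(2t)`. -/
theorem local_solvability_iff {V : Valuation K ℤᵐ⁰} {I : K}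
    (hI : I ^ 2 = -1) (hP : V (1 + I) = exp (-1 : ℤ))
    (hres : ∀ x, V x ≤ 1 → V x < 1 ∨ V (x - 1) < 1)
    {s t m n : ℕ} (hs : s ≤ 1) (ht : t ≤ 1) (hm : m ≤ 1) (hn : n ≤ 1) {d b : K}
    (hd : d = I ^ m * (1 + I) ^ n) (hb : b = (-1) ^ s * (1 + I) ^ (2 * t)) :
    ((∃ z w, d * w ^ 2 = d ^ 2 + b * z ^ 4) ∨ ∃ u, u ^ 2 * d = b) ↔
      (((s, t) = (0, 0) ∧ ((m, n) = (0, 0) ∨ (m, n) = (1, 0))) ∨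
       ((s, t) = (0, 1) ∧ ((m, n) = (0, 0) ∨ (m, n) = (1, 1))) ∨
       ((s, t) = (1, 0) ∧ ((m, n) = (0, 0) ∨ (m, n) = (1, 0))) ∨
       ((s, t) = (1, 1) ∧ ((m, n) = (0, 0) ∨ (m, n) = (0, 1)))) := by
  have hVI := valuation_eq_one_of_sq_eq_neg_one (V := V) hI
  have hP0 : 1 + I ≠ 0 := by
    intro h0
    rw [h0, map_zero] at hP
    exact exp_ne_zero hP.symm
  have hI0 : I ≠ 0 := by
    rintro rfl
    simp at hI
  have hVd : V (I ^ m) = 1 := by rw [map_pow, hVI, one_pow]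
  have hVs : V ((-1) ^ s) = 1 := by rw [map_pow, Valuation.map_neg, map_one, one_pow]
  have hinf : n = 1 → ¬ ∃ u, u ^ 2 * d = b := by
    rintro rfl ⟨u, hu⟩
    have hV := congrArg V hu
    rw [hd, hb, map_mul, map_mul, hVd, one_mul, map_mul, hVs, one_mul, pow_one, mul_comm 2 t,
      pow_mul, map_pow _ (_ ^ _), map_pow _ u, hP, mul_comm] at hV
    exact exp_neg_one_mul_sq_ne_sq (by rw [map_pow, hP]; exact pow_ne_zero _ exp_ne_zero) hV
  have hzero : t = 0 → n = 1 → ¬ ∃ z w, d * w ^ 2 = d ^ 2 + b * z ^ 4 := by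
    rintro rfl rfl ⟨z, w, h⟩
    rw [hd, hb, pow_one, mul_zero, pow_zero, mul_one] at h
    exact mul_sq_ne_sq_add_mul_pow_four hP hVd hVs h
  have hunit : t = 1 → n = 0 → m = 1 →
      ¬ ((∃ z w, d * w ^ 2 = d ^ 2 + b * z ^ 4) ∨ ∃ u, u ^ 2 * d = b) := by
    rintro rfl rfl rfl
    have hε : ∀ s : ℕ, -(-1 : K) ^ s = 1 ∨ -(-1 : K) ^ s = -1 := fun s => by
      rcases neg_one_pow_eq_or K s with h | h <;> simp [h]
    rw [pow_one, pow_zero, mul_one] at hd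
    rw [mul_one] at hb
    rw [hd, hb]
    rintro (⟨z, w, h⟩ | ⟨u, h⟩)
    · refine sq_ne_mul_one_add_mul_sq_mul_pow_four hI hP hres (hε s) (w := w) (z := z) ?_
      apply mul_left_cancel₀ hI0
      linear_combination h + (-1) ^ s * (1 + I) ^ 2 * z ^ 4 * hI
    · have hu0 : u ≠ 0 := by
        rintro rfl
        rw [zero_pow two_ne_zero, zero_mul] at h
        exact mul_ne_zero (pow_ne_zero s (neg_ne_zero.mpr one_ne_zero)) (pow_ne_zero 2 hP0) h.symm
      have hnot : ∀ w : K, w ^ 2 ≠ I := fun w hw =>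
        sq_ne_mul_one_add_sq_mul hI hP hres (w := w) (x := 0) (by simp) (by simpa using hw)
      rcases neg_one_pow_eq_or K s with hs1 | hs1 <;> rw [hs1] at h
      · refine hnot ((1 + I) / u) ?_
        rw [div_pow, div_eq_iff (pow_ne_zero 2 hu0)]
        linear_combination -h
      · refine hnot (I * ((1 + I) / u)) ?_
        rw [mul_pow, hI, div_pow, mul_div_assoc', div_eq_iff (pow_ne_zero 2 hu0)]
        linear_combination -h
  have hodd : ∀ c w z : K, V c = 1 → w ^ 2 ≠ c * (1 + I) * (1 + z ^ 4) := fun c w z hc => by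
    obtain ⟨g, hg0, hg⟩ := exists_valuation_one_add_pow_four_eq_sq hI hP hres z
    exact sq_ne_mul_uniformizer_mul hP hc hg0 hg
  obtain rfl | rfl : s = 0 ∨ s = 1 := by omega
  all_goals obtain rfl | rfl : t = 0 ∨ t = 1 := by omega
  all_goals obtain rfl | rfl : m = 0 ∨ m = 1 := by omega
  all_goals obtain rfl | rfl : n = 0 ∨ n = 1 := by omega
  all_goals simp only [Prod.mk.injEq, zero_ne_one, one_ne_zero, and_true, and_false, or_false,
    or_true, iff_true, iff_false, forall_const, not_or,
    IsEmpty.forall_iff] at hinf hzero hunit ⊢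
  all_goals first | exact hunit | exact ⟨hzero, hinf⟩ | skip
  all_goals simp only [pow_zero, pow_one, mul_one, one_mul, mul_zero] at hd hb
  all_goals simp only [hd, hb] at hinf ⊢
  · exact Or.inl ⟨0, 1, by ring⟩
  · exact Or.inl ⟨1, 0, by linear_combination -hI⟩
  · exact Or.inl ⟨0, 1, by ring⟩
  · refine ⟨fun ⟨z, w, h⟩ => hodd 1 w z (map_one V) ?_, hinf⟩
    apply mul_left_cancel₀ hP0
    linear_combination h
  · exact Or.inl ⟨1, 0, by linear_combination -(1 + I) ^ 2 * hI⟩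
  · exact Or.inl ⟨0, 1, by ring⟩
  · exact Or.inl ⟨1, 1 + I, by linear_combination (I + 1) * hI⟩
  · exact Or.inl ⟨0, 1, by ring⟩
  · exact Or.inl ⟨1, 0, by ring⟩
  · refine ⟨fun ⟨z, w, h⟩ => hodd I w z hVI ?_, hinf⟩
    apply mul_left_cancel₀ (mul_ne_zero hI0 hP0)
    linear_combination h - (1 + I) ^ 2 * z ^ 4 * hI

end LocalField

theorem tt_dvd_iff {x : GaussianInt} : tt ∣ x ↔ 2 ∣ x.re + x.im := by
  constructor
  · rintro ⟨y, rfl⟩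
    simp only [tt, ii, Zsqrtd.re_mul, Zsqrtd.im_mul, Zsqrtd.re_add, Zsqrtd.im_add,
      Zsqrtd.re_one, Zsqrtd.im_one]
    omega
  · rintro ⟨k, hk⟩
    refine ⟨⟨k, k - x.re⟩, ?_⟩
    ext <;> simp only [tt, ii, Zsqrtd.re_mul, Zsqrtd.im_mul, Zsqrtd.re_add, Zsqrtd.im_add,
      Zsqrtd.re_one, Zsqrtd.im_one] <;> omega

theorem tt_dvd_or_dvd_sub_one (x : GaussianInt) : tt ∣ x ∨ tt ∣ x - 1 := by
  simp only [tt_dvd_iff, Zsqrtd.re_sub, Zsqrtd.im_sub, Zsqrtd.re_one, Zsqrtd.im_one]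
  omega

theorem not_tt_dvd_one : ¬ tt ∣ 1 := by
  rw [tt_dvd_iff]
  simp

theorem prime_tt : Prime tt := by
  refine ⟨fun h => not_tt_dvd_one ?_, fun h => not_tt_dvd_one h.dvd, fun a b hab => ?_⟩
  · have := congrArg Zsqrtd.im h
    simp [tt, ii] at this
  · by_contra! h
    have ha := (tt_dvd_or_dvd_sub_one a).resolve_left h.1
    have hb := (tt_dvd_or_dvd_sub_one b).resolve_left h.2
    apply not_tt_dvd_one
    have h1 : (1 : GaussianInt) = a * b - (a - 1) * b - (b - 1) := by ring
    rw [h1]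
    exact dvd_sub (dvd_sub hab (ha.mul_right b)) hb

theorem ii_sq : ii ^ 2 = -1 := by
  ext <;> simp [ii, pow_two]

theorem tt_pow_four : tt ^ 4 = -4 := by
  rw [tt]
  linear_combination (ii ^ 2 + 4 * ii + 5) * ii_sq

theorem tt_pow_dvd_prod_sub_one {ι : Type*} {q : ι → GaussianInt} {n : ℕ}
    (hq : ∀ j, tt ^ n ∣ q j - 1) (S : Finset ι) : tt ^ n ∣ ∏ j ∈ S, q j - 1 := by
  refine Finset.prod_induction q (fun x => tt ^ n ∣ x - 1) (fun a b ha hb => ?_) (by simp)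
    fun j _ => hq j
  have h : a * b - 1 = (a - 1) * b + (b - 1) := by ring
  rw [h]
  exact dvd_add (ha.mul_right b) hb

section Completion

variable {v : HeightOneSpectrum GaussianInt}

theorem valued_algebraMap_gaussianInt (r : GaussianInt) :
    Valued.v (algebraMap GaussianInt (v.adicCompletion (FractionRing GaussianInt)) r) =
      v.intValuation r :=
  (v.valuedAdicCompletion_eq_valuation r).trans (v.valuation_of_algebraMap r)

theorem valued_algebraMap_lt_one_iff (hv : v.asIdeal = Ideal.span {tt}) (r : GaussianInt) :
    Valued.v (algebraMap GaussianInt (v.adicCompletion (FractionRing GaussianInt)) r) < 1 ↔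
      tt ∣ r := by
  rw [valued_algebraMap_gaussianInt, HeightOneSpectrum.intValuation_lt_one_iff_mem, hv,
    Ideal.mem_span_singleton]

/-- Gaussian integers congruent to `1` modulo `(1+i)⁵` are squares in the completion at `1+i`. -/
theorem exists_sq_eq_algebraMap (hv : v.asIdeal = Ideal.span {tt}) {x : GaussianInt}
    (hx : tt ^ 5 ∣ x - 1) : ∃ y : v.adicCompletion (FractionRing GaussianInt), y ≠ 0 ∧ y ^ 2 =
      algebraMap GaussianInt (v.adicCompletion (FractionRing GaussianInt)) x := by
  obtain ⟨m, hm⟩ := hx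
  have hx : x = 1 + 4 * (-(tt * m)) := by linear_combination hm + tt * m * tt_pow_four
  obtain ⟨y, hy⟩ := Valued.exists_sq_eq_one_add_four_mul
    ((valued_algebraMap_lt_one_iff hv _).mpr (((dvd_refl tt).mul_right m).neg_right))
  have hyx : y ^ 2 =
      algebraMap GaussianInt (v.adicCompletion (FractionRing GaussianInt)) x := by
    rw [hy, hx, map_add, map_one, map_mul, map_ofNat]
  refine ⟨y, ?_, hyx⟩
  rintro rfl
  have h0 : tt ∣ x := by
    rw [← valued_algebraMap_lt_one_iff hv, ← hyx, zero_pow two_ne_zero, map_zero]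
    exact zero_lt_one
  refine not_tt_dvd_one ((dvd_sub_right h0).mp ?_)
  rw [hm]
  exact (dvd_pow_self tt (by norm_num)).mul_right m

theorem valued_lt_one_or_valued_sub_one_lt_one (hv : v.asIdeal = Ideal.span {tt})
    {x : v.adicCompletion (FractionRing GaussianInt)}
    (hx : Valued.v x ≤ 1) : Valued.v x < 1 ∨ Valued.v (x - 1) < 1 := by
  obtain ⟨r, hr⟩ := v.exists_valued_sub_algebraMap_lt_one (FractionRing GaussianInt) hx
  refine (tt_dvd_or_dvd_sub_one r).imp (fun h => ?_) (fun h => ?_) <;>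
    rw [← valued_algebraMap_lt_one_iff hv] at h
  · simpa using Valuation.map_add_lt _ hr h
  · rw [map_sub, map_one] at h
    simpa using Valuation.map_add_lt _ hr h

end Completion

/-- Removing square factors from `d` and `b` and the factor `4 = -(1+i)⁴` in the equation defining
`C_d`. -/
theorem exists_quartic_iff_of_mul_sq {K : Type*} [Field K] {I d b e r D B : K}
    (hI : I ^ 2 = -1) (hP : 1 + I ≠ 0) (he : e ≠ 0) (hr : r ≠ 0)
    (hD : D = d * e ^ 2) (hB : B = b * r ^ 4) :
    ((∃ z w, D * w ^ 2 = D ^ 2 - 4 * B * z ^ 4) ∨ ∃ u, u ^ 2 * D = B) ↔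
      ((∃ z w, d * w ^ 2 = d ^ 2 + b * z ^ 4) ∨ ∃ u, u ^ 2 * d = b) := by
  have h4 : (1 + I) ^ 4 = -4 := by linear_combination (I ^ 2 + 4 * I + 5) * hI
  have h40 : (4 : K) ≠ 0 := by
    rw [← neg_ne_zero, ← h4]
    exact pow_ne_zero 4 hP
  subst hD hB
  refine or_congr ⟨fun ⟨z, w, h⟩ => ⟨(1 + I) * r * z / e, w / e, ?_⟩,
    fun ⟨z, w, h⟩ => ⟨e * z / ((1 + I) * r), e * w, ?_⟩⟩
    ⟨fun ⟨u, h⟩ => ⟨u * e / r ^ 2, ?_⟩, fun ⟨u, h⟩ => ⟨u * r ^ 2 / e, ?_⟩⟩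
  · simp only [div_pow, mul_pow, h4]
    field_simp
    linear_combination h
  · simp only [div_pow, mul_pow, h4]
    field_simp
    linear_combination h
  · field_simp
    linear_combination h
  · field_simp
    linear_combination h

/-- Solubility at `1 + i` may be tested on any completion attached to the ideal `(1 + i)`. -/
theorem hasLocalPoint_tt_iff {b d : GaussianInt} {p : Prop}
    (h : ∀ v : HeightOneSpectrum GaussianInt, v.asIdeal = Ideal.span {tt} →
      (((∃ z w : v.adicCompletion (FractionRing GaussianInt),
        algebraMap GaussianInt _ d * w ^ 2
          = (algebraMap GaussianInt _ d) ^ 2 - 4 * algebraMap GaussianInt _ b * z ^ 4)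
      ∨ (∃ u : v.adicCompletion (FractionRing GaussianInt),
        u ^ 2 * algebraMap GaussianInt _ d = algebraMap GaussianInt _ b)) ↔ p)) :
    HasLocalPoint b d tt ↔ p := by
  have htt : (Ideal.span {tt} : Ideal GaussianInt).IsPrime :=
    (Ideal.span_singleton_prime prime_tt.ne_zero).mpr prime_tt
  let v₀ : HeightOneSpectrum GaussianInt :=
    ⟨Ideal.span {tt}, htt, by simpa using prime_tt.ne_zero⟩
  exact ⟨fun hb => (h v₀ rfl).mp (hb v₀ rfl), fun hp v hv => (h v hv).mpr hp⟩

/-- **Statement 16.**  Suppose `b = (−1)^{s_{b,1}}(1+i)^{2t_{b,1}} q₁²⋯q_N²` with the `q_j`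
distinct primary primes congruent to `1` mod `(1+i)⁷`, and let
`d = i^{s_d}(1+i)^{t_d} ∏_{j ∈ S} q_j` be a square-free divisor of `b`.  Then
`C_d(ℚ(i)_{(1+i)}) ≠ ∅` iff `(s_d, t_d)` lies in the two-element set determined by
`(s_{b,1}, t_{b,1})` as in the paper. -/
theorem lsc_at_one_add_i_square_case
    (N : ℕ) (q : Fin N → GaussianInt) (sb1 tb1 : ℕ) (hs : sb1 ≤ 1) (ht : tb1 ≤ 1)
    (hprime : ∀ j, Prime (q j) ∧ IsPrimary (q j))
    (hq7 : ∀ j, tt ^ 7 ∣ (q j - 1))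
    (hdist : Function.Injective q)
    (b : GaussianInt)
    (hb : b = (-1) ^ sb1 * tt ^ (2 * tb1) * ∏ j, q j ^ 2)
    (sd td : ℕ) (hsd : sd ≤ 1) (htd : td ≤ 1)
    (S : Finset (Fin N)) (d : GaussianInt)
    (hd : d = ii ^ sd * tt ^ td * ∏ j ∈ S, q j) :
    HasLocalPoint b d tt ↔
      (((sb1, tb1) = (0, 0) ∧ ((sd, td) = (0, 0) ∨ (sd, td) = (1, 0))) ∨
       ((sb1, tb1) = (0, 1) ∧ ((sd, td) = (0, 0) ∨ (sd, td) = (1, 1))) ∨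
       ((sb1, tb1) = (1, 0) ∧ ((sd, td) = (0, 0) ∨ (sd, td) = (1, 0))) ∨
       ((sb1, tb1) = (1, 1) ∧ ((sd, td) = (0, 0) ∨ (sd, td) = (0, 1)))) := by
  refine hasLocalPoint_tt_iff fun v hv => ?_
  let f := algebraMap GaussianInt (v.adicCompletion (FractionRing GaussianInt))
  have hft : f tt = 1 + f ii := by rw [tt, map_add, map_one]
  have hI : f ii ^ 2 = -1 := by rw [← map_pow, ii_sq, map_neg, map_one]
  have hP : Valued.v (1 + f ii) = WithZero.exp (-1 : ℤ) := by
    rw [← hft, valued_algebraMap_gaussianInt, v.intValuation_singleton prime_tt.ne_zero hv]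
  have hP0 : 1 + f ii ≠ 0 := by
    intro h0
    rw [h0, map_zero] at hP
    exact WithZero.exp_ne_zero hP.symm
  have hq5 : ∀ j, tt ^ 5 ∣ q j - 1 := fun j => (pow_dvd_pow tt (by norm_num)).trans (hq7 j)
  obtain ⟨e, he, heD⟩ := exists_sq_eq_algebraMap hv (tt_pow_dvd_prod_sub_one hq5 S)
  obtain ⟨r, hr, hrQ⟩ := exists_sq_eq_algebraMap hv (tt_pow_dvd_prod_sub_one hq5 Finset.univ)
  have hfd : f d = f ii ^ sd * (1 + f ii) ^ td * e ^ 2 := by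
    rw [heD, hd, map_mul, map_mul, map_pow, map_pow, hft]
  have hfb : f b = (-1) ^ sb1 * (1 + f ii) ^ (2 * tb1) * r ^ 4 := by
    have : r ^ 4 = (r ^ 2) ^ 2 := by ring
    rw [this, hrQ, hb, map_mul, map_mul, map_pow, map_pow, hft, map_neg, map_one,
      Finset.prod_pow, map_pow]
  exact (exists_quartic_iff_of_mul_sq hI hP0 he hr hfd hfb).trans
    (local_solvability_iff hI hP (fun _ => valued_lt_one_or_valued_sub_one_lt_one hv)
      hs ht hsd htd rfl rfl)
end
end
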